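/- Let N ≥ 3, let p ≥ q > 0 with pq > 1, and let a, b > −2. Assume the quadruple (p,q,a,b) is subcritical and, in the case N ≥ 4, assume additionally that 0 ≤ a − b ≤ (N−2)(p−q). Let (u,v) be a nonnegative solution of the Hénon–Lane–Emden system (HLE) such that either both u and v are polynomially bounded, or ∫_{ℝ^N} (|x|^b u(x)^{q+1} + |x|^a v(x)^{p+1}) dx < ∞. If α > N − 3, then u ≡ 0 and v ≡ 0 on ℝ^N. -/

import Mathlib

open MeasureTheory Metric Set

noncomputable section

/-- Euclidean space `ℝ^N`. -/
abbrev Euc (N : ℕ) := EuclideanSpace ℝ (Fin N)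

/-- The Laplacian of a function `f : ℝ^N → ℝ`, as the sum of the pure second
partial derivatives. -/
def lap {N : ℕ} (f : Euc N → ℝ) (x : Euc N) : ℝ :=
  ∑ i : Fin N, iteratedFDeriv ℝ 2 f x ![EuclideanSpace.single i 1, EuclideanSpace.single i 1]

/-- `(u, v)` is a solution of the Hénon–Lane–Emden system
`-Δu = |x|^a |v|^{p-1} v`, `-Δv = |x|^b |u|^{q-1} u` on `ℝ^N \ {0}`:
`u, v` are `C²` on `ℝ^N \ {0}`, continuous on `ℝ^N`, and satisfy the equations pointwise. -/
def IsHLESol {N : ℕ} (p q a b : ℝ) (u v : Euc N → ℝ) : Prop :=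
  ContDiffOn ℝ 2 u {x : Euc N | x ≠ 0} ∧ ContDiffOn ℝ 2 v {x : Euc N | x ≠ 0} ∧
  Continuous u ∧ Continuous v ∧
  (∀ x : Euc N, x ≠ 0 → -lap u x = ‖x‖ ^ a * (|v x| ^ (p - 1) * v x)) ∧
  (∀ x : Euc N, x ≠ 0 → -lap v x = ‖x‖ ^ b * (|u x| ^ (q - 1) * u x))

/-- Stability of a (positive) solution of the Hénon–Lane–Emden system on an open set `Ω`:
there exist positive `C²` functions `ξ, ζ` on `Ω` with
`-Δξ ≥ p |x|^a v^{p-1} ζ` and `-Δζ ≥ q |x|^b u^{q-1} ξ` on `Ω`. -/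
def HLEStableOn {N : ℕ} (p q a b : ℝ) (u v : Euc N → ℝ) (Ω : Set (Euc N)) : Prop :=
  ∃ ξ ζ : Euc N → ℝ, ContDiffOn ℝ 2 ξ Ω ∧ ContDiffOn ℝ 2 ζ Ω ∧
    (∀ x ∈ Ω, 0 < ξ x) ∧ (∀ x ∈ Ω, 0 < ζ x) ∧
    (∀ x ∈ Ω, p * ‖x‖ ^ a * v x ^ (p - 1) * ζ x ≤ -lap ξ x) ∧
    (∀ x ∈ Ω, q * ‖x‖ ^ b * u x ^ (q - 1) * ξ x ≤ -lap ζ x)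

/-- Stability outside a compact set `K`: stability on every open set whose closure is
compact and contained in `ℝ^N \ K`. -/
def HLEStableOutside {N : ℕ} (p q a b : ℝ) (u v : Euc N → ℝ) (K : Set (Euc N)) : Prop :=
  IsCompact K ∧
    ∀ Ω : Set (Euc N), IsOpen Ω → IsCompact (closure Ω) → closure Ω ⊆ Kᶜ →
      HLEStableOn p q a b u v Ω

/-- `(u, v)` solves the Lane–Emden system `-Δu = |v|^{p-1} v`, `-Δv = |u|^{q-1} u` on `ℝ^N`. -/
def IsLESol {N : ℕ} (p q : ℝ) (u v : Euc N → ℝ) : Prop :=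
  (∀ x : Euc N, -lap u x = |v x| ^ (p - 1) * v x) ∧
  (∀ x : Euc N, -lap v x = |u x| ^ (q - 1) * u x)

/-- Stability of a (positive) solution of the Lane–Emden system on an open set `Ω`. -/
def LEStableOn {N : ℕ} (p q : ℝ) (u v : Euc N → ℝ) (Ω : Set (Euc N)) : Prop :=
  ∃ ξ ζ : Euc N → ℝ, ContDiffOn ℝ 2 ξ Ω ∧ ContDiffOn ℝ 2 ζ Ω ∧
    (∀ x ∈ Ω, 0 < ξ x) ∧ (∀ x ∈ Ω, 0 < ζ x) ∧
    (∀ x ∈ Ω, p * v x ^ (p - 1) * ζ x ≤ -lap ξ x) ∧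
    (∀ x ∈ Ω, q * u x ^ (q - 1) * ξ x ≤ -lap ζ x)

/-- A function on `ℝ^N` is polynomially bounded. -/
def PolyBounded {N : ℕ} (w : Euc N → ℝ) : Prop :=
  ∃ K L R : ℝ, 0 < K ∧ 0 < L ∧ ∀ x : Euc N, R ≤ ‖x‖ → |w x| ≤ K * ‖x‖ ^ L

/-- The polynomial `G` from Theorem 1.4 (iii). -/
def Gpoly (p q x : ℝ) : ℝ :=
  x ^ 4 - (4 * p * q * (q + 1) / (p + 1)) * x ^ 2 +
    (2 * p * q * (q + 1) * (p + q + 2) / (p + 1) ^ 2) * x -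
    p * q * (q + 1) ^ 2 / (p + 1) ^ 2

/-- The `i`-th partial derivative of a function on `ℝ^N`. -/
def pd {N : ℕ} (i : Fin N) (f : Euc N → ℝ) (x : Euc N) : ℝ :=
  fderiv ℝ f x (EuclideanSpace.single i 1)

section PartialDerivatives

variable {N : ℕ}

lemma pd_congr {f g : Euc N → ℝ} {x : Euc N} (h : f =ᶠ[nhds x] g) (i : Fin N) :
    pd i f x = pd i g x := by
  simp only [pd, h.fderiv_eq]

lemma pd_eventuallyEq {f g : Euc N → ℝ} {x : Euc N} (h : f =ᶠ[nhds x] g) (i : Fin N) :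
    pd i f =ᶠ[nhds x] pd i g := by
  filter_upwards [h.eventuallyEq_nhds] with y hy using pd_congr hy i

lemma contDiffAt_pd {f : Euc N → ℝ} {x : Euc N} {m n : ℕ} (hmn : m + 1 ≤ n)
    (hf : ContDiffAt ℝ n f x) (i : Fin N) : ContDiffAt ℝ m (pd i f) x := by
  have : ContDiffAt ℝ m (fderiv ℝ f) x := hf.fderiv_right (by exact_mod_cast hmn)
  exact this.clm_apply contDiffAt_const

lemma contDiff_pd {f : Euc N → ℝ} {m n : ℕ} (hmn : m + 1 ≤ n)
    (hf : ContDiff ℝ n f) (i : Fin N) : ContDiff ℝ m (pd i f) :=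
  contDiff_iff_contDiffAt.2 fun _ => contDiffAt_pd hmn hf.contDiffAt i

lemma pd_pd_eq {f : Euc N → ℝ} {x : Euc N} (hf : ContDiffAt ℝ 2 f x) (i j : Fin N) :
    pd i (pd j f) x = fderiv ℝ (fderiv ℝ f) x (EuclideanSpace.single i 1)
      (EuclideanSpace.single j 1) := by
  have h1 : ContDiffAt ℝ 1 (fderiv ℝ f) x := hf.fderiv_right (by norm_num)
  have h2 : DifferentiableAt ℝ (fderiv ℝ f) x := h1.differentiableAt (by norm_num)
  unfold pd
  rw [fderiv_clm_apply h2 (differentiableAt_const _)]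
  simp

lemma pd_comm {f : Euc N → ℝ} {x : Euc N} (hf : ContDiffAt ℝ 2 f x) (i j : Fin N) :
    pd i (pd j f) x = pd j (pd i f) x := by
  rw [pd_pd_eq hf, pd_pd_eq hf]
  exact (hf.isSymmSndFDerivAt (by simp)).eq _ _

lemma lap_eq_sum_pd {f : Euc N → ℝ} {x : Euc N} (hf : ContDiffAt ℝ 2 f x) :
    lap f x = ∑ i, pd i (pd i f) x := by
  unfold lap
  refine Finset.sum_congr rfl fun i _ => ?_
  rw [pd_pd_eq hf, iteratedFDeriv_two_apply]
  simp

lemma lap_congr {f g : Euc N → ℝ} {x : Euc N} (h : f =ᶠ[nhds x] g) : lap f x = lap g x := by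
  simp only [lap, (h.iteratedFDeriv ℝ 2).eq_of_nhds]

lemma continuous_lap {f : Euc N → ℝ} (hf : ContDiff ℝ 2 f) : Continuous (lap f) := by
  unfold lap
  have := hf.continuous_iteratedFDeriv (m := 2) (by norm_num)
  fun_prop

lemma fderiv_apply_eq_sum_pd (f : Euc N → ℝ) (x v : Euc N) :
    fderiv ℝ f x v = ∑ i, v i * pd i f x := by
  have h : v = ∑ i, v i • (EuclideanSpace.single i 1 : Euc N) := by
    ext j
    simp [Finset.sum_apply, Pi.single_apply]
  conv_lhs => rw [h]
  simp [map_sum, pd]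

lemma pd_add {f g : Euc N → ℝ} {x : Euc N} (hf : DifferentiableAt ℝ f x)
    (hg : DifferentiableAt ℝ g x) (i : Fin N) :
    pd i (fun y => f y + g y) x = pd i f x + pd i g x := by
  simp [pd, fderiv_fun_add hf hg]

lemma pd_sub {f g : Euc N → ℝ} {x : Euc N} (hf : DifferentiableAt ℝ f x)
    (hg : DifferentiableAt ℝ g x) (i : Fin N) :
    pd i (fun y => f y - g y) x = pd i f x - pd i g x := by
  simp [pd, fderiv_fun_sub hf hg]

lemma pd_mul {f g : Euc N → ℝ} {x : Euc N} (hf : DifferentiableAt ℝ f x)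
    (hg : DifferentiableAt ℝ g x) (i : Fin N) :
    pd i (fun y => f y * g y) x = pd i f x * g x + f x * pd i g x := by
  simp [pd, fderiv_fun_mul hf hg]
  ring

lemma pd_const_mul {f : Euc N → ℝ} {x : Euc N} (hf : DifferentiableAt ℝ f x) (c : ℝ)
    (i : Fin N) : pd i (fun y => c * f y) x = c * pd i f x := by
  simp [pd, fderiv_const_mul hf]

lemma pd_sum {ι : Type*} {s : Finset ι} {f : ι → Euc N → ℝ} {x : Euc N}
    (hf : ∀ j ∈ s, DifferentiableAt ℝ (f j) x) (i : Fin N) :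
    pd i (fun y => ∑ j ∈ s, f j y) x = ∑ j ∈ s, pd i (f j) x := by
  simp [pd, fderiv_fun_sum hf]

lemma pd_comp {g : ℝ → ℝ} {f : Euc N → ℝ} {x : Euc N} (hf : DifferentiableAt ℝ f x)
    {g' : ℝ} (hg : HasDerivAt g g' (f x)) (i : Fin N) :
    pd i (fun y => g (f y)) x = g' * pd i f x := by
  have := (hg.comp_hasFDerivAt x hf.hasFDerivAt).fderiv
  unfold pd
  change fderiv ℝ (g ∘ f) x _ = _
  rw [this]; simp

lemma pd_coord (i j : Fin N) (x : Euc N) :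
    pd i (fun y : Euc N => y j) x = if i = j then 1 else 0 := by
  have : HasFDerivAt (fun y : Euc N => y j) (EuclideanSpace.proj j : Euc N →L[ℝ] ℝ) x :=
    (EuclideanSpace.proj j : Euc N →L[ℝ] ℝ).hasFDerivAt
  unfold pd
  rw [this.fderiv]
  simp [PiLp.single_apply, eq_comm]

lemma pd_comp_affine {f : Euc N → ℝ} (x : Euc N) (s : ℝ) (z : Euc N)
    (hf : DifferentiableAt ℝ f (x + s • z)) (i : Fin N) :
    pd i (fun y => f (x + s • y)) z = s * pd i f (x + s • z) := by
  have h1 : HasFDerivAt (fun y : Euc N => x + s • y) (s • ContinuousLinearMap.id ℝ (Euc N)) z :=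
    ((hasFDerivAt_id z).const_smul s).const_add x
  have h2 := (hf.hasFDerivAt.comp z h1).fderiv
  unfold pd
  change fderiv ℝ (f ∘ fun y => x + s • y) z _ = _
  rw [h2]; simp

/-- Integration by parts against a compactly supported function. -/
lemma integral_mul_pd {f g : Euc N → ℝ} (hf : ContDiff ℝ 1 f) (hg : ContDiff ℝ 1 g)
    (hs : HasCompactSupport g) (i : Fin N) :
    ∫ x, f x * pd i g x = -∫ x, pd i f x * g x := by
  have cf : Continuous (pd i f) := (contDiff_pd (m := 0) le_rfl hf i).continuous
  have cg : Continuous (pd i g) := (contDiff_pd (m := 0) le_rfl hg i).continuous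
  have hs' : HasCompactSupport (pd i g) := hs.fderiv_apply (𝕜 := ℝ) _
  refine integral_mul_fderiv_eq_neg_fderiv_mul_of_integrable ?_ ?_ ?_ ?_ ?_
  · exact (cf.mul hg.continuous).integrable_of_hasCompactSupport hs.mul_left
  · exact (hf.continuous.mul cg).integrable_of_hasCompactSupport hs'.mul_left
  · exact (hf.continuous.mul hg.continuous).integrable_of_hasCompactSupport hs.mul_left
  · exact fun x _ => hf.differentiable (by norm_num) x
  · exact fun x _ => hg.differentiable (by norm_num) x

end PartialDerivatives

section Bump

variable {N : ℕ}

/-- A smooth radial bump function supported in the closed unit ball. -/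
def bump (z : Euc N) : ℝ := expNegInvGlue (1 - ‖z‖ ^ 2)

/-- The radial bump function `θ` with `z θ(z) = -∇ bump(z)`. -/
def bumpWeight (z : Euc N) : ℝ := 2 * deriv expNegInvGlue (1 - ‖z‖ ^ 2)

lemma expNegInvGlue_hasDerivAt (x : ℝ) :
    HasDerivAt expNegInvGlue ((x⁻¹) ^ 2 * expNegInvGlue x) x := by
  have := expNegInvGlue.hasDerivAt_polynomial_eval_inv_mul 1 x
  simpa using this

lemma bumpWeight_eq (z : Euc N) :
    bumpWeight z = 2 * (((1 - ‖z‖ ^ 2)⁻¹) ^ 2 * expNegInvGlue (1 - ‖z‖ ^ 2)) := by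
  rw [bumpWeight, (expNegInvGlue_hasDerivAt _).deriv]

lemma contDiff_bump {n : ℕ} : ContDiff ℝ n (bump : Euc N → ℝ) := by
  have h : ContDiff ℝ n expNegInvGlue := expNegInvGlue.contDiff (n := (n : ℕ∞))
  exact h.comp (contDiff_const.sub (contDiff_norm_sq ℝ))

lemma contDiff_bumpWeight {n : ℕ} : ContDiff ℝ n (bumpWeight : Euc N → ℝ) := by
  have h0 : ContDiff ℝ ((n + 1 : ℕ) : WithTop ℕ∞) expNegInvGlue :=
    expNegInvGlue.contDiff (n := ((n + 1 : ℕ) : ℕ∞))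
  have h : ContDiff ℝ n (deriv expNegInvGlue) := by
    have := (contDiff_succ_iff_deriv (n := (n : WithTop ℕ∞)) (f := expNegInvGlue)).1
      (by exact_mod_cast h0)
    exact this.2.2
  exact contDiff_const.mul (h.comp (contDiff_const.sub (contDiff_norm_sq ℝ)))

lemma bump_nonneg (z : Euc N) : 0 ≤ bump z := expNegInvGlue.nonneg _

lemma bumpWeight_nonneg (z : Euc N) : 0 ≤ bumpWeight z := by
  rw [bumpWeight_eq]
  have := expNegInvGlue.nonneg (1 - ‖z‖ ^ 2)
  positivity

lemma bump_pos {z : Euc N} (hz : ‖z‖ < 1) : 0 < bump z :=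
  expNegInvGlue.pos_of_pos (by nlinarith [norm_nonneg z])

lemma bumpWeight_pos {z : Euc N} (hz : ‖z‖ < 1) : 0 < bumpWeight z := by
  rw [bumpWeight_eq]
  have h : 0 < 1 - ‖z‖ ^ 2 := by nlinarith [norm_nonneg z]
  have := expNegInvGlue.pos_of_pos h
  positivity

lemma bump_eq_zero {z : Euc N} (hz : 1 ≤ ‖z‖) : bump z = 0 :=
  expNegInvGlue.zero_of_nonpos (by nlinarith [norm_nonneg z])

lemma bumpWeight_eq_zero {z : Euc N} (hz : 1 ≤ ‖z‖) : bumpWeight z = 0 := by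
  rw [bumpWeight_eq, expNegInvGlue.zero_of_nonpos (by nlinarith [norm_nonneg z])]
  simp

lemma hasCompactSupport_of_norm {f : Euc N → ℝ} {R : ℝ} (h : ∀ z, R ≤ ‖z‖ → f z = 0) :
    HasCompactSupport f := by
  refine HasCompactSupport.of_support_subset_isCompact (isCompact_closedBall 0 R) fun z hz => ?_
  by_contra hc
  simp only [mem_closedBall, dist_zero_right, not_le] at hc
  exact hz (h z hc.le)

lemma hasCompactSupport_bump : HasCompactSupport (bump : Euc N → ℝ) :=
  hasCompactSupport_of_norm (R := 1) fun _ h => bump_eq_zero h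

lemma hasCompactSupport_bumpWeight : HasCompactSupport (bumpWeight : Euc N → ℝ) :=
  hasCompactSupport_of_norm (R := 1) fun _ h => bumpWeight_eq_zero h

lemma pd_norm_sq (i : Fin N) (z : Euc N) : pd i (fun y => ‖y‖ ^ 2) z = 2 * z i := by
  unfold pd
  rw [(hasStrictFDerivAt_norm_sq z).hasFDerivAt.fderiv]
  simp [EuclideanSpace.inner_single_right]

lemma pd_radial {g : ℝ → ℝ} {g' : ℝ} {z : Euc N} (hg : HasDerivAt g g' (‖z‖ ^ 2)) (i : Fin N) :
    pd i (fun y => g (‖y‖ ^ 2)) z = 2 * z i * g' := by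
  have hd : DifferentiableAt ℝ (fun y : Euc N => ‖y‖ ^ 2) z :=
    (hasStrictFDerivAt_norm_sq z).hasFDerivAt.differentiableAt
  rw [pd_comp hd hg, pd_norm_sq]; ring

lemma pd_bump (i : Fin N) (z : Euc N) : pd i bump z = -(z i * bumpWeight z) := by
  have h1 : HasDerivAt (fun t : ℝ => 1 - t) (-1) (‖z‖ ^ 2) := by
    simpa using (hasDerivAt_id (‖z‖ ^ 2)).const_sub 1
  have h := (expNegInvGlue_hasDerivAt (1 - ‖z‖ ^ 2)).comp (‖z‖ ^ 2) h1
  have h3 := pd_radial h i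
  change pd i (fun y => expNegInvGlue (1 - ‖y‖ ^ 2)) z = _
  rw [bumpWeight_eq]
  exact h3.trans (by ring)

/-- The mass of `bumpWeight`. -/
def bumpMass (N : ℕ) : ℝ := ∫ z : Euc N, bumpWeight z

lemma bumpMass_pos : 0 < bumpMass N := by
  have hc : Continuous (bumpWeight : Euc N → ℝ) := (contDiff_bumpWeight (n := 0)).continuous
  refine hc.integral_pos_of_hasCompactSupport_nonneg_nonzero hasCompactSupport_bumpWeight
    bumpWeight_nonneg (x := 0) ?_
  exact (bumpWeight_pos (by simp)).ne'

lemma exists_lower_bound_bump : ∃ c > 0, ∀ z : Euc N, ‖z‖ ≤ 1 / 2 → c ≤ bump z ∧ c ≤ bumpWeight z := by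
  have hc : Continuous (fun z : Euc N => min (bump z) (bumpWeight z)) :=
    (contDiff_bump (n := 0)).continuous.min (contDiff_bumpWeight (n := 0)).continuous
  obtain ⟨z0, hz0, hmin⟩ := (isCompact_closedBall (0 : Euc N) (1 / 2)).exists_isMinOn
    ⟨0, by simp⟩ hc.continuousOn
  have hz1 : ‖z0‖ < 1 := by
    have : ‖z0‖ ≤ 1 / 2 := by simpa using hz0
    linarith
  refine ⟨_, lt_min (bump_pos hz1) (bumpWeight_pos hz1), fun z hz => ?_⟩
  exact le_min_iff.1 (hmin (show z ∈ closedBall (0 : Euc N) (1 / 2) by simpa using hz))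

lemma exists_upper_bound {f : Euc N → ℝ} (hf : Continuous f) (hs : HasCompactSupport f) :
    ∃ C > 0, ∀ z, |f z| ≤ C := by
  obtain ⟨C, hC⟩ := hs.exists_bound_of_continuous hf
  exact ⟨max C 1, by positivity, fun z => (hC z).trans (le_max_left _ _)⟩

end Bump

section RadialIdentities

variable {N : ℕ}

lemma integrable_prod_of_continuous {F : ℝ × Euc N → ℝ} (hF : Continuous F) (S : ℝ)
    (h0 : ∀ s z, 1 ≤ ‖z‖ → F (s, z) = 0) :
    Integrable F ((volume.restrict (Ioc 0 S)).prod (volume : Measure (Euc N))) := by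
  have h1 : (volume.restrict (Ioc 0 S)).prod (volume : Measure (Euc N)) =
      (volume : Measure (ℝ × Euc N)).restrict (Ioc 0 S ×ˢ univ) := by
    rw [Measure.volume_eq_prod, ← Measure.prod_restrict, Measure.restrict_univ]
  rw [h1]
  have h2 : IntegrableOn F (Icc 0 S ×ˢ closedBall (0 : Euc N) 1) volume :=
    hF.continuousOn.integrableOn_compact (isCompact_Icc.prod (isCompact_closedBall _ _))
  have h3 : IntegrableOn F (Icc 0 S ×ˢ (univ : Set (Euc N))) volume := by
    refine h2.of_forall_sdiff_eq_zero (measurableSet_Icc.prod MeasurableSet.univ) ?_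
    rintro ⟨s, z⟩ hz
    simp only [mem_sdiff, mem_prod, mem_univ, mem_closedBall, dist_zero_right, and_true,
      not_and, not_le] at hz
    exact h0 s z (hz.2 hz.1).le
  exact h3.mono_set (prod_mono Ioc_subset_Icc_self subset_rfl)

lemma integral_bumpWeight_sub {h : Euc N → ℝ} (hh : ContDiff ℝ 1 h) (x : Euc N) {S : ℝ}
    (hS : 0 ≤ S) :
    (∫ z, h (x + S • z) * bumpWeight z) - bumpMass N * h x =
      ∫ s in (0 : ℝ)..S, ∫ z, (∑ j, z j * pd j h (x + s • z)) * bumpWeight z := by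
  have hpd : ∀ j, Continuous (pd j h) := fun j => (contDiff_pd (m := 0) le_rfl hh j).continuous
  have hθ : Continuous (bumpWeight : Euc N → ℝ) := (contDiff_bumpWeight (n := 0)).continuous
  have hc : Continuous (fun y : ℝ × Euc N =>
      (∑ j, y.2 j * pd j h (x + y.1 • y.2)) * bumpWeight y.2) := by
    refine Continuous.mul (continuous_finsetSum _ fun j _ => ?_) (hθ.comp continuous_snd)
    exact Continuous.mul (by fun_prop) ((hpd j).comp (by fun_prop))
  have hinteg := integrable_prod_of_continuous hc S
    (fun s z hz => by simp [bumpWeight_eq_zero hz])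
  have hpt : ∀ z, ∫ s in (0 : ℝ)..S, (∑ j, z j * pd j h (x + s • z)) * bumpWeight z =
      h (x + S • z) * bumpWeight z - h x * bumpWeight z := by
    intro z
    rw [intervalIntegral.integral_mul_const]
    have : ∫ s in (0 : ℝ)..S, (∑ j, z j * pd j h (x + s • z)) = h (x + S • z) - h (x + (0:ℝ) • z) := by
      refine intervalIntegral.integral_eq_sub_of_hasDerivAt (f := fun s => h (x + s • z)) ?_ ?_
      · intro s _
        have h1 : HasDerivAt (fun s : ℝ => x + s • z) z s := by
          simpa using ((hasDerivAt_id s).smul_const z).const_add x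
        have h2 := ((hh.differentiable (by norm_num)) (x + s • z)).hasFDerivAt.comp_hasDerivAt s h1
        rw [fderiv_apply_eq_sum_pd] at h2
        exact h2
      · refine (continuous_finsetSum _ fun j _ => ?_).intervalIntegrable _ _
        exact Continuous.mul (by fun_prop) ((hpd j).comp (by fun_prop))
    rw [this]; simp; ring
  have hi1 : Integrable (fun z => h (x + S • z) * bumpWeight z) :=
    (Continuous.mul (hh.continuous.comp (by fun_prop)) hθ).integrable_of_hasCompactSupport
      hasCompactSupport_bumpWeight.mul_left
  have hi2 : Integrable (fun z : Euc N => h x * bumpWeight z) :=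
    (continuous_const.mul hθ).integrable_of_hasCompactSupport
      hasCompactSupport_bumpWeight.mul_left
  rw [intervalIntegral.integral_of_le hS]
  rw [integral_integral_swap (f := fun s z => (∑ j, z j * pd j h (x + s • z)) * bumpWeight z) hinteg]
  simp_rw [← intervalIntegral.integral_of_le hS, hpt]
  rw [integral_sub hi1 hi2, integral_const_mul, bumpMass]
  ring

lemma integral_pd_affine_mul {h g : Euc N → ℝ} (hh : ContDiff ℝ 1 h) (hg : ContDiff ℝ 1 g)
    (hs : HasCompactSupport g) (x : Euc N) (s : ℝ) (i : Fin N) :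
    ∫ z, h (x + s • z) * pd i g z = -(s * ∫ z, pd i h (x + s • z) * g z) := by
  have h1 : ContDiff ℝ 1 (fun z : Euc N => h (x + s • z)) := hh.comp (by fun_prop)
  rw [integral_mul_pd h1 hg hs, ← integral_const_mul]
  congr 1
  refine integral_congr_ae (Filter.Eventually.of_forall fun z => ?_)
  simp only
  rw [pd_comp_affine x s z (hh.differentiable (by norm_num) _)]
  ring

lemma integral_bumpWeight_eq_lap {w : Euc N → ℝ} (hw : ContDiff ℝ 2 w) (x : Euc N) {S : ℝ}
    (hS : 0 ≤ S) :
    (∫ z, w (x + S • z) * bumpWeight z) - bumpMass N * w x =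
      ∫ s in (0 : ℝ)..S, s * ∫ z, lap w (x + s • z) * bump z := by
  rw [integral_bumpWeight_sub (hw.of_le (by norm_num)) x hS]
  refine intervalIntegral.integral_congr fun s _ => ?_
  simp only
  have hpd : ∀ j, ContDiff ℝ 1 (pd j w) := fun j => contDiff_pd (m := 1) (n := 2) le_rfl hw j
  have hpd2 : ∀ j, Continuous (pd j (pd j w)) :=
    fun j => (contDiff_pd (m := 0) le_rfl (hpd j) j).continuous
  have e1 : ∀ z, (∑ j, z j * pd j w (x + s • z)) * bumpWeight z =
      ∑ j, -(pd j w (x + s • z) * pd j bump z) := by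
    intro z
    rw [Finset.sum_mul]
    refine Finset.sum_congr rfl fun j _ => ?_
    rw [pd_bump]; ring
  have e2 : ∀ z, lap w (x + s • z) * bump z = ∑ j, pd j (pd j w) (x + s • z) * bump z := by
    intro z
    rw [lap_eq_sum_pd hw.contDiffAt, Finset.sum_mul]
  have hpb : ∀ j, Continuous (pd j (bump : Euc N → ℝ)) :=
    fun j => (contDiff_pd (m := 0) le_rfl (contDiff_bump (n := 1)) j).continuous
  simp_rw [e1, e2]
  rw [integral_finsetSum, integral_finsetSum, Finset.mul_sum]
  · refine Finset.sum_congr rfl fun j _ => ?_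
    rw [integral_neg, integral_pd_affine_mul (hpd j) contDiff_bump hasCompactSupport_bump]
    ring
  · intro j _
    exact (Continuous.mul ((hpd2 j).comp (by fun_prop)) (contDiff_bump (n := 0)).continuous).integrable_of_hasCompactSupport
      hasCompactSupport_bump.mul_left
  · intro j _
    refine Integrable.neg ?_
    have hs : HasCompactSupport (pd j (bump : Euc N → ℝ)) :=
      hasCompactSupport_bump.fderiv_apply (𝕜 := ℝ) _
    exact (Continuous.mul ((hpd j).continuous.comp (by fun_prop)) (hpb j)).integrable_of_hasCompactSupport
      hs.mul_left

lemma integral_pd_bumpWeight_eq_lap {w : Euc N → ℝ} (hw : ContDiff ℝ 2 w) (x : Euc N) {S : ℝ}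
    (hS : 0 ≤ S) (i : Fin N) :
    (∫ z, pd i w (x + S • z) * bumpWeight z) - bumpMass N * pd i w x =
      -∫ s in (0 : ℝ)..S, ∫ z, lap w (x + s • z) * pd i bump z := by
  have hpd : ∀ j, ContDiff ℝ 1 (pd j w) := fun j => contDiff_pd (m := 1) (n := 2) le_rfl hw j
  have hpd2 : ∀ i j, Continuous (pd i (pd j w)) :=
    fun i j => (contDiff_pd (m := 0) le_rfl (hpd j) i).continuous
  have hb1 : ∀ j, ContDiff ℝ 1 (pd j (bump : Euc N → ℝ)) :=
    fun j => contDiff_pd (m := 1) (n := 2) le_rfl contDiff_bump j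
  have hbs : ∀ j, HasCompactSupport (pd j (bump : Euc N → ℝ)) :=
    fun j => hasCompactSupport_bump.fderiv_apply (𝕜 := ℝ) _
  rw [integral_bumpWeight_sub (hpd i) x hS, ← intervalIntegral.integral_neg]
  rw [intervalIntegral.integral_of_le hS, intervalIntegral.integral_of_le hS]
  refine setIntegral_congr_fun measurableSet_Ioc fun s hs => ?_
  simp only
  have e1 : ∀ z, (∑ j, z j * pd j (pd i w) (x + s • z)) * bumpWeight z =
      ∑ j, -(pd i (pd j w) (x + s • z) * pd j bump z) := by
    intro z
    rw [Finset.sum_mul]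
    refine Finset.sum_congr rfl fun j _ => ?_
    rw [pd_bump, pd_comm hw.contDiffAt]; ring
  have e2 : ∀ z, lap w (x + s • z) * pd i bump z =
      ∑ j, pd j (pd j w) (x + s • z) * pd i bump z := by
    intro z
    rw [lap_eq_sum_pd hw.contDiffAt, Finset.sum_mul]
  have hin : ∀ i j l, Integrable (fun z => pd i (pd j w) (x + s • z) * pd l bump z) := by
    intro i j l
    exact (Continuous.mul ((hpd2 i j).comp (by fun_prop)) (hb1 l).continuous).integrable_of_hasCompactSupport
      (hbs l).mul_left
  simp_rw [e1, e2]
  simp_rw [Finset.sum_neg_distrib]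
  rw [integral_neg, integral_finsetSum _ fun j _ => hin _ _ _,
    integral_finsetSum _ fun j _ => hin _ _ _]
  congr 1
  refine Finset.sum_congr rfl fun j _ => ?_
  have h1 := integral_pd_affine_mul (hpd j) (hb1 j) (hbs j) x s i
  have h2 := integral_pd_affine_mul (hpd j) (hb1 i) (hbs i) x s j
  have h3 : ∀ z, pd i (pd j (bump : Euc N → ℝ)) z = pd j (pd i bump) z :=
    fun z => pd_comm (contDiff_bump (n := 2)).contDiffAt i j
  simp_rw [h3] at h1
  rw [h2] at h1
  have hs0 : s ≠ 0 := hs.1.ne'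
  exact (mul_left_cancel₀ hs0 (neg_injective h1)).symm

end RadialIdentities

section Cutoff

variable {N : ℕ}

/-- A smooth cutoff function vanishing on the ball of radius `ε` and equal to `1` outside the
ball of radius `2ε`. -/
def cutoff (ε : ℝ) (x : Euc N) : ℝ := Real.smoothTransition (‖ε⁻¹ • x‖ ^ 2 - 1)

lemma contDiff_cutoff {n : ℕ} (ε : ℝ) : ContDiff ℝ n (cutoff ε : Euc N → ℝ) := by
  have h : ContDiff ℝ n Real.smoothTransition := Real.smoothTransition.contDiff (n := (n : ℕ∞))
  have h2 : ContDiff ℝ n (fun x : Euc N => ‖ε⁻¹ • x‖ ^ 2 - 1) :=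
    ((contDiff_id.const_smul ε⁻¹).norm_sq ℝ).sub contDiff_const
  exact h.comp h2

lemma cutoff_nonneg (ε : ℝ) (x : Euc N) : 0 ≤ cutoff ε x := Real.smoothTransition.nonneg _

lemma cutoff_le_one (ε : ℝ) (x : Euc N) : cutoff ε x ≤ 1 := Real.smoothTransition.le_one _

lemma cutoff_eq_zero {ε : ℝ} (hε : 0 < ε) {x : Euc N} (hx : ‖x‖ ≤ ε) : cutoff ε x = 0 := by
  refine Real.smoothTransition.zero_of_nonpos ?_
  rw [norm_smul, Real.norm_of_nonneg (by positivity)]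
  have : ε⁻¹ * ‖x‖ ≤ 1 := by
    rw [inv_mul_le_iff₀ hε]; simpa using hx
  have h0 : 0 ≤ ε⁻¹ * ‖x‖ := by positivity
  nlinarith

lemma cutoff_eq_one {ε : ℝ} (hε : 0 < ε) {x : Euc N} (hx : 2 * ε ≤ ‖x‖) : cutoff ε x = 1 := by
  refine Real.smoothTransition.one_of_one_le ?_
  rw [norm_smul, Real.norm_of_nonneg (by positivity)]
  have : 2 ≤ ε⁻¹ * ‖x‖ := by
    rw [le_inv_mul_iff₀ hε]; linarith
  nlinarith

lemma cutoff_eq_scale (ε : ℝ) (x : Euc N) : cutoff ε x = cutoff 1 ((0 : Euc N) + ε⁻¹ • x) := by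
  simp [cutoff]

lemma pd_cutoff (ε : ℝ) (i : Fin N) (x : Euc N) :
    pd i (cutoff ε) x = ε⁻¹ * pd i (cutoff 1) ((0 : Euc N) + ε⁻¹ • x) := by
  rw [← pd_comp_affine (f := cutoff 1) 0 ε⁻¹ x
    ((contDiff_cutoff (n := 1) 1).differentiable (by norm_num) _)]
  exact pd_congr (Filter.Eventually.of_forall fun y => cutoff_eq_scale ε y) i

lemma pd_pd_cutoff (ε : ℝ) (i : Fin N) (x : Euc N) :
    pd i (pd i (cutoff ε)) x = ε⁻¹ ^ 2 * pd i (pd i (cutoff 1)) ((0 : Euc N) + ε⁻¹ • x) := by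
  have hd : Differentiable ℝ (pd i (cutoff 1 : Euc N → ℝ)) :=
    (contDiff_pd (m := 1) (n := 2) le_rfl (contDiff_cutoff 1) i).differentiable (by norm_num)
  have h1 : pd i (cutoff ε : Euc N → ℝ) = fun y => ε⁻¹ * pd i (cutoff 1) ((0 : Euc N) + ε⁻¹ • y) :=
    funext fun y => pd_cutoff ε i y
  rw [h1, pd_const_mul (by exact (hd.comp (by fun_prop)) x), pd_comp_affine 0 ε⁻¹ x (hd _)]
  ring

lemma pd_cutoff_eq_zero {ε : ℝ} (hε : 0 < ε) {x : Euc N} (hx : ‖x‖ < ε ∨ 2 * ε < ‖x‖) (i : Fin N) :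
    pd i (cutoff ε) =ᶠ[nhds x] fun _ => 0 := by
  rcases hx with hx | hx
  · have : cutoff ε =ᶠ[nhds x] fun _ => (0 : ℝ) := by
      filter_upwards [continuous_norm.continuousAt.eventually_lt continuousAt_const hx] with y hy
      exact cutoff_eq_zero hε (le_of_lt hy)
    filter_upwards [pd_eventuallyEq this i] with y hy
    rw [hy]; simp [pd]
  · have : cutoff ε =ᶠ[nhds x] fun _ => (1 : ℝ) := by
      filter_upwards [continuousAt_const.eventually_lt continuous_norm.continuousAt hx] with y hy
      exact cutoff_eq_one hε (le_of_lt hy)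
    filter_upwards [pd_eventuallyEq this i] with y hy
    rw [hy]; simp [pd]

lemma exists_pd_cutoff_bound (N : ℕ) : ∃ C > 0, ∀ ε > 0, ∀ (i : Fin N) (x : Euc N),
    |pd i (cutoff ε) x| ≤ C / ε ∧ |pd i (pd i (cutoff ε)) x| ≤ C / ε ^ 2 := by
  have key : ∀ i : Fin N, ∃ C > 0, ∀ x : Euc N,
      |pd i (cutoff 1) x| ≤ C ∧ |pd i (pd i (cutoff 1)) x| ≤ C := by
    intro i
    have c1 : ContDiff ℝ 1 (pd i (cutoff 1 : Euc N → ℝ)) :=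
      contDiff_pd (m := 1) (n := 2) le_rfl (contDiff_cutoff 1) i
    have c2 : Continuous (pd i (pd i (cutoff 1 : Euc N → ℝ))) :=
      (contDiff_pd (m := 0) le_rfl c1 i).continuous
    have z : ∀ x : Euc N, 3 ≤ ‖x‖ → pd i (cutoff 1) =ᶠ[nhds x] fun _ => 0 :=
      fun x hx => pd_cutoff_eq_zero one_pos (Or.inr (by linarith)) i
    obtain ⟨C1, h1, h1'⟩ := exists_upper_bound c1.continuous
      (hasCompactSupport_of_norm (R := 3) fun x hx => (z x hx).self_of_nhds)
    obtain ⟨C2, h2, h2'⟩ := exists_upper_bound c2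
      (hasCompactSupport_of_norm (R := 3) fun x hx => by
        rw [pd_congr (z x hx)]; simp [pd])
    exact ⟨max C1 C2, by positivity, fun x =>
      ⟨(h1' x).trans (le_max_left _ _), (h2' x).trans (le_max_right _ _)⟩⟩
  choose C hC hb using key
  refine ⟨1 + ∑ i, C i, by
    have : 0 ≤ ∑ i, C i := Finset.sum_nonneg fun i _ => (hC i).le
    linarith, fun ε hε i x => ?_⟩
  have hi : C i ≤ 1 + ∑ i, C i := by
    have := Finset.single_le_sum (f := C) (fun i _ => (hC i).le) (Finset.mem_univ i)
    linarith
  rw [pd_cutoff, pd_pd_cutoff, abs_mul, abs_mul, abs_of_pos (inv_pos.2 hε),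
    abs_of_pos (a := ε⁻¹ ^ 2) (by positivity), div_eq_inv_mul, div_eq_inv_mul, inv_pow]
  exact ⟨mul_le_mul_of_nonneg_left ((hb i _).1.trans hi) (by positivity),
    mul_le_mul_of_nonneg_left ((hb i _).2.trans hi) (by positivity)⟩

lemma contDiff_cutoff_mul {n : ℕ} {w : Euc N → ℝ} (hw : ∀ x, x ≠ 0 → ContDiffAt ℝ n w x)
    {ε : ℝ} (hε : 0 < ε) : ContDiff ℝ n (fun x => cutoff ε x * w x) := by
  rw [contDiff_iff_contDiffAt]
  intro x
  by_cases hx : x = 0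
  · have : (fun x => cutoff ε x * w x) =ᶠ[nhds x] fun _ => (0 : ℝ) := by
      have hx' : ‖x‖ < ε := by simpa [hx] using hε
      filter_upwards [continuous_norm.continuousAt.eventually_lt continuousAt_const hx'] with y hy
      rw [cutoff_eq_zero hε (le_of_lt hy), zero_mul]
    exact contDiffAt_const.congr_of_eventuallyEq this
  · exact (contDiff_cutoff ε).contDiffAt.mul (hw x hx)

lemma cutoff_mul_eventuallyEq {w : Euc N → ℝ} {ε : ℝ} (hε : 0 < ε) {x : Euc N}
    (hx : 2 * ε < ‖x‖) : (fun x => cutoff ε x * w x) =ᶠ[nhds x] w := by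
  filter_upwards [continuousAt_const.eventually_lt continuous_norm.continuousAt hx] with y hy
  rw [cutoff_eq_one hε (le_of_lt hy), one_mul]

lemma lap_mul {f g : Euc N → ℝ} {x : Euc N} (hf : ContDiffAt ℝ 2 f x) (hg : ContDiffAt ℝ 2 g x) :
    lap (fun y => f y * g y) x =
      f x * lap g x + 2 * ∑ i, pd i f x * pd i g x + (∑ i, pd i (pd i f) x) * g x := by
  rw [lap_eq_sum_pd (hf.mul hg), lap_eq_sum_pd hg, Finset.mul_sum, Finset.mul_sum, Finset.sum_mul,
    ← Finset.sum_add_distrib, ← Finset.sum_add_distrib]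
  refine Finset.sum_congr rfl fun i _ => ?_
  have hfe : ∀ᶠ y in nhds x, ContDiffAt ℝ 2 f y := hf.eventually (by simp)
  have hge : ∀ᶠ y in nhds x, ContDiffAt ℝ 2 g y := hg.eventually (by simp)
  have h1 : pd i (fun y => f y * g y) =ᶠ[nhds x] fun y => pd i f y * g y + f y * pd i g y := by
    filter_upwards [hfe, hge] with y hy hy'
    exact pd_mul (hy.differentiableAt (by norm_num)) (hy'.differentiableAt (by norm_num)) i
  have df := hf.differentiableAt (by norm_num : (2 : WithTop ℕ∞) ≠ 0)
  have dg := hg.differentiableAt (by norm_num : (2 : WithTop ℕ∞) ≠ 0)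
  have df1 : DifferentiableAt ℝ (pd i f) x :=
    (contDiffAt_pd (m := 1) (n := 2) le_rfl hf i).differentiableAt (by norm_num)
  have dg1 : DifferentiableAt ℝ (pd i g) x :=
    (contDiffAt_pd (m := 1) (n := 2) le_rfl hg i).differentiableAt (by norm_num)
  rw [pd_congr h1, pd_add (f := fun y => pd i f y * g y) (g := fun y => f y * pd i g y) (df1.mul dg) (df.mul dg1), pd_mul df1 dg, pd_mul df dg1]
  ring

/-- Cutting off near an isolated singularity produces an error of size `ε⁻²` in the Laplacian,
supported in the ball of radius `2ε`. -/
lemma exists_lap_cutoff_mul_bound (N : ℕ) : ∃ C > 0, ∀ (w : Euc N → ℝ) (M : ℝ), 0 ≤ M →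
    (∀ x, x ≠ 0 → ContDiffAt ℝ 2 w x) → (∀ x, x ≠ 0 → ‖x‖ ≤ 1 → |w x| ≤ M) →
    (∀ x i, x ≠ 0 → ‖x‖ ≤ 1 → |pd i w x| ≤ M / ‖x‖) →
    ∀ ε, 0 < ε → ε ≤ 1 / 2 → ∀ x, x ≠ 0 →
      |lap (fun y => cutoff ε y * w y) x - cutoff ε x * lap w x| ≤
        indicator (closedBall 0 (2 * ε)) (fun _ => C * M / ε ^ 2) x := by
  obtain ⟨C, hC, hb⟩ := exists_pd_cutoff_bound N
  refine ⟨3 * N * C + 1, by positivity, fun w M hM hw hwM hwd ε hε hε2 x hx => ?_⟩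
  have e := lap_mul (contDiff_cutoff (n := 2) ε).contDiffAt (hw x hx)
  rw [e]
  have e2 : ∀ A B D : ℝ, A + B + D - A = B + D := fun A B D => by ring
  rw [e2]
  have hnn : (0 : ℝ) ≤ indicator (closedBall (0 : Euc N) (2 * ε))
      (fun _ => (3 * N * C + 1) * M / ε ^ 2) x := indicator_nonneg (fun _ _ => by positivity) _
  by_cases hz : ‖x‖ < ε ∨ 2 * ε < ‖x‖
  · have z1 : ∀ i, pd i (cutoff ε) x = 0 := fun i => (pd_cutoff_eq_zero hε hz i).self_of_nhds
    have z2 : ∀ i, pd i (pd i (cutoff ε)) x = 0 := fun i => by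
      rw [pd_congr (pd_cutoff_eq_zero hε hz i)]; simp [pd]
    simpa [z1, z2] using hnn
  · push Not at hz
    have hx1 : ‖x‖ ≤ 1 := by linarith [hz.2]
    rw [indicator_of_mem (by simpa using hz.2)]
    have b1 : |∑ i, pd i (cutoff ε) x * pd i w x| ≤ ∑ _i : Fin N, C / ε * (M / ε) := by
      refine (Finset.abs_sum_le_sum_abs _ _).trans (Finset.sum_le_sum fun i _ => ?_)
      rw [abs_mul]
      have := hwd x i hx hx1
      have h2 : M / ‖x‖ ≤ M / ε := by gcongr; exact hz.1
      exact mul_le_mul (hb ε hε i x).1 (this.trans h2) (abs_nonneg _) (by positivity)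
    have b2 : |∑ i, pd i (pd i (cutoff ε)) x| ≤ ∑ _i : Fin N, C / ε ^ 2 := by
      refine (Finset.abs_sum_le_sum_abs _ _).trans (Finset.sum_le_sum fun i _ => ?_)
      exact (hb ε hε i x).2
    simp only [Finset.sum_const, Finset.card_univ, Fintype.card_fin, nsmul_eq_mul] at b1 b2
    refine (abs_add_le _ _).trans ?_
    rw [abs_mul, abs_mul, abs_of_pos (by norm_num : (0 : ℝ) < 2)]
    have b3 : |∑ i, pd i (pd i (cutoff ε)) x| * |w x| ≤ N * (C / ε ^ 2) * M :=
      mul_le_mul b2 (hwM x hx hx1) (abs_nonneg _) (by positivity)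
    calc _ ≤ 2 * (N * (C / ε * (M / ε))) + N * (C / ε ^ 2) * M := by linarith
      _ = 3 * N * C * M / ε ^ 2 := by field_simp; ring
      _ ≤ _ := by gcongr; linarith

end Cutoff

section Superharmonic

variable {N : ℕ}

lemma integral_comp_affine (F : Euc N → ℝ) (x : Euc N) {s : ℝ} (hs : 0 < s) :
    ∫ z, F (x + s • z) = (s ^ N)⁻¹ * ∫ y, F y := by
  have := Measure.integral_comp_smul (volume : Measure (Euc N)) (fun y => F (x + y)) s
  rw [this, integral_add_left_eq_self F x]
  simp [abs_of_pos hs]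

lemma Integrable.comp_affine {F : Euc N → ℝ} (hF : Integrable F) (x : Euc N) {s : ℝ} (hs : s ≠ 0) :
    Integrable fun z => F (x + s • z) :=
  (hF.comp_add_left x).comp_smul hs

lemma lintegral_comp_affine (F : Euc N → ENNReal) (x : Euc N) {s : ℝ} (hs : 0 < s) :
    ∫⁻ z, F (x + s • z) = ENNReal.ofReal ((s ^ N)⁻¹) * ∫⁻ y, F y := by
  have h1 : ∫⁻ z, F (x + s • z) = ∫⁻ y, F (x + y) ∂(Measure.map (s • ·) (volume : Measure (Euc N))) :=
    ((Homeomorph.smulOfNeZero s hs.ne').measurableEmbedding.lintegral_map (fun y => F (x + y))).symm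
  rw [h1, Measure.map_addHaar_smul volume hs.ne', lintegral_smul_measure,
    lintegral_add_left_eq_self F x]
  simp [abs_of_pos hs]

lemma contDiffAt_lap {w : Euc N → ℝ} {x : Euc N} (hw : ContDiffAt ℝ 2 w x) :
    ContDiffAt ℝ (0 : ℕ) (lap w) x := by
  have h1 : lap w =ᶠ[nhds x] fun y => ∑ i, pd i (pd i w) y := by
    filter_upwards [hw.eventually (by simp)] with y hy using lap_eq_sum_pd hy
  refine ContDiffAt.congr_of_eventuallyEq ?_ h1
  exact ContDiffAt.sum fun i _ => contDiffAt_pd (n := 1) le_rfl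
    (contDiffAt_pd (m := 1) (n := 2) le_rfl hw i) i

lemma lap_const (c : ℝ) (x : Euc N) : lap (fun _ : Euc N => c) x = 0 := by
  rw [lap_eq_sum_pd contDiffAt_const]
  have h : ∀ i, pd i (fun _ : Euc N => c) = fun _ => 0 := fun i => by ext; simp [pd]
  simp only [h]
  simp [pd]

lemma lap_cutoff_mul_zero {w : Euc N → ℝ} {ε : ℝ} (hε : 0 < ε) :
    lap (fun y => cutoff ε y * w y) 0 = 0 := by
  have : (fun x => cutoff ε x * w x) =ᶠ[nhds (0 : Euc N)] fun _ => (0 : ℝ) := by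
    have hx' : ‖(0 : Euc N)‖ < ε := by simpa using hε
    filter_upwards [continuous_norm.continuousAt.eventually_lt continuousAt_const hx'] with y hy
    rw [cutoff_eq_zero hε (le_of_lt hy), zero_mul]
  rw [lap_congr this, lap_const]

lemma intervalIntegrable_mul_integral_bump {h : Euc N → ℝ} (hh : Continuous h) (x : Euc N)
    {S : ℝ} (hS : 0 ≤ S) :
    IntervalIntegrable (fun s => s * ∫ z, h (x + s • z) * bump z) volume 0 S := by
  rw [intervalIntegrable_iff_integrableOn_Ioc_of_le hS]
  have hb : Continuous (bump : Euc N → ℝ) := (contDiff_bump (n := 0)).continuous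
  have hc : Continuous (fun y : ℝ × Euc N => y.1 * (h (x + y.1 • y.2) * bump y.2)) :=
    continuous_fst.mul (Continuous.mul (hh.comp (by fun_prop)) (hb.comp continuous_snd))
  have := (integrable_prod_of_continuous hc S (fun s z hz => by simp [bump_eq_zero hz])).integral_prod_left
  simp only [integral_const_mul] at this
  exact this

lemma integral_ball_indicator (N : ℕ) (K r : ℝ) (hr : 0 ≤ r) :
    ∫ y, indicator (closedBall (0 : Euc N) r) (fun _ => K) y =
      K * (r ^ N * (volume : Measure (Euc N)).real (ball 0 1)) := by
  rw [integral_indicator isClosed_closedBall.measurableSet, setIntegral_const,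
    Measure.addHaar_real_closedBall _ _ hr]
  simp; ring

/-- Quantitative form of the superharmonic mean value inequality for the regularised function,
with an error vanishing with the size of the cutoff. -/
lemma exists_cutoff_superharmonic_bound (hN : 3 ≤ N) {S : ℝ} (hS : 0 < S) :
    ∃ c > 0, ∀ (w : Euc N → ℝ) (M : ℝ), 0 ≤ M →
    (∀ x, x ≠ 0 → ContDiffAt ℝ 2 w x) → (∀ x, x ≠ 0 → ‖x‖ ≤ 1 → |w x| ≤ M) →
    (∀ x i, x ≠ 0 → ‖x‖ ≤ 1 → |pd i w x| ≤ M / ‖x‖) → (∀ x, x ≠ 0 → lap w x ≤ 0) →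
    ∀ x, x ≠ 0 → ∃ K, ∀ ε, 0 < ε → ε ≤ 1 / 2 → 4 * ε < ‖x‖ →
      c * (∫ y in closedBall x (S / 4), cutoff ε y * (-lap w y)) ≤
        bumpMass N * w x - (∫ z, cutoff ε (x + S • z) * w (x + S • z) * bumpWeight z) + K * ε := by
  obtain ⟨c1, hc1, hlow⟩ := exists_lower_bound_bump (N := N)
  obtain ⟨B, hB, hup⟩ := exists_upper_bound (contDiff_bump (N := N) (n := 0)).continuous
    hasCompactSupport_bump
  obtain ⟨C, hC, hcut⟩ := exists_lap_cutoff_mul_bound N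
  refine ⟨S / 2 * (S / 2 * c1 * (S ^ N)⁻¹), by positivity, fun w M hM hw hwM hwd hl x hx => ?_⟩
  have hx0 : 0 < ‖x‖ := norm_pos_iff.2 hx
  set ω := (volume : Measure (Euc N)).real (ball 0 1) with hω
  have hω0 : 0 ≤ ω := measureReal_nonneg
  set K0 := S * (B * ((‖x‖ / 2) ^ N)⁻¹ * (C * M * 2 ^ N * ω)) with hK0
  have hK0n : 0 ≤ K0 := by positivity
  refine ⟨S * K0, fun ε hε hε2 hεx => ?_⟩
  set wε : Euc N → ℝ := fun y => cutoff ε y * w y with hwε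
  have hwεc : ContDiff ℝ 2 wε := contDiff_cutoff_mul hw hε
  have hid := integral_bumpWeight_eq_lap hwεc x hS.le
  have hwx : wε x = w x := (cutoff_mul_eventuallyEq hε (by linarith)).self_of_nhds
  rw [hwx] at hid
  set j : Euc N → ℝ := fun y => cutoff ε y * (-lap w y) with hj
  have hjc : Continuous j := by
    have : ContDiff ℝ (0 : ℕ) j :=
      contDiff_cutoff_mul (w := fun y => -lap w y) (fun y hy => (contDiffAt_lap (hw y hy)).neg) hε
    exact this.continuous
  have hj0 : ∀ y, 0 ≤ j y := fun y => by
    by_cases hy : y = 0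
    · simp [hj, hy, cutoff_eq_zero hε (x := (0 : Euc N)) (by simpa using hε.le)]
    · exact mul_nonneg (cutoff_nonneg _ _) (neg_nonneg.2 (hl y hy))
  set E : Euc N → ℝ := indicator (closedBall 0 (2 * ε)) (fun _ => C * M / ε ^ 2) with hE
  have hE0 : ∀ y, 0 ≤ E y := fun y => indicator_nonneg (fun _ _ => by positivity) _
  have hEi : Integrable E := by
    rw [hE, integrable_indicator_iff isClosed_closedBall.measurableSet]
    exact (integrableOn_const_iff (by simp)).2 (Or.inr measure_closedBall_lt_top)
  have hpt : ∀ y, j y - E y ≤ -lap wε y := by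
    intro y
    by_cases hy : y = 0
    · rw [hy, hwε, lap_cutoff_mul_zero hε]
      have : j 0 = 0 := by
        simp [hj, cutoff_eq_zero hε (x := (0 : Euc N)) (by simpa using hε.le)]
      rw [this]; linarith [hE0 0]
    · have := (abs_le.1 (hcut w M hM hw hwM hwd ε hε hε2 y hy)).2
      simp only [hj]; linarith
  set F : Euc N → ℝ := indicator (closedBall x (S / 4)) j with hF
  have hFi : Integrable F := by
    rw [hF, integrable_indicator_iff isClosed_closedBall.measurableSet]
    exact hjc.continuousOn.integrableOn_compact (isCompact_closedBall _ _)
  have hF0 : ∀ y, 0 ≤ F y := fun y => indicator_nonneg (fun _ _ => hj0 _) _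
  have hb : Continuous (bump : Euc N → ℝ) := (contDiff_bump (n := 0)).continuous
  have hlc : Continuous fun y => -lap wε y := (continuous_lap hwεc).neg
  have hgi : ∀ s : ℝ, Integrable fun z => -lap wε (x + s • z) * bump z := fun s =>
    (Continuous.mul (hlc.comp (by fun_prop)) hb).integrable_of_hasCompactSupport
      hasCompactSupport_bump.mul_left
  have hEb : ∀ s : ℝ, 0 < s → s ≤ S → s * ∫ z, E (x + s • z) * bump z ≤ K0 * ε := by
    intro s hs hsS
    by_cases hsx : s < ‖x‖ / 2
    · have : ∀ z, E (x + s • z) * bump z = 0 := by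
        intro z
        by_cases hz : 1 ≤ ‖z‖
        · rw [bump_eq_zero hz, mul_zero]
        · have : 2 * ε < ‖x + s • z‖ := by
            have h1 : ‖x‖ - ‖s • z‖ ≤ ‖x + s • z‖ := by
              simpa using norm_sub_norm_le x (-(s • z))
            rw [norm_smul, Real.norm_of_nonneg hs.le] at h1
            nlinarith
          rw [hE, indicator_of_notMem (by simpa using this), zero_mul]
      simp only [this, integral_zero, mul_zero]; positivity
    · push Not at hsx
      have h1 : ∫ z, E (x + s • z) * bump z ≤ ∫ z, E (x + s • z) * B := by
        refine integral_mono_of_nonneg (Filter.Eventually.of_forall fun z =>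
          mul_nonneg (hE0 _) (bump_nonneg _)) ((Integrable.comp_affine hEi x hs.ne').mul_const B)
          (Filter.Eventually.of_forall fun z => ?_)
        exact mul_le_mul_of_nonneg_left ((le_abs_self _).trans (hup z)) (hE0 _)
      rw [integral_mul_const, integral_comp_affine E x hs, hE,
        integral_ball_indicator N _ _ (by positivity), ← hE, ← hω] at h1
      have h2 : (s ^ N)⁻¹ ≤ ((‖x‖ / 2) ^ N)⁻¹ := by gcongr
      have h3 : C * M / ε ^ 2 * ((2 * ε) ^ N * ω) ≤ C * M * 2 ^ N * ω * ε := by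
        have h4 : ε ^ N ≤ ε ^ 3 := pow_le_pow_of_le_one hε.le (by linarith) hN
        have h5 : C * M / ε ^ 2 * ((2 * ε) ^ N * ω) = C * M * 2 ^ N * ω * (ε ^ N / ε ^ 2) := by
          rw [mul_pow]; field_simp
        rw [h5]
        refine mul_le_mul_of_nonneg_left ?_ (by positivity)
        rw [div_le_iff₀ (by positivity)]
        calc ε ^ N ≤ ε ^ 3 := h4
          _ = _ := by ring
      calc s * ∫ z, E (x + s • z) * bump z
          ≤ S * (((‖x‖ / 2) ^ N)⁻¹ * (C * M * 2 ^ N * ω * ε) * B) := by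
            refine mul_le_mul hsS (h1.trans ?_) (integral_nonneg fun z =>
              mul_nonneg (hE0 _) (bump_nonneg _)) hS.le
            gcongr
        _ = K0 * ε := by rw [hK0]; ring
  have hEbi : ∀ s : ℝ, 0 < s → Integrable fun z => E (x + s • z) * bump z := by
    intro s hs
    refine (Integrable.comp_affine hEi x hs.ne').mul_bdd (c := B) hb.aestronglyMeasurable ?_
    exact Filter.Eventually.of_forall fun z => by simpa using hup z
  have hjbi : ∀ s : ℝ, Integrable fun z => j (x + s • z) * bump z := fun s =>
    (Continuous.mul (hjc.comp (by fun_prop)) hb).integrable_of_hasCompactSupport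
      hasCompactSupport_bump.mul_left
  have hsplit : ∀ s : ℝ, 0 < s → s ≤ S →
      s * (∫ z, j (x + s • z) * bump z) - K0 * ε ≤ s * ∫ z, -lap wε (x + s • z) * bump z := by
    intro s hs hsS
    have : (∫ z, j (x + s • z) * bump z) - (∫ z, E (x + s • z) * bump z) ≤
        ∫ z, -lap wε (x + s • z) * bump z := by
      rw [← integral_sub (hjbi s) (hEbi s hs)]
      refine integral_mono ((hjbi s).sub (hEbi s hs)) (hgi s) fun z => ?_
      have := mul_le_mul_of_nonneg_right (hpt (x + s • z)) (bump_nonneg z)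
      simp only; linarith
    have h2 := hEb s hs hsS
    nlinarith
  have hlo : ∀ s : ℝ, S / 2 ≤ s → s ≤ S →
      S / 2 * c1 * (S ^ N)⁻¹ * (∫ y, F y) ≤ s * ∫ z, j (x + s • z) * bump z := by
    intro s hs hsS
    have hs0 : 0 < s := by linarith
    have h1 : ∫ z, c1 * F (x + s • z) ≤ ∫ z, j (x + s • z) * bump z := by
      refine integral_mono_of_nonneg (Filter.Eventually.of_forall fun z =>
        mul_nonneg hc1.le (hF0 _)) (hjbi s) (Filter.Eventually.of_forall fun z => ?_)
      simp only [hF]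
      by_cases hz : x + s • z ∈ closedBall x (S / 4)
      · rw [indicator_of_mem hz, mul_comm]
        refine mul_le_mul_of_nonneg_left (hlow z ?_).1 (hj0 _)
        simp only [mem_closedBall, dist_self_add_left, norm_smul, Real.norm_of_nonneg hs0.le] at hz
        by_contra hc
        push Not at hc
        nlinarith
      · rw [indicator_of_notMem hz, mul_zero]
        exact mul_nonneg (hj0 _) (bump_nonneg _)
    rw [integral_const_mul, integral_comp_affine F x hs0] at h1
    have hFn : 0 ≤ ∫ y, F y := integral_nonneg hF0
    have h2 : (S ^ N)⁻¹ ≤ (s ^ N)⁻¹ := by gcongr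
    calc S / 2 * c1 * (S ^ N)⁻¹ * (∫ y, F y) ≤ s * c1 * (s ^ N)⁻¹ * (∫ y, F y) := by gcongr
      _ = s * (c1 * ((s ^ N)⁻¹ * ∫ y, F y)) := by ring
      _ ≤ _ := by gcongr
  have hG := intervalIntegrable_mul_integral_bump hlc x hS.le
  have hG1 : IntervalIntegrable (fun s => s * ∫ z, -lap wε (x + s • z) * bump z) volume 0 (S / 2) :=
    hG.mono_set (by
      rw [uIcc_of_le (by positivity), uIcc_of_le hS.le]; exact Icc_subset_Icc le_rfl (by linarith))
  have hG2 : IntervalIntegrable (fun s => s * ∫ z, -lap wε (x + s • z) * bump z) volume (S / 2) S :=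
    hG.mono_set (by
      rw [uIcc_of_le (by linarith), uIcc_of_le hS.le]
      exact Icc_subset_Icc (by positivity) le_rfl)
  have hneg : (∫ s in (0 : ℝ)..S, s * ∫ z, lap wε (x + s • z) * bump z) =
      -∫ s in (0 : ℝ)..S, s * ∫ z, -lap wε (x + s • z) * bump z := by
    rw [← intervalIntegral.integral_neg]
    refine intervalIntegral.integral_congr fun s _ => ?_
    simp only [neg_mul, integral_neg, mul_neg, neg_neg]
  rw [hneg, ← intervalIntegral.integral_add_adjacent_intervals hG1 hG2] at hid
  have i1 : (∫ _s in (0 : ℝ)..(S / 2), -(K0 * ε)) ≤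
      ∫ s in (0 : ℝ)..(S / 2), s * ∫ z, -lap wε (x + s • z) * bump z := by
    refine intervalIntegral.integral_mono_on_of_le_Ioo (by positivity) (by simp) hG1 fun s hs => ?_
    have h1 := hsplit s hs.1 (by linarith [hs.2])
    have h2 : 0 ≤ s * ∫ z, j (x + s • z) * bump z :=
      mul_nonneg hs.1.le (integral_nonneg fun z => mul_nonneg (hj0 _) (bump_nonneg _))
    linarith
  have i2 : (∫ _s in (S / 2)..S, (S / 2 * c1 * (S ^ N)⁻¹ * (∫ y, F y) - K0 * ε)) ≤
      ∫ s in (S / 2)..S, s * ∫ z, -lap wε (x + s • z) * bump z := by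
    refine intervalIntegral.integral_mono_on_of_le_Ioo (by linarith) (by simp) hG2 fun s hs => ?_
    have h1 := hsplit s (by linarith [hs.1]) hs.2.le
    have h2 := hlo s hs.1.le hs.2.le
    linarith
  rw [intervalIntegral.integral_const] at i1 i2
  have hFe : ∫ y, F y = ∫ y in closedBall x (S / 4), cutoff ε y * (-lap w y) := by
    rw [hF, integral_indicator isClosed_closedBall.measurableSet]
  rw [hFe] at i2
  simp only [smul_eq_mul] at i1 i2
  simp only [hwε] at hid ⊢
  nlinarith

end Superharmonic

section Tame

variable {N : ℕ}

/-- A function which is `C²` off the origin, locally bounded, with gradient `O(|x|⁻¹)` at the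
origin. -/
structure Tame (w : Euc N → ℝ) : Prop where
  contDiffAt : ∀ x, x ≠ 0 → ContDiffAt ℝ 2 w x
  bdd : ∀ R, ∃ M, ∀ x, x ≠ 0 → ‖x‖ ≤ R → |w x| ≤ M
  grad : ∃ M, ∀ x i, x ≠ 0 → ‖x‖ ≤ 1 → |pd i w x| ≤ M / ‖x‖

lemma ae_ne_point [NeZero N] (c : Euc N) : ∀ᵐ x : Euc N, x ≠ c := by
  have : Nonempty (Fin N) := ⟨0⟩
  have : Nontrivial (Euc N) := inferInstance
  have h : ({c}ᶜ : Set (Euc N)) ∈ ae (volume : Measure (Euc N)) :=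
    compl_mem_ae_iff.2 (measure_singleton c)
  exact h

lemma aestronglyMeasurable_of_continuousAt_ne_zero [NeZero N] {w : Euc N → ℝ}
    (hw : ∀ x, x ≠ 0 → ContinuousAt w x) : AEStronglyMeasurable w volume := by
  have h1 : ContinuousOn w {0}ᶜ := fun x hx => (hw x hx).continuousWithinAt
  have h2 := h1.aestronglyMeasurable (μ := (volume : Measure (Euc N)))
    (measurableSet_singleton 0).compl
  have h3 : (volume : Measure (Euc N)).restrict {0}ᶜ = volume :=
    Measure.restrict_eq_self_of_ae_mem (ae_ne_point (0 : Euc N))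
  rwa [h3] at h2

lemma exists_superharmonic_bound (hN : 3 ≤ N) {S : ℝ} (hS : 0 < S) :
    ∃ C > 0, ∀ w : Euc N → ℝ, Tame w → (∀ x, x ≠ 0 → lap w x ≤ 0) → ∀ x, x ≠ 0 →
      (∫ z, w (x + S • z) * bumpWeight z) ≤ bumpMass N * w x ∧
      ∫⁻ y in closedBall x (S / 4), ENNReal.ofReal (-lap w y) ≤
        ENNReal.ofReal (C * (bumpMass N * w x - ∫ z, w (x + S • z) * bumpWeight z)) := by
  have : NeZero N := ⟨by omega⟩
  obtain ⟨c, hc, hbd⟩ := exists_cutoff_superharmonic_bound hN hS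
  refine ⟨c⁻¹, by positivity, fun w hw hl x hx => ?_⟩
  obtain ⟨M1, hM1⟩ := hw.bdd 1
  obtain ⟨M2, hM2⟩ := hw.grad
  obtain ⟨K, hK⟩ := hbd w (max (max M1 M2) 0) (le_max_right _ _) hw.contDiffAt
    (fun y hy hy1 => (hM1 y hy hy1).trans ((le_max_left _ _).trans (le_max_left _ _)))
    (fun y i hy hy1 => (hM2 y i hy hy1).trans (by
      gcongr; exact (le_max_right _ _).trans (le_max_left _ _))) hl x hx
  have hx0 : 0 < ‖x‖ := norm_pos_iff.2 hx
  set e : ℕ → ℝ := fun n => 1 / ((n : ℝ) + 1) with he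
  have he0 : ∀ n, 0 < e n := fun n => by positivity
  have helim : Filter.Tendsto e Filter.atTop (nhds 0) := tendsto_one_div_add_atTop_nhds_zero_nat
  set D := bumpMass N * w x - ∫ z, w (x + S • z) * bumpWeight z with hD
  set R : ℕ → ℝ := fun n => bumpMass N * w x -
    (∫ z, cutoff (e n) (x + S • z) * w (x + S • z) * bumpWeight z) + K * e n with hR
  -- pointwise, the cutoffs are eventually equal to `1`
  have hcut : ∀ y : Euc N, y ≠ 0 → ∀ᶠ n in Filter.atTop, cutoff (e n) y = 1 := by
    intro y hy
    have : ∀ᶠ n in Filter.atTop, e n < ‖y‖ / 2 :=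
      helim.eventually_lt_const (by have := norm_pos_iff.2 hy; positivity)
    filter_upwards [this] with n hn
    exact cutoff_eq_one (he0 n) (by linarith)
  have hae : ∀ᵐ z : Euc N, x + S • z ≠ 0 := by
    filter_upwards [ae_ne_point (-(S⁻¹ • x))] with z hz h
    apply hz
    have h1 : S • z = -x := by rw [eq_neg_iff_add_eq_zero, add_comm]; exact h
    rw [← smul_neg, ← h1, smul_smul, inv_mul_cancel₀ hS.ne', one_smul]
  have hwm : AEStronglyMeasurable w volume :=
    aestronglyMeasurable_of_continuousAt_ne_zero fun y hy => (hw.contDiffAt y hy).continuousAt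
  have hwm' : AEStronglyMeasurable (fun z => w (x + S • z)) volume :=
    hwm.comp_quasiMeasurePreserving ((quasiMeasurePreserving_add_left volume x).comp
      (by
        refine ⟨by fun_prop, ?_⟩
        rw [Measure.map_addHaar_smul volume hS.ne']
        exact Measure.smul_absolutelyContinuous))
  have hθ : Continuous (bumpWeight : Euc N → ℝ) := (contDiff_bumpWeight (n := 0)).continuous
  have hRlim : Filter.Tendsto R Filter.atTop (nhds D) := by
    obtain ⟨M, hM⟩ := hw.bdd (‖x‖ + S)
    have h1 : Filter.Tendsto (fun n => ∫ z, cutoff (e n) (x + S • z) * w (x + S • z) * bumpWeight z)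
        Filter.atTop (nhds (∫ z, w (x + S • z) * bumpWeight z)) := by
      refine tendsto_integral_of_dominated_convergence (fun z => M * bumpWeight z) ?_ ?_ ?_ ?_
      · intro n
        have : Continuous fun z : Euc N => cutoff (e n) (x + S • z) :=
          (contDiff_cutoff (n := 0) (e n)).continuous.comp (by fun_prop)
        exact (this.aestronglyMeasurable.mul hwm').mul hθ.aestronglyMeasurable
      · exact (continuous_const.mul hθ).integrable_of_hasCompactSupport
          hasCompactSupport_bumpWeight.mul_left
      · intro n
        filter_upwards [hae] with z hz
        by_cases hz1 : 1 ≤ ‖z‖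
        · simp [bumpWeight_eq_zero hz1]
        · have hn : ‖x + S • z‖ ≤ ‖x‖ + S := by
            refine (norm_add_le _ _).trans ?_
            rw [norm_smul, Real.norm_of_nonneg hS.le]
            nlinarith
          have h2 := hM _ hz hn
          rw [Real.norm_eq_abs, abs_mul, abs_mul, abs_of_nonneg (bumpWeight_nonneg z),
            abs_of_nonneg (cutoff_nonneg _ _)]
          refine mul_le_mul_of_nonneg_right ?_ (bumpWeight_nonneg z)
          calc _ ≤ 1 * |w (x + S • z)| := by gcongr; exact cutoff_le_one _ _
            _ ≤ M := by linarith
      · filter_upwards [hae] with z hz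
        refine tendsto_const_nhds.congr' ?_
        filter_upwards [hcut _ hz] with n hn
        rw [hn, one_mul]
    have h3 := (tendsto_const_nhds (x := bumpMass N * w x)).sub h1
    simpa [hR, hD] using h3.add (helim.const_mul K)
  have hev : ∀ᶠ n in Filter.atTop,
      0 ≤ c * (∫ y in closedBall x (S / 4), cutoff (e n) y * (-lap w y)) ∧
      c * (∫ y in closedBall x (S / 4), cutoff (e n) y * (-lap w y)) ≤ R n := by
    filter_upwards [helim.eventually_lt_const (show (0 : ℝ) < 1 / 2 by norm_num),
      helim.eventually_lt_const (show (0 : ℝ) < ‖x‖ / 4 by positivity)] with n h1 h2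
    refine ⟨mul_nonneg hc.le ?_, hK (e n) (he0 n) h1.le (by linarith)⟩
    refine integral_nonneg fun y => ?_
    by_cases hy : y = 0
    · simp [hy, cutoff_eq_zero (he0 n) (x := (0 : Euc N)) (by simpa using (he0 n).le)]
    · exact mul_nonneg (cutoff_nonneg _ _) (neg_nonneg.2 (hl y hy))
  have hD0 : 0 ≤ D := ge_of_tendsto hRlim (by filter_upwards [hev] with n hn using hn.1.trans hn.2)
  refine ⟨by linarith, ?_⟩
  have hjc : ∀ n, Continuous fun y => cutoff (e n) y * (-lap w y) := by
    intro n
    have : ContDiff ℝ (0 : ℕ) fun y => cutoff (e n) y * (-lap w y) :=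
      contDiff_cutoff_mul (w := fun y => -lap w y)
        (fun y hy => (contDiffAt_lap (hw.contDiffAt y hy)).neg) (he0 n)
    exact this.continuous
  have hne : ∀ᵐ y ∂(volume.restrict (closedBall x (S / 4))), y ≠ (0 : Euc N) := ae_restrict_of_ae (ae_ne_point 0)
  calc ∫⁻ y in closedBall x (S / 4), ENNReal.ofReal (-lap w y)
      ≤ ∫⁻ y in closedBall x (S / 4), Filter.liminf
          (fun n => ENNReal.ofReal (cutoff (e n) y * (-lap w y))) Filter.atTop := by
        refine lintegral_mono_ae ?_
        filter_upwards [hne] with y hy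
        have : Filter.Tendsto (fun n => ENNReal.ofReal (cutoff (e n) y * (-lap w y))) Filter.atTop
            (nhds (ENNReal.ofReal (-lap w y))) := by
          refine tendsto_const_nhds.congr' ?_
          filter_upwards [hcut y hy] with n hn
          rw [hn, one_mul]
        rw [this.liminf_eq]
    _ ≤ Filter.liminf (fun n => ∫⁻ y in closedBall x (S / 4),
          ENNReal.ofReal (cutoff (e n) y * (-lap w y))) Filter.atTop :=
        lintegral_liminf_le fun n => ((hjc n).measurable).ennreal_ofReal
    _ ≤ Filter.liminf (fun n => ENNReal.ofReal (c⁻¹ * R n)) Filter.atTop := by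
        refine Filter.liminf_le_liminf ?_
        filter_upwards [hev] with n hn
        rw [← ofReal_integral_eq_lintegral_ofReal]
        · refine ENNReal.ofReal_le_ofReal ?_
          rw [le_inv_mul_iff₀ hc]; exact hn.2
        · exact (hjc n).continuousOn.integrableOn_compact (isCompact_closedBall _ _)
        · filter_upwards [hne] with y hy
          exact mul_nonneg (cutoff_nonneg _ _) (neg_nonneg.2 (hl y hy))
    _ = ENNReal.ofReal (c⁻¹ * D) :=
        ((ENNReal.continuous_ofReal.tendsto _).comp (hRlim.const_mul c⁻¹)).liminf_eq

end Tame

section LocalBounds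

variable {N : ℕ}

lemma pd_bump_eq_zero {z : Euc N} (hz : 1 ≤ ‖z‖) (i : Fin N) : pd i bump z = 0 := by
  rw [pd_bump, bumpWeight_eq_zero hz, mul_zero, neg_zero]

lemma pd_bumpWeight_eq_zero {z : Euc N} (hz : 1 ≤ ‖z‖) (i : Fin N) : pd i bumpWeight z = 0 := by
  have hmin : IsMinOn (bumpWeight : Euc N → ℝ) univ z := fun y _ => by
    simp only [mem_ofPred_eq, bumpWeight_eq_zero hz]
    exact bumpWeight_nonneg y
  have := (hmin.isLocalMin Filter.univ_mem).fderiv_eq_zero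
  simp [pd, this]

lemma norm_add_smul_ge (x : Euc N) {z : Euc N} {s S : ℝ} (hs : 0 ≤ s) (hsS : s ≤ S) (hz : ‖z‖ < 1) : ‖x‖ - S ≤ ‖x + s • z‖ := by
  have h1 : ‖x‖ - ‖s • z‖ ≤ ‖x + s • z‖ := by
    simpa using norm_sub_norm_le x (-(s • z))
  rw [norm_smul, Real.norm_of_nonneg hs] at h1
  nlinarith

lemma bumpMass_mul_eq_of_lt {w : Euc N → ℝ} (hw : ∀ x, x ≠ 0 → ContDiffAt ℝ 2 w x) {x : Euc N}
    {S : ℝ} (hS0 : 0 ≤ S) (hS : S < ‖x‖) :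
    bumpMass N * w x = (∫ z, w (x + S • z) * bumpWeight z) -
      ∫ s in (0 : ℝ)..S, s * ∫ z, lap w (x + s • z) * bump z := by
  set ε := (‖x‖ - S) / 4 with hεd
  have hε : 0 < ε := by rw [hεd]; linarith
  have hid := integral_bumpWeight_eq_lap (contDiff_cutoff_mul hw hε) x hS0
  have hloc : ∀ s z, 0 ≤ s → s ≤ S → ‖z‖ < 1 →
      (fun y => cutoff ε y * w y) =ᶠ[nhds (x + s • z)] w := fun s z h1 h2 h3 =>
    cutoff_mul_eventuallyEq hε (by have := norm_add_smul_ge x h1 h2 h3; linarith)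
  have e1 : ∫ z, cutoff ε (x + S • z) * w (x + S • z) * bumpWeight z =
      ∫ z, w (x + S • z) * bumpWeight z := by
    refine integral_congr_ae (Filter.Eventually.of_forall fun z => ?_)
    by_cases hz : 1 ≤ ‖z‖
    · simp [bumpWeight_eq_zero hz]
    · have := (hloc S z hS0 le_rfl (not_le.1 hz)).self_of_nhds
      simp only at this ⊢
      rw [this]
  have e2 : (∫ s in (0 : ℝ)..S, s * ∫ z, lap (fun y => cutoff ε y * w y) (x + s • z) * bump z) =
      ∫ s in (0 : ℝ)..S, s * ∫ z, lap w (x + s • z) * bump z := by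
    refine intervalIntegral.integral_congr fun s hs => ?_
    rw [uIcc_of_le hS0] at hs
    congr 1
    refine integral_congr_ae (Filter.Eventually.of_forall fun z => ?_)
    by_cases hz : 1 ≤ ‖z‖
    · simp [bump_eq_zero hz]
    · simp only
      rw [lap_congr (hloc s z hs.1 hs.2 (not_le.1 hz))]
  have e3 : cutoff ε x * w x = w x :=
    (cutoff_mul_eventuallyEq hε (x := x) (w := w) (by linarith)).self_of_nhds
  simp only [e1, e2, e3] at hid
  linarith

lemma bumpMass_mul_pd_eq_of_lt {w : Euc N → ℝ} (hw : ∀ x, x ≠ 0 → ContDiffAt ℝ 2 w x) {x : Euc N}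
    {S : ℝ} (hS0 : 0 < S) (hS : S < ‖x‖) (i : Fin N) :
    bumpMass N * pd i w x = -(S⁻¹ * ∫ z, w (x + S • z) * pd i bumpWeight z) +
      ∫ s in (0 : ℝ)..S, ∫ z, lap w (x + s • z) * pd i bump z := by
  set ε := (‖x‖ - S) / 4 with hεd
  have hε : 0 < ε := by rw [hεd]; linarith
  have hcd := contDiff_cutoff_mul hw hε
  have hid := integral_pd_bumpWeight_eq_lap hcd x hS0.le i
  have hloc : ∀ s z, 0 ≤ s → s ≤ S → ‖z‖ < 1 →
      (fun y => cutoff ε y * w y) =ᶠ[nhds (x + s • z)] w := fun s z h1 h2 h3 =>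
    cutoff_mul_eventuallyEq hε (by have := norm_add_smul_ge x h1 h2 h3; linarith)
  have hibp := integral_pd_affine_mul (hcd.of_le (by norm_num)) (contDiff_bumpWeight (n := 1))
    hasCompactSupport_bumpWeight x S i
  have hz0 : ∀ z : Euc N, 1 ≤ ‖z‖ → pd i bumpWeight z = 0 := fun z hz =>
    pd_bumpWeight_eq_zero hz i
  have e1 : ∫ z, cutoff ε (x + S • z) * w (x + S • z) * pd i bumpWeight z =
      ∫ z, w (x + S • z) * pd i bumpWeight z := by
    refine integral_congr_ae (Filter.Eventually.of_forall fun z => ?_)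
    by_cases hz : 1 ≤ ‖z‖
    · simp [hz0 z hz]
    · have := (hloc S z hS0.le le_rfl (not_le.1 hz)).self_of_nhds
      simp only at this ⊢
      rw [this]
  have e2 : (∫ s in (0 : ℝ)..S, ∫ z, lap (fun y => cutoff ε y * w y) (x + s • z) * pd i bump z) =
      ∫ s in (0 : ℝ)..S, ∫ z, lap w (x + s • z) * pd i bump z := by
    refine intervalIntegral.integral_congr fun s hs => ?_
    rw [uIcc_of_le hS0.le] at hs
    refine integral_congr_ae (Filter.Eventually.of_forall fun z => ?_)
    by_cases hz : 1 ≤ ‖z‖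
    · simp [pd_bump_eq_zero hz]
    · simp only
      rw [lap_congr (hloc s z hs.1 hs.2 (not_le.1 hz))]
  have e3 : pd i (fun y => cutoff ε y * w y) x = pd i w x :=
    pd_congr (cutoff_mul_eventuallyEq hε (x := x) (w := w) (by linarith)) i
  rw [e1] at hibp
  rw [e2, e3] at hid
  have h4 : ∫ z, pd i (fun y => cutoff ε y * w y) (x + S • z) * bumpWeight z =
      -(S⁻¹ * ∫ z, w (x + S • z) * pd i bumpWeight z) := by
    rw [hibp]
    field_simp
  rw [h4] at hid
  linarith

lemma enorm_integral_mul_le {f φ : Euc N → ℝ} {B : ℝ} (hB : ∀ z, |φ z| ≤ B)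
    (hz : ∀ z, 1 ≤ ‖z‖ → φ z = 0) :
    ‖∫ z, f z * φ z‖ₑ ≤ ENNReal.ofReal B * ∫⁻ z in ball (0 : Euc N) 1, ‖f z‖ₑ := by
  refine (enorm_integral_le_lintegral_enorm _).trans ?_
  rw [← lintegral_const_mul' _ _ ENNReal.ofReal_ne_top,
    ← lintegral_indicator isOpen_ball.measurableSet]
  refine lintegral_mono fun z => ?_
  by_cases h : z ∈ ball (0 : Euc N) 1
  · rw [indicator_of_mem h, enorm_mul, mul_comm]
    gcongr
    rw [Real.enorm_eq_ofReal_abs]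
    exact ENNReal.ofReal_le_ofReal (hB z)
  · rw [indicator_of_notMem h, hz z (by simpa using h)]
    simp

/-- Pointwise bounds for a function and its gradient in terms of local integrals of the function
and of its Laplacian. -/
lemma exists_enorm_le_lintegral (N : ℕ) : ∃ B : ℝ, 0 < B ∧ ∀ w : Euc N → ℝ,
    (∀ x, x ≠ 0 → ContDiffAt ℝ 2 w x) → ∀ (x : Euc N) (S : ℝ), 0 < S → S < ‖x‖ →
    ‖w x‖ₑ ≤ ENNReal.ofReal B * ((∫⁻ z in ball (0 : Euc N) 1, ‖w (x + S • z)‖ₑ) +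
      ∫⁻ s in Ioc 0 S, ENNReal.ofReal s * ∫⁻ z in ball (0 : Euc N) 1, ‖lap w (x + s • z)‖ₑ) ∧
    ∀ i, ‖pd i w x‖ₑ ≤ ENNReal.ofReal B *
      (ENNReal.ofReal S⁻¹ * (∫⁻ z in ball (0 : Euc N) 1, ‖w (x + S • z)‖ₑ) +
      ∫⁻ s in Ioc 0 S, ∫⁻ z in ball (0 : Euc N) 1, ‖lap w (x + s • z)‖ₑ) := by
  obtain ⟨B1, h1, hb1⟩ := exists_upper_bound (contDiff_bump (N := N) (n := 0)).continuous
    hasCompactSupport_bump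
  obtain ⟨B2, h2, hb2⟩ := exists_upper_bound (contDiff_bumpWeight (N := N) (n := 0)).continuous
    hasCompactSupport_bumpWeight
  have hg1 : ∀ i : Fin N, ∃ C > 0, ∀ z : Euc N, |pd i bump z| ≤ C := fun i =>
    exists_upper_bound (contDiff_pd (m := 0) (n := 1) le_rfl contDiff_bump i).continuous
      (hasCompactSupport_bump.fderiv_apply (𝕜 := ℝ) _)
  have hg2 : ∀ i : Fin N, ∃ C > 0, ∀ z : Euc N, |pd i bumpWeight z| ≤ C := fun i =>
    exists_upper_bound (contDiff_pd (m := 0) (n := 1) le_rfl contDiff_bumpWeight i).continuous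
      (hasCompactSupport_bumpWeight.fderiv_apply (𝕜 := ℝ) _)
  choose C1 hC1 hc1 using hg1
  choose C2 hC2 hc2 using hg2
  have hm := bumpMass_pos (N := N)
  set A := B1 + B2 + ∑ i, (C1 i + C2 i) with hA
  have hs : ∀ i, C1 i + C2 i ≤ ∑ i, (C1 i + C2 i) := fun i =>
    Finset.single_le_sum (f := fun i => C1 i + C2 i)
      (fun i _ => (add_pos (hC1 i) (hC2 i)).le) (Finset.mem_univ i)
  have hs0 : 0 ≤ ∑ i, (C1 i + C2 i) :=
    Finset.sum_nonneg fun i _ => (add_pos (hC1 i) (hC2 i)).le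
  have hA0 : 0 < A := by rw [hA]; positivity
  refine ⟨(bumpMass N)⁻¹ * A, by positivity, fun w hw x S hS hSx => ?_⟩
  have key : ∀ t : ℝ, ‖t‖ₑ = ENNReal.ofReal (bumpMass N)⁻¹ * ‖bumpMass N * t‖ₑ := by
    intro t
    rw [enorm_mul, ← mul_assoc, Real.enorm_eq_ofReal hm.le, ← ENNReal.ofReal_mul (by positivity),
      inv_mul_cancel₀ hm.ne', ENNReal.ofReal_one, one_mul]
  rw [ENNReal.ofReal_mul (by positivity)]
  constructor
  · rw [key, mul_assoc, bumpMass_mul_eq_of_lt hw hS.le hSx, mul_add]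
    gcongr
    refine (enorm_sub_le).trans (add_le_add ?_ ?_)
    · exact enorm_integral_mul_le (fun z => (hb2 z).trans (by rw [hA]; linarith))
        (fun z hz => bumpWeight_eq_zero hz)
    · rw [intervalIntegral.integral_of_le hS.le]
      refine (enorm_integral_le_lintegral_enorm _).trans ?_
      rw [← lintegral_const_mul' _ _ ENNReal.ofReal_ne_top]
      refine setLIntegral_mono' measurableSet_Ioc fun s hs => ?_
      rw [enorm_mul, Real.enorm_eq_ofReal hs.1.le, mul_left_comm]
      gcongr
      exact enorm_integral_mul_le (fun z => (hb1 z).trans (by rw [hA]; linarith))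
        (fun z hz => bump_eq_zero hz)
  · intro i
    rw [key, mul_assoc, bumpMass_mul_pd_eq_of_lt hw hS hSx i, mul_add]
    gcongr
    refine (enorm_add_le _ _).trans (add_le_add ?_ ?_)
    · rw [enorm_neg, enorm_mul, Real.enorm_eq_ofReal (by positivity : 0 ≤ S⁻¹), mul_left_comm]
      gcongr
      exact enorm_integral_mul_le (fun z => (hc2 i z).trans (by
        have := hs i; have := hC1 i; rw [hA]; linarith))
        (fun z hz => pd_bumpWeight_eq_zero hz i)
    · rw [intervalIntegral.integral_of_le hS.le]
      refine (enorm_integral_le_lintegral_enorm _).trans ?_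
      rw [← lintegral_const_mul' _ _ ENNReal.ofReal_ne_top]
      refine setLIntegral_mono' measurableSet_Ioc fun s hs' => ?_
      exact enorm_integral_mul_le (fun z => (hc1 i z).trans (by
        have := hs i; have := hC2 i; rw [hA]; linarith)) (fun z hz => pd_bump_eq_zero hz i)

end LocalBounds

section RieszPotential

variable {N : ℕ}

/-- A continuous function, `C²` off the origin, whose Laplacian is `O(|x|⁻²)` at the origin, has
gradient `O(|x|⁻¹)` at the origin. -/
lemma Tame.of_lap_bound {w : Euc N → ℝ} (hc : Continuous w)
    (hw : ∀ x, x ≠ 0 → ContDiffAt ℝ 2 w x) {K : ℝ}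
    (hl : ∀ x, x ≠ 0 → ‖x‖ ≤ 2 → |lap w x| ≤ K / ‖x‖ ^ 2) : Tame w := by
  have hbd : ∀ R, ∃ M, ∀ x : Euc N, ‖x‖ ≤ R → |w x| ≤ M := by
    intro R
    obtain ⟨M, hM⟩ := (isCompact_closedBall (0 : Euc N) R).exists_bound_of_continuousOn
      hc.continuousOn
    exact ⟨M, fun x hx => hM x (by simpa using hx)⟩
  refine ⟨hw, fun R => (hbd R).imp fun M hM x _ => hM x, ?_⟩
  obtain ⟨B, hB, hrep⟩ := exists_enorm_le_lintegral N
  obtain ⟨M, hM⟩ := hbd 2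
  have hM0 : 0 ≤ M := (abs_nonneg _).trans (hM 0 (by simp))
  set ω := (volume : Measure (Euc N)).real (ball 0 1) with hω
  have hω0 : 0 ≤ ω := measureReal_nonneg
  have hvol : (volume : Measure (Euc N)) (ball 0 1) = ENNReal.ofReal ω := by
    rw [hω, measureReal_def, ENNReal.ofReal_toReal measure_ball_lt_top.ne]
  refine ⟨B * (2 * (M * ω) + 2 * |K| * ω), fun x i hx hx1 => ?_⟩
  have hx0 : 0 < ‖x‖ := norm_pos_iff.2 hx
  have h := (hrep w hw x (‖x‖ / 2) (by positivity) (by linarith)).2 i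
  have hmem : ∀ s z, 0 ≤ s → s ≤ ‖x‖ / 2 → ‖z‖ < 1 →
      ‖x‖ / 2 ≤ ‖x + s • z‖ ∧ ‖x + s • z‖ ≤ 2 := by
    intro s z h1 h2 h3
    refine ⟨by have := norm_add_smul_ge x h1 h2 h3; linarith, ?_⟩
    refine (norm_add_le _ _).trans ?_
    rw [norm_smul, Real.norm_of_nonneg h1]
    nlinarith [norm_nonneg z]
  have i1 : ∫⁻ z in ball (0 : Euc N) 1, ‖w (x + (‖x‖ / 2) • z)‖ₑ ≤ ENNReal.ofReal (M * ω) := by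
    calc _ ≤ ∫⁻ _z in ball (0 : Euc N) 1, ENNReal.ofReal M := by
          refine setLIntegral_mono' isOpen_ball.measurableSet fun z hz => ?_
          rw [Real.enorm_eq_ofReal_abs]
          exact ENNReal.ofReal_le_ofReal
            (hM _ (hmem _ z (by positivity) le_rfl (by simpa using hz)).2)
      _ = _ := by rw [setLIntegral_const, hvol, ENNReal.ofReal_mul hM0]
  have i2 : ∫⁻ s in Ioc 0 (‖x‖ / 2), ∫⁻ z in ball (0 : Euc N) 1, ‖lap w (x + s • z)‖ₑ ≤
      ENNReal.ofReal (|K| / (‖x‖ / 2) ^ 2 * ω * (‖x‖ / 2)) := by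
    calc _ ≤ ∫⁻ _s in Ioc 0 (‖x‖ / 2), ENNReal.ofReal (|K| / (‖x‖ / 2) ^ 2 * ω) := by
          refine setLIntegral_mono' measurableSet_Ioc fun s hs => ?_
          calc _ ≤ ∫⁻ _z in ball (0 : Euc N) 1, ENNReal.ofReal (|K| / (‖x‖ / 2) ^ 2) := by
                refine setLIntegral_mono' isOpen_ball.measurableSet fun z hz => ?_
                rw [Real.enorm_eq_ofReal_abs]
                have h3 := hmem s z hs.1.le hs.2 (by simpa using hz)
                have h4 : x + s • z ≠ 0 := norm_pos_iff.1 (by linarith)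
                refine ENNReal.ofReal_le_ofReal ((hl _ h4 h3.2).trans ?_)
                have := le_abs_self K
                have h5 := h3.1
                gcongr
            _ = _ := by rw [setLIntegral_const, hvol, ENNReal.ofReal_mul (by positivity)]
      _ = _ := by
          rw [setLIntegral_const, Real.volume_Ioc, sub_zero, ← ENNReal.ofReal_mul (by positivity)]
  have h6 : ‖pd i w x‖ₑ ≤ ENNReal.ofReal (B * ((‖x‖ / 2)⁻¹ * (M * ω) +
      |K| / (‖x‖ / 2) ^ 2 * ω * (‖x‖ / 2))) := by
    refine h.trans ?_
    rw [ENNReal.ofReal_mul hB.le, ENNReal.ofReal_add (by positivity) (by positivity),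
      ENNReal.ofReal_mul (p := (‖x‖ / 2)⁻¹) (by positivity)]
    gcongr
  rw [Real.enorm_eq_ofReal_abs, ENNReal.ofReal_le_ofReal_iff (by positivity)] at h6
  refine h6.trans (le_of_eq ?_)
  field_simp

lemma lintegral_Ioi_rpow_le {r e : ℝ} (hr : 0 < r) (he : e ≤ -2) :
    ∫⁻ s in Ioi r, ENNReal.ofReal (s ^ e) ≤ ENNReal.ofReal (r ^ (e + 1)) := by
  rw [← ofReal_integral_eq_lintegral_ofReal (integrableOn_Ioi_rpow_of_lt (by linarith) hr)
    (by
      filter_upwards [ae_restrict_mem measurableSet_Ioi] with s hs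
      exact Real.rpow_nonneg (hr.le.trans (le_of_lt hs)) _),
    integral_Ioi_rpow_of_lt (by linarith) hr]
  refine ENNReal.ofReal_le_ofReal ?_
  have h : 0 ≤ r ^ (e + 1) := Real.rpow_nonneg hr.le _
  rw [neg_div, ← div_neg]
  exact div_le_self h (by linarith)

lemma lintegral_ball_comp (H : Euc N → ENNReal) (x : Euc N) {s : ℝ} (hs : 0 < s) :
    ∫⁻ z in ball (0 : Euc N) 1, H (x + s • z) =
      ENNReal.ofReal ((s ^ N)⁻¹) * ∫⁻ y in ball x s, H y := by
  rw [← lintegral_indicator isOpen_ball.measurableSet,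
    ← lintegral_indicator isOpen_ball.measurableSet, ← lintegral_comp_affine _ x hs]
  refine lintegral_congr fun z => ?_
  have h : z ∈ ball (0 : Euc N) 1 ↔ x + s • z ∈ ball x s := by
    simp [norm_smul, abs_of_pos hs, hs]
  by_cases hz : z ∈ ball (0 : Euc N) 1
  · rw [indicator_of_mem hz, indicator_of_mem (h.1 hz)]
  · rw [indicator_of_notMem hz, indicator_of_notMem (fun hc => hz (h.2 hc))]

/-- Spherical averages integrated over radii are controlled by a Riesz potential. -/
lemma lintegral_Ioc_ball_le [NeZero N] {H : Euc N → ENNReal} (hH : Measurable H) (x : Euc N) (S : ℝ)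
    {j : ℝ} (hj : j + 2 ≤ N) :
    ∫⁻ s in Ioc 0 S, ENNReal.ofReal (s ^ j) * ∫⁻ z in ball (0 : Euc N) 1, H (x + s • z) ≤
      ∫⁻ y in ball x S, H y * ENNReal.ofReal (‖y - x‖ ^ (j + 1 - N)) := by
  set k : ℝ → Euc N → ENNReal := fun s y =>
    indicator {p : ℝ × Euc N | ‖p.2 - x‖ < p.1} (fun p => H p.2 * ENNReal.ofReal (p.1 ^ (j - N)))
      (s, y) with hk
  have hset : MeasurableSet {p : ℝ × Euc N | ‖p.2 - x‖ < p.1} :=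
    (isOpen_lt (by fun_prop) (by fun_prop)).measurableSet
  have hkm : Measurable (Function.uncurry k) := by
    refine Measurable.indicator ?_ hset
    fun_prop
  calc ∫⁻ s in Ioc 0 S, ENNReal.ofReal (s ^ j) * ∫⁻ z in ball (0 : Euc N) 1, H (x + s • z)
      = ∫⁻ s in Ioc 0 S, ∫⁻ y, k s y := by
        refine setLIntegral_congr_fun measurableSet_Ioc fun s hs => ?_
        rw [lintegral_ball_comp H x hs.1, ← mul_assoc, ← ENNReal.ofReal_mul (by
          have := hs.1; positivity), ← lintegral_const_mul _ hH,
          ← lintegral_indicator isOpen_ball.measurableSet]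
        refine lintegral_congr fun y => ?_
        have e : s ^ j * (s ^ N)⁻¹ = s ^ (j - N) := by
          rw [Real.rpow_sub hs.1, Real.rpow_natCast, div_eq_mul_inv]
        simp only [hk, indicator, mem_ball, dist_eq_norm, mem_ofPred_eq]
        rw [e, mul_comm]
    _ = ∫⁻ y, ∫⁻ s in Ioc 0 S, k s y := by
        rw [lintegral_lintegral_swap hkm.aemeasurable]
    _ ≤ ∫⁻ y, indicator (ball x S) (fun y => H y * ENNReal.ofReal (‖y - x‖ ^ (j + 1 - N))) y := by
        refine lintegral_mono_ae ?_
        filter_upwards [ae_ne_point x] with y hy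
        have hr : 0 < ‖y - x‖ := norm_pos_iff.2 (sub_ne_zero.2 hy)
        by_cases hyS : y ∈ ball x S
        · rw [indicator_of_mem hyS]
          calc ∫⁻ s in Ioc 0 S, k s y
              ≤ ∫⁻ s, indicator (Ioi ‖y - x‖) (fun s => H y * ENNReal.ofReal (s ^ (j - N))) s := by
                refine (setLIntegral_le_lintegral _ _).trans (le_of_eq ?_)
                refine lintegral_congr fun s => ?_
                simp only [hk, indicator, mem_ofPred_eq, mem_Ioi]
            _ = H y * ∫⁻ s in Ioi ‖y - x‖, ENNReal.ofReal (s ^ (j - N)) := by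
                rw [lintegral_indicator measurableSet_Ioi, lintegral_const_mul _ (by fun_prop)]
            _ ≤ _ := by
                gcongr
                refine (lintegral_Ioi_rpow_le hr (by linarith)).trans (le_of_eq ?_)
                congr 2; ring
        · rw [indicator_of_notMem hyS]
          refine le_of_eq (setLIntegral_eq_zero measurableSet_Ioc fun s hs => ?_)
          refine indicator_of_notMem ?_ _
          simp only [mem_ball, dist_eq_norm, not_lt] at hyS
          simp only [mem_ofPred_eq, not_lt]
          exact hs.2.trans hyS
    _ = _ := lintegral_indicator isOpen_ball.measurableSet _

end RieszPotential

section BasicEstimates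

variable {N : ℕ}

/-- Nonnegative solutions of the Hénon–Lane–Emden system. -/
structure IsNonnegSol (p q a b : ℝ) (u v : Euc N → ℝ) : Prop where
  continuous_fst : Continuous u
  continuous_snd : Continuous v
  contDiffAt_fst : ∀ x, x ≠ 0 → ContDiffAt ℝ 2 u x
  contDiffAt_snd : ∀ x, x ≠ 0 → ContDiffAt ℝ 2 v x
  nonneg_fst : ∀ x, 0 ≤ u x
  nonneg_snd : ∀ x, 0 ≤ v x
  lap_fst : ∀ x, x ≠ 0 → lap u x = -(‖x‖ ^ a * v x ^ p)
  lap_snd : ∀ x, x ≠ 0 → lap v x = -(‖x‖ ^ b * u x ^ q)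

lemma abs_rpow_sub_one_mul {t p : ℝ} (ht : 0 ≤ t) (hp : 0 < p) : |t| ^ (p - 1) * t = t ^ p := by
  rcases ht.eq_or_lt with rfl | h
  · rw [mul_zero, Real.zero_rpow hp.ne']
  · rw [abs_of_pos h, Real.rpow_sub_one h.ne']
    field_simp

lemma IsHLESol.isNonnegSol {p q a b : ℝ} (hp : 0 < p) (hq : 0 < q) {u v : Euc N → ℝ}
    (h : IsHLESol p q a b u v) (hu : ∀ x, 0 ≤ u x) (hv : ∀ x, 0 ≤ v x) :
    IsNonnegSol p q a b u v := by
  obtain ⟨h1, h2, h3, h4, h5, h6⟩ := h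
  have ho : IsOpen {x : Euc N | x ≠ 0} := isOpen_ne
  refine ⟨h3, h4, fun x hx => h1.contDiffAt (ho.mem_nhds hx),
    fun x hx => h2.contDiffAt (ho.mem_nhds hx), hu, hv, fun x hx => ?_, fun x hx => ?_⟩
  · rw [← abs_rpow_sub_one_mul (hv x) hp, ← h5 x hx, neg_neg]
  · rw [← abs_rpow_sub_one_mul (hu x) hq, ← h6 x hx, neg_neg]

namespace IsNonnegSol

variable {p q a b : ℝ} {u v : Euc N → ℝ}

lemma symm (h : IsNonnegSol p q a b u v) : IsNonnegSol q p b a v u :=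
  ⟨h.2, h.1, h.4, h.3, h.6, h.5, h.8, h.7⟩

lemma superharmonic (h : IsNonnegSol p q a b u v) (x : Euc N) (hx : x ≠ 0) : lap u x ≤ 0 := by
  rw [h.lap_fst x hx]
  have := h.nonneg_snd x
  have : 0 ≤ ‖x‖ ^ a * v x ^ p := by positivity
  linarith

lemma tame (h : IsNonnegSol p q a b u v) (hp : 0 < p) (ha : -2 < a) : Tame u := by
  obtain ⟨M, hM⟩ := (isCompact_closedBall (0 : Euc N) 2).exists_bound_of_continuousOn
    h.continuous_snd.continuousOn
  have hM0 : 0 ≤ M := (norm_nonneg _).trans (hM 0 (by simp))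
  refine Tame.of_lap_bound (K := 2 ^ (a + 2) * M ^ p) h.continuous_fst h.contDiffAt_fst
    fun x hx hx2 => ?_
  have h0 : 0 < ‖x‖ := norm_pos_iff.2 hx
  have hv := h.nonneg_snd x
  have h1 : v x ≤ M := (le_abs_self _).trans (hM x (by simpa using hx2))
  rw [h.lap_fst x hx, abs_neg, abs_of_nonneg (by positivity), le_div_iff₀ (by positivity)]
  have e : ‖x‖ ^ a * ‖x‖ ^ 2 = ‖x‖ ^ (a + 2) := by
    rw [Real.rpow_add h0]; norm_num
  calc ‖x‖ ^ a * v x ^ p * ‖x‖ ^ 2 = ‖x‖ ^ (a + 2) * v x ^ p := by rw [← e]; ring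
    _ ≤ _ := by gcongr; linarith

/-- The scaling invariance of the system. -/
lemma comp_smul (h : IsNonnegSol p q a b u v) {R : ℝ} (hR : 0 < R) {s t : ℝ}
    (h1 : s + 2 + a = p * t) (h2 : t + 2 + b = q * s) :
    IsNonnegSol p q a b (fun x => R ^ s * u (R • x)) (fun x => R ^ t * v (R • x)) := by
  have key : ∀ {p a s t : ℝ} {u v : Euc N → ℝ}, s + 2 + a = p * t →
      (∀ x, x ≠ 0 → ContDiffAt ℝ 2 u x) → (∀ x, 0 ≤ v x) →
      (∀ x, x ≠ 0 → lap u x = -(‖x‖ ^ a * v x ^ p)) → ∀ x : Euc N, x ≠ 0 →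
      ContDiffAt ℝ 2 (fun x => R ^ s * u (R • x)) x ∧
      lap (fun x => R ^ s * u (R • x)) x = -(‖x‖ ^ a * (R ^ t * v (R • x)) ^ p) := by
    intro p a s t u v h1 hu hv hl x hx
    have hRx : R • x ≠ 0 := smul_ne_zero hR.ne' hx
    have hcd : ContDiffAt ℝ 2 (fun x => R ^ s * u (R • x)) x :=
      contDiffAt_const.mul ((hu _ hRx).comp x (by fun_prop))
    refine ⟨hcd, ?_⟩
    rw [lap_eq_sum_pd hcd]
    have hev : ∀ᶠ y in nhds x, y ≠ 0 := isOpen_ne.mem_nhds hx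
    have e1 : ∀ i, pd i (fun x => R ^ s * u (R • x)) =ᶠ[nhds x]
        fun y => (R ^ s * R) * pd i u (0 + R • y) := by
      intro i
      filter_upwards [hev] with y hy
      have hRy : (0 : Euc N) + R • y ≠ 0 := by simpa using smul_ne_zero hR.ne' hy
      have hd : DifferentiableAt ℝ u (0 + R • y) := (hu _ hRy).differentiableAt (by norm_num)
      have hd' : DifferentiableAt ℝ (fun y => u (0 + R • y)) y :=
        DifferentiableAt.comp y hd (f := fun y => (0 : Euc N) + R • y) (by fun_prop)
      have e2 : (fun x => R ^ s * u (R • x)) = fun x => R ^ s * (fun y => u (0 + R • y)) x := by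
        simp
      rw [e2, pd_const_mul hd', pd_comp_affine 0 R y hd]
      ring
    have e3 : ∀ i, pd i (pd i (fun x => R ^ s * u (R • x))) x =
        R ^ s * R ^ 2 * pd i (pd i u) (R • x) := by
      intro i
      rw [pd_congr (e1 i)]
      have hRy : (0 : Euc N) + R • x ≠ 0 := by simpa using hRx
      have hd : DifferentiableAt ℝ (pd i u) (0 + R • x) :=
        (contDiffAt_pd (m := 1) (n := 2) le_rfl (hu _ hRy) i).differentiableAt (by norm_num)
      have hd' : DifferentiableAt ℝ (fun y => pd i u (0 + R • y)) x :=
        DifferentiableAt.comp x hd (f := fun y => (0 : Euc N) + R • y) (by fun_prop)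
      have := pd_const_mul (c := R ^ s * R) hd' i
      rw [this, pd_comp_affine 0 R x hd, zero_add]
      ring
    simp only [e3]
    rw [← Finset.mul_sum, ← lap_eq_sum_pd (hu _ hRx), hl _ hRx, norm_smul,
      Real.norm_of_nonneg hR.le, Real.mul_rpow hR.le (norm_nonneg _),
      Real.mul_rpow (by positivity) (hv _), ← Real.rpow_mul hR.le, mul_comm t p, ← h1,
      Real.rpow_add hR, Real.rpow_add hR]
    norm_num
    ring
  have k1 := key h1 h.contDiffAt_fst h.nonneg_snd h.lap_fst
  have k2 := key h2 h.contDiffAt_snd h.nonneg_fst h.lap_snd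
  have hu := h.continuous_fst
  have hv := h.continuous_snd
  exact ⟨by fun_prop, by fun_prop, fun x hx => (k1 x hx).1, fun x hx => (k2 x hx).1,
    fun x => mul_nonneg (by positivity) (h.nonneg_fst _),
    fun x => mul_nonneg (by positivity) (h.nonneg_snd _), fun x hx => (k1 x hx).2,
    fun x hx => (k2 x hx).2⟩

end IsNonnegSol

/-- Nonnegative superharmonic functions dominate their mean values. -/
lemma exists_lintegral_closedBall_le (hN : 3 ≤ N) {ρ : ℝ} (hρ : 0 < ρ) : ∃ C > 0,
    ∀ w : Euc N → ℝ, Continuous w → Tame w → (∀ x, 0 ≤ w x) → (∀ x, x ≠ 0 → lap w x ≤ 0) →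
    ∀ x, x ≠ 0 → ‖x‖ ≤ ρ →
      ∫⁻ y in closedBall (0 : Euc N) ρ, ENNReal.ofReal (w y) ≤ ENNReal.ofReal (C * w x) ∧
      ∫⁻ y in closedBall (0 : Euc N) ρ, ENNReal.ofReal (-lap w y) ≤ ENNReal.ofReal (C * w x) := by
  obtain ⟨C, hC, hsup⟩ := exists_superharmonic_bound hN (S := 8 * ρ) (by positivity)
  obtain ⟨c, hc, hlow⟩ := exists_lower_bound_bump (N := N)
  have hm := bumpMass_pos (N := N)
  refine ⟨max (C * bumpMass N) ((8 * ρ) ^ N * c⁻¹ * bumpMass N), by positivity,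
    fun w hwc hwt hw0 hsh x hx hxρ => ?_⟩
  have hwx := hw0 x
  obtain ⟨h1, h2⟩ := hsup w hwt hsh x hx
  have hI0 : 0 ≤ ∫ z, w (x + (8 * ρ) • z) * bumpWeight z :=
    integral_nonneg fun z => mul_nonneg (hw0 _) (bumpWeight_nonneg z)
  constructor
  · have hinteg : Integrable fun z => w (x + (8 * ρ) • z) * bumpWeight z := by
      refine Continuous.integrable_of_hasCompactSupport ?_ ?_
      · have := (contDiff_bumpWeight (N := N) (n := 0)).continuous
        fun_prop
      · refine hasCompactSupport_of_norm (R := 1) fun z hz => ?_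
        rw [bumpWeight_eq_zero (by linarith), mul_zero]
    have h3 : ENNReal.ofReal c * ∫⁻ z in closedBall (0 : Euc N) (1 / 2),
        ENNReal.ofReal (w (x + (8 * ρ) • z)) ≤ ENNReal.ofReal (bumpMass N * w x) := by
      refine le_trans ?_ (ENNReal.ofReal_le_ofReal h1)
      rw [ofReal_integral_eq_lintegral_ofReal hinteg
        (Filter.Eventually.of_forall fun z => mul_nonneg (hw0 _) (bumpWeight_nonneg z)),
        ← lintegral_const_mul' _ _ ENNReal.ofReal_ne_top]
      refine le_trans ?_ (setLIntegral_le_lintegral (closedBall (0 : Euc N) (1 / 2)) _)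
      refine setLIntegral_mono' isClosed_closedBall.measurableSet fun z hz => ?_
      rw [← ENNReal.ofReal_mul hc.le, mul_comm c]
      exact ENNReal.ofReal_le_ofReal
        (mul_le_mul_of_nonneg_left (hlow z (by simpa using hz)).2 (hw0 _))
    have h4 : ∫⁻ y in closedBall (0 : Euc N) ρ, ENNReal.ofReal (w y) ≤
        ENNReal.ofReal ((8 * ρ) ^ N) * ∫⁻ z in closedBall (0 : Euc N) (1 / 2),
        ENNReal.ofReal (w (x + (8 * ρ) • z)) := by
      have h8 : 0 < 8 * ρ := by positivity
      have := lintegral_comp_affine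
        ((closedBall (0 : Euc N) ρ).indicator fun y => ENNReal.ofReal (w y)) x h8
      rw [lintegral_indicator isClosed_closedBall.measurableSet] at this
      have h5 : ∫⁻ y in closedBall (0 : Euc N) ρ, ENNReal.ofReal (w y) =
          ENNReal.ofReal ((8 * ρ) ^ N) * ∫⁻ z, (closedBall (0 : Euc N) ρ).indicator
            (fun y => ENNReal.ofReal (w y)) (x + (8 * ρ) • z) := by
        rw [this, ← mul_assoc, ← ENNReal.ofReal_mul (by positivity),
          mul_inv_cancel₀ (by positivity), ENNReal.ofReal_one, one_mul]
      rw [h5]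
      refine mul_le_mul_right ?_ _
      rw [← lintegral_indicator isClosed_closedBall.measurableSet]
      refine lintegral_mono fun z => ?_
      by_cases hz : x + (8 * ρ) • z ∈ closedBall (0 : Euc N) ρ
      · have hz' : z ∈ closedBall (0 : Euc N) (1 / 2) := by
          simp only [mem_closedBall, dist_zero_right] at hz ⊢
          have h6 : ‖(8 * ρ) • z‖ ≤ 2 * ρ := by
            have : (8 * ρ) • z = (x + (8 * ρ) • z) - x := by abel
            rw [this]
            exact (norm_sub_le _ _).trans (by linarith)
          rw [norm_smul, Real.norm_of_nonneg h8.le] at h6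
          by_contra! h7
          nlinarith
        rw [indicator_of_mem hz, indicator_of_mem hz']
      · rw [indicator_of_notMem hz]; exact zero_le
    calc _ ≤ _ := h4
      _ = ENNReal.ofReal ((8 * ρ) ^ N * c⁻¹) * (ENNReal.ofReal c *
          ∫⁻ z in closedBall (0 : Euc N) (1 / 2), ENNReal.ofReal (w (x + (8 * ρ) • z))) := by
          rw [← mul_assoc, ← ENNReal.ofReal_mul (by positivity)]
          congr 2
          field_simp
      _ ≤ ENNReal.ofReal ((8 * ρ) ^ N * c⁻¹) * ENNReal.ofReal (bumpMass N * w x) := by gcongr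
      _ ≤ _ := by
          rw [← ENNReal.ofReal_mul (by positivity), ← mul_assoc]
          refine ENNReal.ofReal_le_ofReal (mul_le_mul_of_nonneg_right (le_max_right _ _) hwx)
  · have hsub : closedBall (0 : Euc N) ρ ⊆ closedBall x (8 * ρ / 4) := by
      refine closedBall_subset_closedBall' ?_
      rw [dist_zero_left]; linarith
    refine (lintegral_mono_set hsub).trans (h2.trans (ENNReal.ofReal_le_ofReal ?_))
    refine le_trans ?_ (mul_le_mul_of_nonneg_right (le_max_left _ _) hwx)
    nlinarith

lemma le_rpow_of_cross_le {p q K s t : ℝ} (hp : 0 < p) (hpq : 1 < p * q) (hK : 0 ≤ K)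
    (hs : 0 ≤ s) (ht : 0 ≤ t) (h1 : t ^ p ≤ K * s) (h2 : s ^ q ≤ K * t) :
    s ≤ K ^ ((1 + p) / (p * q - 1)) := by
  rcases hs.eq_or_lt with rfl | hs
  · positivity
  have h3 : s ^ (p * q) ≤ K ^ (1 + p) * s := by
    calc s ^ (p * q) = (s ^ q) ^ p := by rw [mul_comm, Real.rpow_mul hs.le]
      _ ≤ (K * t) ^ p := by gcongr
      _ = K ^ p * t ^ p := Real.mul_rpow hK ht
      _ ≤ K ^ p * (K * s) := by gcongr
      _ = _ := by
        rcases hK.eq_or_lt with rfl | hK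
        · rw [Real.zero_rpow hp.ne', Real.zero_rpow (by linarith)]; ring
        · rw [Real.rpow_add hK, Real.rpow_one]; ring
  have h4 : s ^ (p * q - 1) ≤ K ^ (1 + p) := by
    rw [Real.rpow_sub_one hs.ne', div_le_iff₀ hs]; exact h3
  have h5 : 0 < p * q - 1 := by linarith
  calc s = (s ^ (p * q - 1)) ^ (p * q - 1)⁻¹ := by
        rw [← Real.rpow_mul hs.le, mul_inv_cancel₀ h5.ne', Real.rpow_one]
    _ ≤ (K ^ (1 + p)) ^ (p * q - 1)⁻¹ := by gcongr
    _ = _ := by rw [← Real.rpow_mul hK]; rfl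

/-- Basic a priori estimates for nonnegative solutions. -/
lemma exists_basic_estimate (hN : 3 ≤ N) {p q a b : ℝ} (hp : 0 < p) (hq : 0 < q)
    (hpq : 1 < p * q) (ha : -2 < a) (hb : -2 < b) {ρ : ℝ} (hρ : 0 < ρ) : ∃ C > 0,
    ∀ u v : Euc N → ℝ, IsNonnegSol p q a b u v →
      ∫⁻ y in closedBall (0 : Euc N) ρ, ENNReal.ofReal (u y) ≤ ENNReal.ofReal C ∧
      ∫⁻ y in closedBall (0 : Euc N) ρ, ENNReal.ofReal (v y) ≤ ENNReal.ofReal C ∧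
      ∫⁻ y in closedBall (0 : Euc N) ρ, ENNReal.ofReal (-lap u y) ≤ ENNReal.ofReal C ∧
      ∫⁻ y in closedBall (0 : Euc N) ρ, ENNReal.ofReal (-lap v y) ≤ ENNReal.ofReal C := by
  obtain ⟨C, hC, hmean⟩ := exists_lintegral_closedBall_le hN hρ
  have : NeZero N := ⟨by omega⟩
  set e : Euc N := (3 * ρ / 4) • EuclideanSpace.single 0 1 with he
  have hen : ‖e‖ = 3 * ρ / 4 := by
    rw [he, norm_smul, Real.norm_of_nonneg (by positivity)]; simp
  set A := closedBall e (ρ / 4) with hA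
  have hAn : ∀ x ∈ A, ρ / 2 ≤ ‖x‖ ∧ ‖x‖ ≤ ρ := by
    intro x hx
    rw [hA, mem_closedBall, dist_eq_norm] at hx
    have h1 := norm_sub_norm_le e x
    have h2 := norm_sub_norm_le x e
    rw [norm_sub_rev] at h1
    constructor <;> linarith
  have hAc : IsCompact A := isCompact_closedBall _ _
  have hAne : A.Nonempty := ⟨e, mem_closedBall_self (by positivity)⟩
  set V := (volume : Measure (Euc N)).real A with hV
  have hVtop : (volume : Measure (Euc N)) A ≠ ⊤ := hAc.measure_lt_top.ne
  have hV0 : 0 < V := by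
    rw [hV, measureReal_def]
    exact ENNReal.toReal_pos (measure_closedBall_pos _ _ (by positivity)).ne' hVtop
  have hlow : ∀ c : ℝ, ∃ κ > 0, ∀ x ∈ A, κ ≤ ‖x‖ ^ c := by
    intro c
    obtain ⟨x₀, hx₀, hmin⟩ := hAc.exists_isMinOn (f := fun x => ‖x‖ ^ c) hAne
      (fun x hx => (ContinuousAt.rpow_const (by fun_prop)
        (Or.inl (by have := (hAn x hx).1; exact (by linarith : 0 < ‖x‖).ne'))).continuousWithinAt)
    have h0 : 0 < ‖x₀‖ := by have := (hAn x₀ hx₀).1; linarith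
    exact ⟨‖x₀‖ ^ c, by positivity, fun x hx => hmin hx⟩
  obtain ⟨κ₁, hκ₁, hk₁⟩ := hlow a
  obtain ⟨κ₂, hκ₂, hk₂⟩ := hlow b
  set κ := min κ₁ κ₂ with hκ
  have hκ0 : 0 < κ := lt_min hκ₁ hκ₂
  set K := C / (κ * V) with hK
  have hK0 : 0 < K := by positivity
  have half : ∀ {p q a b : ℝ} {u v : Euc N → ℝ}, 0 < p → -2 < a → (∀ x ∈ A, κ ≤ ‖x‖ ^ a) →
      IsNonnegSol p q a b u v → ∀ x ∈ A, ∀ y ∈ A, IsMinOn v A y → v y ^ p ≤ K * u x := by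
    intro p q a b u v hp ha hk h x hx y hy hmin
    have hx0 : x ≠ 0 := norm_pos_iff.1 (by have := (hAn x hx).1; linarith)
    have h1 := (hmean u h.continuous_fst (h.tame hp ha) h.nonneg_fst h.superharmonic x hx0
      (hAn x hx).2).2
    have hvy := h.nonneg_snd y
    have hux := h.nonneg_fst x
    have h2 : ENNReal.ofReal (κ * v y ^ p * V) ≤
        ∫⁻ z in closedBall (0 : Euc N) ρ, ENNReal.ofReal (-lap u z) := by
      have hsub : A ⊆ closedBall (0 : Euc N) ρ := fun z hz => by simpa using (hAn z hz).2
      refine le_trans ?_ (lintegral_mono_set hsub)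
      calc _ = ∫⁻ _z in A, ENNReal.ofReal (κ * v y ^ p) := by
            rw [setLIntegral_const, ENNReal.ofReal_mul (by positivity), hV, measureReal_def,
              ENNReal.ofReal_toReal hVtop]
        _ ≤ _ := by
            refine setLIntegral_mono' hAc.isClosed.measurableSet fun z hz => ?_
            have hz0 : z ≠ 0 := norm_pos_iff.1 (by have := (hAn z hz).1; linarith)
            rw [h.lap_fst z hz0, neg_neg]
            have h3 := hk z hz
            have h4 : v y ≤ v z := hmin hz
            gcongr
    have h5 := (ENNReal.ofReal_le_ofReal_iff (by positivity)).1 (h2.trans h1)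
    rw [hK, div_mul_eq_mul_div, le_div_iff₀ (by positivity)]
    linarith
  refine ⟨C * max (K ^ ((1 + p) / (p * q - 1))) (K ^ ((1 + q) / (q * p - 1))), by positivity,
    fun u v h => ?_⟩
  obtain ⟨x, hx, hxm⟩ := hAc.exists_isMinOn hAne h.continuous_fst.continuousOn
  obtain ⟨y, hy, hym⟩ := hAc.exists_isMinOn hAne h.continuous_snd.continuousOn
  have h1 := half hp ha (fun z hz => (min_le_left _ _).trans (hk₁ z hz)) h x hx y hy hym
  have h2 := half hq hb (fun z hz => (min_le_right _ _).trans (hk₂ z hz)) h.symm y hy x hx hxm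
  have h3 := le_rpow_of_cross_le hp hpq hK0.le (h.nonneg_fst x) (h.nonneg_snd y) h1 h2
  have h4 := le_rpow_of_cross_le hq (by rwa [mul_comm]) hK0.le (h.nonneg_snd y) (h.nonneg_fst x)
    h2 h1
  have hx0 : x ≠ 0 := norm_pos_iff.1 (by have := (hAn x hx).1; linarith)
  have hy0 : y ≠ 0 := norm_pos_iff.1 (by have := (hAn y hy).1; linarith)
  have h5 := hmean u h.continuous_fst (h.tame hp ha) h.nonneg_fst h.superharmonic x hx0
    (hAn x hx).2
  have h6 := hmean v h.continuous_snd (h.symm.tame hq hb) h.nonneg_snd h.symm.superharmonic y hy0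
    (hAn y hy).2
  have h7 := mul_le_mul_of_nonneg_left (h3.trans (le_max_left _ (K ^ ((1 + q) / (q * p - 1)))))
    hC.le
  have h8 := mul_le_mul_of_nonneg_left (h4.trans (le_max_right (K ^ ((1 + p) / (p * q - 1))) _))
    hC.le
  exact ⟨h5.1.trans (ENNReal.ofReal_le_ofReal h7), h6.1.trans (ENNReal.ofReal_le_ofReal h8),
    h5.2.trans (ENNReal.ofReal_le_ofReal h7), h6.2.trans (ENNReal.ofReal_le_ofReal h8)⟩

/-- A nonnegative solution whose first component is nontrivial is locally bounded below. -/
lemma IsNonnegSol.exists_lower_bound (hN : 3 ≤ N) {p q a b : ℝ} {u v : Euc N → ℝ}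
    (h : IsNonnegSol p q a b u v) (hp : 0 < p) (ha : -2 < a) (hne : ∃ x, u x ≠ 0) (ρ : ℝ) :
    ∃ c > 0, ∀ x, x ≠ 0 → ‖x‖ ≤ ρ → c ≤ u x := by
  obtain ⟨x₀, hx₀⟩ := hne
  set r := max ρ (‖x₀‖ + 1) with hr
  have hr0 : 0 < r := by have := le_max_right ρ (‖x₀‖ + 1); have := norm_nonneg x₀; linarith
  obtain ⟨C, hC, hmean⟩ := exists_lintegral_closedBall_le hN hr0
  set I := ∫⁻ y in closedBall (0 : Euc N) r, ENNReal.ofReal (u y) with hI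
  have hI0 : 0 < I := by
    rw [hI, ← lintegral_indicator isClosed_closedBall.measurableSet]
    have hpos : 0 < u x₀ := lt_of_le_of_ne (h.nonneg_fst _) (Ne.symm hx₀)
    set U := {y : Euc N | u x₀ / 2 < u y} ∩ ball (0 : Euc N) r with hU
    have hUo : IsOpen U := (isOpen_lt continuous_const h.continuous_fst).inter isOpen_ball
    have hUn : U.Nonempty := ⟨x₀, by simp; linarith, by
      rw [mem_ball, dist_zero_right, hr]; exact lt_max_of_lt_right (by linarith)⟩
    calc 0 < ENNReal.ofReal (u x₀ / 2) * volume U :=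
          ENNReal.mul_pos (by simpa using hpos) (hUo.measure_pos _ hUn).ne'
      _ = ∫⁻ y, U.indicator (fun _ => ENNReal.ofReal (u x₀ / 2)) y := by
          rw [lintegral_indicator hUo.measurableSet, setLIntegral_const]
      _ ≤ _ := by
          refine lintegral_mono fun y => ?_
          by_cases hy : y ∈ U
          · rw [indicator_of_mem hy, indicator_of_mem (ball_subset_closedBall hy.2)]
            exact ENNReal.ofReal_le_ofReal (le_of_lt hy.1)
          · rw [indicator_of_notMem hy]; exact zero_le
  have hItop : I ≠ ⊤ := by
    rw [hI]
    have hinteg : IntegrableOn u (closedBall (0 : Euc N) r) :=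
      h.continuous_fst.continuousOn.integrableOn_compact (isCompact_closedBall _ _)
    exact hinteg.lintegral_lt_top.ne
  refine ⟨I.toReal / C, div_pos (ENNReal.toReal_pos hI0.ne' hItop) hC, fun x hx hxρ => ?_⟩
  have h1 := (hmean u h.continuous_fst (h.tame hp ha) h.nonneg_fst h.superharmonic x hx
    (hxρ.trans (le_max_left _ _))).1
  rw [div_le_iff₀ hC, mul_comm]
  exact ENNReal.toReal_le_of_le_ofReal (mul_nonneg hC.le (h.nonneg_fst x)) h1

end BasicEstimates

section PointwiseBounds

variable {N : ℕ}

lemma IsNonnegSol.exists_pointwise_bound (hN : 3 ≤ N) {p q a b : ℝ} (hp : 0 < p) (hq : 0 < q)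
    (hpq : 1 < p * q) (ha : -2 < a) (hb : -2 < b) {ρ : ℝ} (hρ : 0 < ρ) : ∃ C > 0,
    ∀ u v : Euc N → ℝ, IsNonnegSol p q a b u v → ∀ x, 1 ≤ ‖x‖ → ‖x‖ + 1 / 2 ≤ ρ →
      ENNReal.ofReal (u x) ≤ ENNReal.ofReal C * (1 + ∫⁻ y in {y : Euc N | 1 / 2 ≤ ‖y‖ ∧ ‖y‖ ≤ ρ},
        ENNReal.ofReal (‖y‖ ^ a * v y ^ p) * ENNReal.ofReal (‖y - x‖ ^ (2 - N : ℝ))) ∧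
      ∀ i, ‖pd i u x‖ₑ ≤ ENNReal.ofReal C * (1 + ∫⁻ y in {y : Euc N | 1 / 2 ≤ ‖y‖ ∧ ‖y‖ ≤ ρ},
        ENNReal.ofReal (‖y‖ ^ a * v y ^ p) * ENNReal.ofReal (‖y - x‖ ^ (1 - N : ℝ))) := by
  have : NeZero N := ⟨by omega⟩
  obtain ⟨C₁, hC₁, hbe⟩ := exists_basic_estimate hN hp hq hpq ha hb hρ
  obtain ⟨B, hB, hrep⟩ := exists_enorm_le_lintegral N
  set L := 2 * (((1 / 2 : ℝ) ^ N)⁻¹ * C₁) + 1 with hL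
  have hL1 : ((1 / 2 : ℝ) ^ N)⁻¹ * C₁ ≤ L := by
    have : 0 ≤ ((1 / 2 : ℝ) ^ N)⁻¹ * C₁ := by positivity
    linarith
  have hL2 : 2 * (((1 / 2 : ℝ) ^ N)⁻¹ * C₁) ≤ L := by linarith
  have hL3 : 1 ≤ L := by
    have : 0 ≤ ((1 / 2 : ℝ) ^ N)⁻¹ * C₁ := by positivity
    linarith
  refine ⟨B * L, by positivity, fun u v h x hx hxρ => ?_⟩
  have hrx := hrep u h.contDiffAt_fst x (1 / 2) (by norm_num) (by linarith)
  set D := {y : Euc N | 1 / 2 ≤ ‖y‖ ∧ ‖y‖ ≤ ρ} with hD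
  have hball : ball x (1 / 2) ⊆ D := by
    intro y hy
    rw [mem_ball, dist_eq_norm] at hy
    have h1 := norm_sub_norm_le y x
    have h2 := norm_sub_norm_le x y
    rw [norm_sub_rev] at h2
    exact ⟨by linarith, by linarith⟩
  have hmean : ∫⁻ z in ball (0 : Euc N) 1, ‖u (x + (1 / 2 : ℝ) • z)‖ₑ ≤
      ENNReal.ofReal (((1 / 2 : ℝ) ^ N)⁻¹ * C₁) := by
    rw [lintegral_ball_comp (fun y => ‖u y‖ₑ) x (by norm_num), ENNReal.ofReal_mul (by positivity)]
    refine mul_le_mul_right ?_ _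
    have hsub : ball x (1 / 2) ⊆ closedBall (0 : Euc N) ρ := fun y hy => by
      simpa using (hball hy).2
    refine (lintegral_mono_set hsub).trans (le_trans (le_of_eq ?_) (hbe u v h).1)
    exact lintegral_congr fun y => Real.enorm_of_nonneg (h.nonneg_fst y)
  have hmeas : Measurable (lap u) := by
    refine measurable_of_continuousOn_compl_singleton 0 fun y hy => ?_
    exact (contDiffAt_lap (h.contDiffAt_fst y hy)).continuousAt.continuousWithinAt
  have hriesz : ∀ j : ℝ, j + 2 ≤ N →
      ∫⁻ s in Ioc 0 (1 / 2 : ℝ), ENNReal.ofReal (s ^ j) *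
        ∫⁻ z in ball (0 : Euc N) 1, ‖lap u (x + s • z)‖ₑ ≤
      ∫⁻ y in D, ENNReal.ofReal (‖y‖ ^ a * v y ^ p) *
        ENNReal.ofReal (‖y - x‖ ^ (j + 1 - N : ℝ)) := by
    intro j hj
    refine (lintegral_Ioc_ball_le (H := fun y => ‖lap u y‖ₑ) hmeas.enorm x (1 / 2) hj).trans ?_
    refine le_trans (le_of_eq ?_) (lintegral_mono_set hball)
    refine setLIntegral_congr_fun isOpen_ball.measurableSet fun y hy => ?_
    have hy0 : y ≠ 0 := norm_pos_iff.1 (by have := (hball hy).1; linarith)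
    have := h.nonneg_snd y
    rw [h.lap_fst y hy0, enorm_neg, Real.enorm_of_nonneg (by positivity)]
  have h1L : (1 : ENNReal) ≤ ENNReal.ofReal L := by
    rw [← ENNReal.ofReal_one]; exact ENNReal.ofReal_le_ofReal hL3
  have fin : ∀ I J : ENNReal, I ≤ ENNReal.ofReal L →
      ENNReal.ofReal B * (I + J) ≤ ENNReal.ofReal (B * L) * (1 + J) := by
    intro I J hI
    rw [ENNReal.ofReal_mul hB.le, mul_assoc]
    gcongr
    rw [mul_add, mul_one]
    gcongr
    calc J = 1 * J := (one_mul J).symm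
      _ ≤ _ := by gcongr
  constructor
  · rw [← Real.enorm_of_nonneg (h.nonneg_fst x)]
    refine (hrx.1).trans ((mul_le_mul_right (add_le_add le_rfl ?_) _).trans (fin _ _
      (hmean.trans (ENNReal.ofReal_le_ofReal hL1))))
    refine le_trans (le_of_eq ?_) ((hriesz 1 (by
      have : (3 : ℝ) ≤ N := by exact_mod_cast hN
      linarith)).trans (le_of_eq ?_))
    · simp only [Real.rpow_one]
    · norm_num
  · intro i
    refine (hrx.2 i).trans ((mul_le_mul_right (add_le_add le_rfl ?_) _).trans (fin _ _ ?_))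
    · refine le_trans (le_of_eq ?_) ((hriesz 0 (by
        have : (3 : ℝ) ≤ N := by exact_mod_cast hN
        linarith)).trans (le_of_eq ?_))
      · simp only [Real.rpow_zero, ENNReal.ofReal_one, one_mul]
      · norm_num
    · refine (mul_le_mul_right hmean _).trans ?_
      rw [← ENNReal.ofReal_mul (by positivity)]
      refine ENNReal.ofReal_le_ofReal (le_trans (le_of_eq ?_) hL2)
      norm_num

end PointwiseBounds

section Comparison

variable {N : ℕ}

lemma pd_pd_comp {g g' : ℝ → ℝ} {g'' : ℝ} {f : Euc N → ℝ} {x : Euc N} (hf : ContDiffAt ℝ 2 f x)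
    (hg : ∀ᶠ t in nhds (f x), HasDerivAt g (g' t) t) (hg' : HasDerivAt g' g'' (f x)) (i : Fin N) :
    pd i (pd i fun y => g (f y)) x = g'' * pd i f x ^ 2 + g' (f x) * pd i (pd i f) x := by
  have h1 : pd i (fun y => g (f y)) =ᶠ[nhds x] fun y => g' (f y) * pd i f y := by
    filter_upwards [hf.continuousAt.eventually hg,
      (hf.eventually (by simp)).mono fun y hy => hy.differentiableAt (n := 2) (by norm_num)]
      with y hy hy'
    exact pd_comp hy' hy i
  have hd := hf.differentiableAt (by norm_num)
  have hd' : DifferentiableAt ℝ (pd i f) x :=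
    (contDiffAt_pd (m := 1) (n := 2) le_rfl hf i).differentiableAt (by norm_num)
  rw [pd_congr h1, pd_mul (f := fun y => g' (f y)) (g := pd i f)
    (hg'.differentiableAt.comp x hd) hd', pd_comp hd hg']
  ring

/-- A convex `C²` approximation of the positive part. -/
def smoothPos (t : ℝ) : ℝ := ∫ s in (0 : ℝ)..t, expNegInvGlue s

lemma continuous_expNegInvGlue : Continuous expNegInvGlue :=
  (expNegInvGlue.contDiff (n := 0)).continuous

lemma hasDerivAt_smoothPos (t : ℝ) : HasDerivAt smoothPos (expNegInvGlue t) t :=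
  intervalIntegral.integral_hasDerivAt_right (continuous_expNegInvGlue.intervalIntegrable _ _)
    (continuous_expNegInvGlue.stronglyMeasurableAtFilter _ _) continuous_expNegInvGlue.continuousAt

lemma contDiff_smoothPos : ContDiff ℝ 2 smoothPos := by
  have e : deriv smoothPos = expNegInvGlue := funext fun t => (hasDerivAt_smoothPos t).deriv
  have h := (contDiff_succ_iff_deriv (𝕜 := ℝ) (n := 1) (f := smoothPos)).2
    ⟨fun t => (hasDerivAt_smoothPos t).differentiableAt, by simp, by
      rw [e]; exact expNegInvGlue.contDiff (n := 1)⟩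
  exact h.of_le (by norm_num)

lemma smoothPos_eq_zero {t : ℝ} (ht : t ≤ 0) : smoothPos t = 0 := by
  rw [smoothPos, intervalIntegral.integral_symm, neg_eq_zero]
  refine (intervalIntegral.integral_congr (g := fun _ => (0 : ℝ)) fun s hs => ?_).trans (by simp)
  rw [uIcc_of_le ht] at hs
  exact expNegInvGlue.zero_of_nonpos hs.2

lemma expNegInvGlue_le_one (t : ℝ) : expNegInvGlue t ≤ 1 := by
  unfold expNegInvGlue
  split_ifs with h
  · exact zero_le_one
  · push Not at h
    exact Real.exp_le_one_iff.2 (by simpa using h.le)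

lemma smoothPos_le {t : ℝ} (ht : 0 ≤ t) : smoothPos t ≤ t := by
  calc smoothPos t ≤ ∫ _s in (0 : ℝ)..t, (1 : ℝ) :=
        intervalIntegral.integral_mono_on ht (continuous_expNegInvGlue.intervalIntegrable _ _)
          (by simp) fun s _ => expNegInvGlue_le_one s
    _ = t := by simp

lemma smoothPos_nonneg (t : ℝ) : 0 ≤ smoothPos t := by
  rcases le_total t 0 with h | h
  · rw [smoothPos_eq_zero h]
  · exact intervalIntegral.integral_nonneg h fun s _ => expNegInvGlue.nonneg s

lemma smoothPos_pos {t : ℝ} (ht : 0 < t) : 0 < smoothPos t :=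
  intervalIntegral.intervalIntegral_pos_of_pos_on
    (continuous_expNegInvGlue.intervalIntegrable _ _)
    (fun _ hs => expNegInvGlue.pos_of_pos hs.1) ht

/-- Weighted means of a component of a solution at scale `S` decay as `S → ∞`. -/
lemma IsNonnegSol.exists_mean_le (hN : 3 ≤ N) {p q a b : ℝ} (hp : 0 < p) (hq : 0 < q)
    (hpq : 1 < p * q) (ha : -2 < a) (hb : -2 < b) {u v : Euc N → ℝ}
    (h : IsNonnegSol p q a b u v) (x : Euc N) {ε : ℝ} (hε : 0 < ε) :
    ∃ S : ℝ, 0 < S ∧ ∫ z, v (x + S • z) * bumpWeight z ≤ ε := by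
  obtain ⟨C, hC, hbe⟩ := exists_basic_estimate hN hp hq hpq ha hb (ρ := 2) (by norm_num)
  obtain ⟨M, hM, hθ⟩ := exists_upper_bound (N := N) (f := bumpWeight)
    (contDiff_bumpWeight (n := 0)).continuous
    (hasCompactSupport_of_norm (R := 1) fun z hz => bumpWeight_eq_zero hz)
  have hd : 0 < p * q - 1 := by linarith
  set t := (q * (2 + a) + 2 + b) / (p * q - 1) with ht
  set s := p * t - 2 - a with hs
  have htp : 0 < t := div_pos (by nlinarith) hd
  have h2 : t + 2 + b = q * s := by
    have : t * (p * q - 1) = q * (2 + a) + 2 + b := div_mul_cancel₀ _ hd.ne'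
    rw [hs]; linarith
  obtain ⟨S, hS⟩ : ∃ S : ℝ, max 1 ‖x‖ ≤ S ∧ M * C / ε ≤ S ^ t :=
    ((Filter.eventually_ge_atTop _).and ((tendsto_rpow_atTop htp).eventually_ge_atTop _)).exists
  have hS0 : 0 < S := by linarith [le_max_left 1 ‖x‖]
  refine ⟨S, hS0, ?_⟩
  have hsol := h.comp_smul hS0 (s := s) (t := t) (by rw [hs]; ring) h2
  have hI := (hbe _ _ hsol).2.1
  have hcv := h.continuous_snd
  have hcθ := (contDiff_bumpWeight (N := N) (n := 0)).continuous
  have hpt : ∀ z, v (x + S • z) * bumpWeight z ≤ S ^ (-t) * M *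
      (closedBall (0 : Euc N) 2).indicator (fun y => S ^ t * v (S • y)) (S⁻¹ • x + z) := by
    intro z
    have hv := h.nonneg_snd (x + S • z)
    have e : S • (S⁻¹ • x + z) = x + S • z := by
      rw [smul_add, smul_smul, mul_inv_cancel₀ hS0.ne', one_smul]
    by_cases hz : ‖z‖ < 1
    · have hmem : S⁻¹ • x + z ∈ closedBall (0 : Euc N) 2 := by
        rw [mem_closedBall, dist_zero_right]
        refine (norm_add_le _ _).trans ?_
        rw [norm_smul, norm_inv, Real.norm_of_nonneg hS0.le, inv_mul_eq_div]
        have : ‖x‖ / S ≤ 1 := (div_le_one hS0).2 ((le_max_right _ _).trans hS.1)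
        linarith
      rw [indicator_of_mem hmem, e, Real.rpow_neg hS0.le]
      have h3 : bumpWeight z ≤ M := (le_abs_self _).trans (hθ z)
      calc v (x + S • z) * bumpWeight z ≤ v (x + S • z) * M := by gcongr
        _ = _ := by field_simp
    · rw [bumpWeight_eq_zero (not_lt.1 hz), mul_zero]
      refine mul_nonneg (by positivity) (indicator_nonneg (fun y _ => ?_) _)
      exact hsol.nonneg_snd y
  have hinteg : Integrable ((closedBall (0 : Euc N) 2).indicator fun y => S ^ t * v (S • y)) := by
    rw [integrable_indicator_iff isClosed_closedBall.measurableSet]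
    exact hsol.continuous_snd.continuousOn.integrableOn_compact (isCompact_closedBall _ _)
  calc ∫ z, v (x + S • z) * bumpWeight z
      ≤ ∫ z, S ^ (-t) * M *
        (closedBall (0 : Euc N) 2).indicator (fun y => S ^ t * v (S • y)) (S⁻¹ • x + z) := by
        refine integral_mono ?_ ((hinteg.comp_add_left _).const_mul _) hpt
        refine Continuous.integrable_of_hasCompactSupport (by fun_prop) ?_
        refine hasCompactSupport_of_norm (R := 1) fun z hz => ?_
        rw [bumpWeight_eq_zero hz, mul_zero]
    _ = S ^ (-t) * M * ∫ z in closedBall (0 : Euc N) 2, S ^ t * v (S • z) := by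
        rw [integral_const_mul, integral_add_left_eq_self
          (f := (closedBall (0 : Euc N) 2).indicator fun y => S ^ t * v (S • y)),
          integral_indicator isClosed_closedBall.measurableSet]
    _ ≤ S ^ (-t) * M * C := by
        gcongr
        rw [← ENNReal.ofReal_le_ofReal_iff hC.le, ofReal_integral_eq_lintegral_ofReal]
        · exact hI
        · exact (integrable_indicator_iff isClosed_closedBall.measurableSet).1 hinteg
        · exact Filter.Eventually.of_forall hsol.nonneg_snd
    _ ≤ ε := by
        have h4 := hS.2
        rw [div_le_iff₀ hε] at h4
        rw [Real.rpow_neg hS0.le, mul_assoc, inv_mul_le_iff₀ (by positivity)]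
        exact h4

/-- A subharmonic function below a component of a solution is nonpositive. -/
lemma IsNonnegSol.nonpos_of_subharmonic (hN : 3 ≤ N) {p q a b : ℝ} (hp : 0 < p) (hq : 0 < q)
    (hpq : 1 < p * q) (ha : -2 < a) (hb : -2 < b) {u v : Euc N → ℝ}
    (h : IsNonnegSol p q a b u v) {W : Euc N → ℝ} (hW : Tame fun x => -W x)
    (hlap : ∀ x, x ≠ 0 → lap (fun x => -W x) x ≤ 0)
    (hW0 : ∀ x, x ≠ 0 → 0 ≤ W x) (hWv : ∀ x, x ≠ 0 → W x ≤ v x)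
    (x : Euc N) (hx : x ≠ 0) : W x ≤ 0 := by
  have : NeZero N := ⟨by omega⟩
  by_contra! hpos
  have hm := bumpMass_pos (N := N)
  obtain ⟨S, hS, hmean⟩ := h.exists_mean_le hN hp hq hpq ha hb x
    (ε := bumpMass N * W x / 2) (by positivity)
  obtain ⟨C, -, hsup⟩ := exists_superharmonic_bound hN hS
  have h1 := (hsup _ hW hlap x hx).1
  simp only [neg_mul, integral_neg, mul_neg, neg_le_neg_iff] at h1
  have hcv := h.continuous_snd
  have hcθ := (contDiff_bumpWeight (N := N) (n := 0)).continuous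
  have hae : ∀ᵐ z : Euc N, x + S • z ≠ 0 := by
    filter_upwards [ae_ne_point (-(S⁻¹ • x))] with z hz hc
    refine hz ?_
    rw [add_comm, add_eq_zero_iff_eq_neg] at hc
    rw [← smul_neg, ← hc, smul_smul, inv_mul_cancel₀ hS.ne', one_smul]
  have h2 : ∫ z, W (x + S • z) * bumpWeight z ≤ ∫ z, v (x + S • z) * bumpWeight z := by
    refine integral_mono_of_nonneg ?_ ?_ ?_
    · filter_upwards [hae] with z hz
      exact mul_nonneg (hW0 _ hz) (bumpWeight_nonneg z)
    · refine Continuous.integrable_of_hasCompactSupport (by fun_prop) ?_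
      refine hasCompactSupport_of_norm (R := 1) fun z hz => ?_
      rw [bumpWeight_eq_zero hz, mul_zero]
    · filter_upwards [hae] with z hz
      exact mul_le_mul_of_nonneg_right (hWv _ hz) (bumpWeight_nonneg z)
  have : 0 < bumpMass N * W x := by positivity
  linarith

/-- Derivatives of `|x|^{-τ} u^σ`. -/
lemma pd_lap_rpow_mul {u : Euc N → ℝ} {x : Euc N} (hx : x ≠ 0) (hu : ContDiffAt ℝ 2 u x)
    (hpos : 0 < u x) (σ τ : ℝ) :
    ContDiffAt ℝ 2 (fun y => ‖y‖ ^ (-τ) * u y ^ σ) x ∧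
    (∀ i, pd i (fun y => ‖y‖ ^ (-τ) * u y ^ σ) x =
      ‖x‖ ^ (-τ) * u x ^ σ * (σ * (pd i u x / u x) - τ * (x i / ‖x‖ ^ 2))) ∧
    lap (fun y => ‖y‖ ^ (-τ) * u y ^ σ) x = ‖x‖ ^ (-τ) * u x ^ σ *
      (∑ i, (σ * (pd i u x / u x) - τ * (x i / ‖x‖ ^ 2)) ^ 2 +
        σ * (lap u x / u x - ∑ i, (pd i u x / u x) ^ 2) - τ * ((N - 2) / ‖x‖ ^ 2)) := by
  have hx0 : 0 < ‖x‖ := norm_pos_iff.2 hx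
  have hr : ContDiffAt ℝ 2 (fun y : Euc N => ‖y‖ ^ 2) x := contDiffAt_id.norm_sq ℝ
  have hr0 : ‖x‖ ^ 2 ≠ 0 := by positivity
  have hlu : ContDiffAt ℝ 2 (fun y => Real.log (u y)) x := hu.log hpos.ne'
  have hlr : ContDiffAt ℝ 2 (fun y : Euc N => Real.log (‖y‖ ^ 2)) x := hr.log hr0
  set L : Euc N → ℝ := fun y => σ * Real.log (u y) - τ / 2 * Real.log (‖y‖ ^ 2) with hL
  have hLc : ContDiffAt ℝ 2 L x := (contDiffAt_const.mul hlu).sub (contDiffAt_const.mul hlr)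
  have hev : (fun y => ‖y‖ ^ (-τ) * u y ^ σ) =ᶠ[nhds x] fun y => Real.exp (L y) := by
    filter_upwards [isOpen_ne.mem_nhds hx, hu.continuousAt.eventually (lt_mem_nhds hpos)]
      with y hy hyu
    have hy0 : 0 < ‖y‖ := norm_pos_iff.2 hy
    rw [Real.rpow_def_of_pos hy0, Real.rpow_def_of_pos hyu, ← Real.exp_add, hL]
    congr 1
    simp only
    rw [Real.log_pow]; push_cast; ring
  have hval := hev.eq_of_nhds
  have dlog : ∀ {t : ℝ}, 0 < t → (∀ᶠ t in nhds t, HasDerivAt Real.log ((fun t => t⁻¹) t) t) ∧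
      HasDerivAt (fun t : ℝ => t⁻¹) (-(t ^ 2)⁻¹) t := fun {t} ht =>
    ⟨by filter_upwards [lt_mem_nhds ht] with s hs using Real.hasDerivAt_log hs.ne',
      hasDerivAt_inv ht.ne'⟩
  have hdu := hlu.differentiableAt (by norm_num)
  have hdr := hlr.differentiableAt (by norm_num)
  have h1u : ∀ i, pd i (fun y => Real.log (u y)) x = pd i u x / u x := fun i => by
    rw [pd_comp (hu.differentiableAt (by norm_num)) (Real.hasDerivAt_log hpos.ne')]
    field_simp
  have h1r : ∀ i, pd i (fun y : Euc N => Real.log (‖y‖ ^ 2)) x = 2 * (x i / ‖x‖ ^ 2) := fun i => by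
    rw [pd_comp (hr.differentiableAt (by norm_num)) (Real.hasDerivAt_log hr0), pd_norm_sq]
    field_simp
  have h1 : ∀ i, pd i L x = σ * (pd i u x / u x) - τ * (x i / ‖x‖ ^ 2) := fun i => by
    rw [hL, pd_sub (f := fun y => σ * Real.log (u y)) (g := fun y => τ / 2 * Real.log (‖y‖ ^ 2))
      (hdu.const_mul _) (hdr.const_mul _), pd_const_mul hdu, pd_const_mul hdr, h1u, h1r]
    ring
  have h2u : ∀ i, pd i (pd i fun y => Real.log (u y)) x =
      pd i (pd i u) x / u x - (pd i u x / u x) ^ 2 := fun i => by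
    rw [pd_pd_comp hu (dlog hpos).1 (dlog hpos).2]
    field_simp
    ring
  have h2r : ∀ i, pd i (pd i fun y : Euc N => Real.log (‖y‖ ^ 2)) x =
      2 * (1 / ‖x‖ ^ 2 - 2 * (x i ^ 2 / ‖x‖ ^ 4)) := fun i => by
    have hrp : 0 < ‖x‖ ^ 2 := by positivity
    have e : pd i (pd i fun y : Euc N => ‖y‖ ^ 2) x = 2 := by
      have : pd i (fun y : Euc N => ‖y‖ ^ 2) = fun y => 2 * y i := funext fun y => pd_norm_sq i y
      rw [this, pd_const_mul (by fun_prop), pd_coord]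
      simp
    rw [pd_pd_comp hr (dlog hrp).1 (dlog hrp).2, e, pd_norm_sq]
    field_simp
    ring
  have h2 : ∀ i, pd i (pd i L) x = σ * (pd i (pd i u) x / u x - (pd i u x / u x) ^ 2) -
      τ * (1 / ‖x‖ ^ 2 - 2 * (x i ^ 2 / ‖x‖ ^ 4)) := fun i => by
    have d1 : ∀ {f : Euc N → ℝ}, ContDiffAt ℝ 2 f x → DifferentiableAt ℝ (pd i f) x := fun hf =>
      (contDiffAt_pd (m := 1) (n := 2) le_rfl hf i).differentiableAt (by norm_num)
    have e : pd i L =ᶠ[nhds x] fun y => σ * pd i (fun y => Real.log (u y)) y -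
        τ / 2 * pd i (fun y => Real.log (‖y‖ ^ 2)) y := by
      filter_upwards [hlu.eventually (by simp), hlr.eventually (by simp)] with y hy hy'
      have hy := hy.differentiableAt (n := 2) (by norm_num)
      have hy' := hy'.differentiableAt (n := 2) (by norm_num)
      rw [hL, pd_sub (f := fun y => σ * Real.log (u y)) (g := fun y => τ / 2 * Real.log (‖y‖ ^ 2))
        (hy.const_mul _) (hy'.const_mul _), pd_const_mul hy, pd_const_mul hy']
    rw [pd_congr e, pd_sub (f := fun y => σ * pd i (fun y => Real.log (u y)) y)
      (g := fun y => τ / 2 * pd i (fun y => Real.log (‖y‖ ^ 2)) y) ((d1 hlu).const_mul _)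
      ((d1 hlr).const_mul _), pd_const_mul (d1 hlu), pd_const_mul (d1 hlr), h2u, h2r]
    ring
  have hLd := hLc.differentiableAt (by norm_num)
  refine ⟨hLc.exp.congr_of_eventuallyEq hev, fun i => ?_, ?_⟩
  · rw [pd_congr hev, pd_comp hLd (Real.hasDerivAt_exp _), h1, hval]
  · rw [lap_congr hev, lap_eq_sum_pd hLc.exp, hval]
    have h3 : ∀ i, pd i (pd i fun y => Real.exp (L y)) x = Real.exp (L x) *
        ((σ * (pd i u x / u x) - τ * (x i / ‖x‖ ^ 2)) ^ 2 +
        (σ * (pd i (pd i u) x / u x - (pd i u x / u x) ^ 2) -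
        τ * (1 / ‖x‖ ^ 2 - 2 * (x i ^ 2 / ‖x‖ ^ 4)))) := fun i => by
      rw [pd_pd_comp hLc (Filter.Eventually.of_forall Real.hasDerivAt_exp)
        (Real.hasDerivAt_exp _), h1, h2]
      ring
    simp only [h3]
    rw [← Finset.mul_sum, Finset.sum_add_distrib, Finset.sum_sub_distrib, ← Finset.mul_sum,
      ← Finset.mul_sum, Finset.sum_sub_distrib, Finset.sum_sub_distrib, ← Finset.mul_sum,
      ← Finset.sum_div, ← Finset.sum_div, ← lap_eq_sum_pd hu]
    have e4 : ∑ i, x i ^ 2 = ‖x‖ ^ 2 := (EuclideanSpace.real_norm_sq_eq x).symm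
    have e5 : (N : ℝ) * 1 / ‖x‖ ^ 2 - 2 * (‖x‖ ^ 2 / ‖x‖ ^ 4) = (N - 2) / ‖x‖ ^ 2 := by
      field_simp
    rw [← Finset.sum_div, e4, Finset.sum_const, Finset.card_univ, Fintype.card_fin, nsmul_eq_mul,
      e5]
    ring

lemma lap_rpow_mul_le (hN : 3 ≤ N) {u : Euc N → ℝ} {x : Euc N} (hx : x ≠ 0)
    (hu : ContDiffAt ℝ 2 u x) (hpos : 0 < u x) {σ τ : ℝ} (hσ : 0 ≤ σ) (hτ : 0 ≤ τ)
    (hστ : τ ≤ (N - 2) * (1 - σ)) :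
    lap (fun y => ‖y‖ ^ (-τ) * u y ^ σ) x ≤ ‖x‖ ^ (-τ) * u x ^ σ * (σ * (lap u x / u x)) := by
  rw [(pd_lap_rpow_mul hx hu hpos σ τ).2.2]
  refine mul_le_mul_of_nonneg_left ?_ (by positivity)
  have hN' : (1 : ℝ) ≤ N - 2 := by
    have : (3 : ℝ) ≤ N := by exact_mod_cast hN
    linarith
  set n : ℝ := N - 2 with hn
  set t := τ / n with ht
  have hτt : τ = t * n := by rw [ht]; field_simp
  have ht0 : 0 ≤ t := by positivity
  have ht1 : t ≤ 1 - σ := by rw [ht, div_le_iff₀ (by linarith)]; linarith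
  have e4 : ∑ i, x i ^ 2 = ‖x‖ ^ 2 := (EuclideanSpace.real_norm_sq_eq x).symm
  have hx0 : 0 < ‖x‖ := norm_pos_iff.2 hx
  have e5 : ∑ i, (n * (x i / ‖x‖ ^ 2)) ^ 2 = n ^ 2 / ‖x‖ ^ 2 := by
    have : ∀ i, (n * (x i / ‖x‖ ^ 2)) ^ 2 = n ^ 2 / ‖x‖ ^ 4 * x i ^ 2 := fun i => by ring
    simp only [this]
    rw [← Finset.mul_sum, e4]
    field_simp
  have key : ∑ i, (σ * (pd i u x / u x) - τ * (x i / ‖x‖ ^ 2)) ^ 2 ≤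
      ∑ i, (σ * (pd i u x / u x) ^ 2 + t * (n * (x i / ‖x‖ ^ 2)) ^ 2) := by
    refine Finset.sum_le_sum fun i _ => ?_
    set A := pd i u x / u x
    set D := n * (x i / ‖x‖ ^ 2) with hD
    have : τ * (x i / ‖x‖ ^ 2) = t * D := by rw [hD, hτt]; ring
    rw [this]
    have h1 : 0 ≤ σ * t * (A + D) ^ 2 := by positivity
    have h2 : 0 ≤ σ * (1 - σ - t) * A ^ 2 :=
      mul_nonneg (mul_nonneg hσ (by linarith)) (sq_nonneg _)
    have h3 : 0 ≤ t * (1 - t - σ) * D ^ 2 :=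
      mul_nonneg (mul_nonneg ht0 (by linarith)) (sq_nonneg _)
    nlinarith
  rw [Finset.sum_add_distrib, ← Finset.mul_sum, ← Finset.mul_sum, e5] at key
  have e6 : t * (n ^ 2 / ‖x‖ ^ 2) = τ * (n / ‖x‖ ^ 2) := by rw [hτt]; ring
  rw [e6] at key
  linarith

lemma lap_sub_const_mul {f g : Euc N → ℝ} {x : Euc N} (hf : ContDiffAt ℝ 2 f x)
    (hg : ContDiffAt ℝ 2 g x) (c : ℝ) :
    lap (fun y => f y - c * g y) x = lap f x - c * lap g x := by
  have hd : ∀ {f : Euc N → ℝ} {y : Euc N}, ContDiffAt ℝ 2 f y → DifferentiableAt ℝ f y :=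
    fun hf => hf.differentiableAt (by norm_num)
  have hd' : ∀ {f : Euc N → ℝ} (i : Fin N), ContDiffAt ℝ 2 f x → DifferentiableAt ℝ (pd i f) x :=
    fun i hf => (contDiffAt_pd (m := 1) (n := 2) le_rfl hf i).differentiableAt (by norm_num)
  rw [lap_eq_sum_pd hf, lap_eq_sum_pd hg, lap_eq_sum_pd (hf.sub (contDiffAt_const.mul hg)),
    Finset.mul_sum, ← Finset.sum_sub_distrib]
  refine Finset.sum_congr rfl fun i _ => ?_
  have e : pd i (fun y => f y - c * g y) =ᶠ[nhds x] fun y => pd i f y - c * pd i g y := by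
    filter_upwards [hf.eventually (by simp), hg.eventually (by simp)] with y hy hy'
    rw [pd_sub (g := fun y => c * g y) (hd hy) ((hd hy').const_mul _), pd_const_mul (hd hy')]
  rw [pd_congr e, pd_sub (g := fun y => c * pd i g y) (hd' i hf) ((hd' i hg).const_mul _),
    pd_const_mul (hd' i hg)]

/-- Pointwise comparison of the two components of a solution. -/
lemma IsNonnegSol.comparison (hN : 3 ≤ N) {p q a b : ℝ} (hq : 0 < q) (hqp : q ≤ p)
    (hpq : 1 < p * q) (ha : -2 < a) (hb : -2 < b) (h0 : 0 ≤ a - b)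
    (h1 : a - b ≤ ((N : ℝ) - 2) * (p - q)) {u v : Euc N → ℝ} (h : IsNonnegSol p q a b u v)
    (hne : ∃ x, u x ≠ 0) (x : Euc N) (hx : x ≠ 0) :
    ‖x‖ ^ a * v x ^ (p + 1) / (p + 1) ≤ ‖x‖ ^ b * u x ^ (q + 1) / (q + 1) := by
  have hp : 0 < p := hq.trans_le hqp
  set σ := (q + 1) / (p + 1) with hσ
  set τ := (a - b) / (p + 1) with hτ
  set ℓ := σ ^ (-(p + 1)⁻¹) with hℓ
  have hσ0 : 0 < σ := by positivity
  have hτ0 : 0 ≤ τ := by positivity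
  have hℓ0 : 0 < ℓ := by positivity
  have hστ : τ ≤ (N - 2) * (1 - σ) := by
    have e : 1 - σ = (p - q) / (p + 1) := by rw [hσ]; field_simp; ring
    rw [e, hτ, mul_div_assoc']
    gcongr
  have hupos : ∀ x, x ≠ 0 → 0 < u x := fun x hx => by
    obtain ⟨c, hc, hcu⟩ := h.exists_lower_bound hN hp ha hne ‖x‖
    exact hc.trans_le (hcu x hx le_rfl)
  set φ : Euc N → ℝ := fun y => ‖y‖ ^ (-τ) * u y ^ σ with hφ
  set w : Euc N → ℝ := fun y => v y - ℓ * φ y with hw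
  have hφc : ∀ x, x ≠ 0 → ContDiffAt ℝ 2 φ x := fun x hx =>
    (pd_lap_rpow_mul hx (h.contDiffAt_fst x hx) (hupos x hx) σ τ).1
  have hwc : ∀ x, x ≠ 0 → ContDiffAt ℝ 2 w x := fun x hx =>
    (h.contDiffAt_snd x hx).sub (contDiffAt_const.mul (hφc x hx))
  have hφ0 : ∀ x, 0 ≤ φ x := fun x => by
    have := h.nonneg_fst x
    positivity
  have hψ : ∀ x, x ≠ 0 → (ℓ * φ x) ^ (p + 1) = σ⁻¹ * ‖x‖ ^ (b - a) * u x ^ (q + 1) := by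
    intro x hx
    have hx0 : 0 < ‖x‖ := norm_pos_iff.2 hx
    have hu0 := h.nonneg_fst x
    rw [Real.mul_rpow hℓ0.le (hφ0 x), hφ, Real.mul_rpow (by positivity) (by positivity), hℓ,
      ← Real.rpow_mul hσ0.le, ← Real.rpow_mul hx0.le, ← Real.rpow_mul hu0]
    have e1 : -(p + 1)⁻¹ * (p + 1) = -1 := by field_simp
    have e2 : -τ * (p + 1) = b - a := by rw [hτ]; field_simp; ring
    have e3 : σ * (p + 1) = q + 1 := by rw [hσ]; field_simp
    rw [e1, e2, e3, Real.rpow_neg_one, mul_assoc]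
  have hwlap : ∀ x, x ≠ 0 → 0 < w x → 0 ≤ lap w x := by
    intro x hx hwx
    have hx0 : 0 < ‖x‖ := norm_pos_iff.2 hx
    have hu0 := hupos x hx
    rw [hw, lap_sub_const_mul (h.contDiffAt_snd x hx) (hφc x hx), h.lap_snd x hx]
    have h2 := lap_rpow_mul_le hN hx (h.contDiffAt_fst x hx) hu0 hσ0.le hτ0 hστ
    rw [h.lap_fst x hx] at h2
    have h3 : (ℓ * φ x) ^ p ≤ v x ^ p := by
      have : ℓ * φ x ≤ v x := by simp only [hw] at hwx; linarith
      have := hφ0 x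
      gcongr
    have h4 : ℓ * φ x * (ℓ * φ x) ^ p = (ℓ * φ x) ^ (p + 1) := by
      have h5 : 0 < ℓ * φ x := by
        have : 0 < φ x := mul_pos (by positivity) (by positivity)
        positivity
      rw [Real.rpow_add h5, Real.rpow_one, mul_comm]
    rw [hψ x hx] at h4
    have h6 : ‖x‖ ^ b * u x ^ q ≤ ℓ * (φ x * (σ * (‖x‖ ^ a * v x ^ p / u x))) := by
      calc ‖x‖ ^ b * u x ^ q
          = σ * ‖x‖ ^ a / u x * (σ⁻¹ * ‖x‖ ^ (b - a) * u x ^ (q + 1)) := by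
            rw [Real.rpow_sub hx0, Real.rpow_add hu0, Real.rpow_one]
            field_simp
        _ = σ * ‖x‖ ^ a / u x * (ℓ * φ x * (ℓ * φ x) ^ p) := by rw [h4]
        _ ≤ σ * ‖x‖ ^ a / u x * (ℓ * φ x * v x ^ p) := by
            have := hφ0 x
            gcongr
        _ = _ := by ring
    have h7 : ℓ * lap φ x ≤ ℓ * (φ x * (σ * (-(‖x‖ ^ a * v x ^ p) / u x))) :=
      mul_le_mul_of_nonneg_left h2 hℓ0.le
    have h8 : ℓ * (φ x * (σ * (-(‖x‖ ^ a * v x ^ p) / u x))) =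
      -(ℓ * (φ x * (σ * (‖x‖ ^ a * v x ^ p / u x)))) := by ring
    change 0 ≤ _ - ℓ * lap φ x
    linarith
  have hgd : ∀ t, HasDerivAt (fun t => -smoothPos t) (-expNegInvGlue t) t := fun t =>
    (hasDerivAt_smoothPos t).neg
  have hgd' : ∀ t, HasDerivAt (fun t => -expNegInvGlue t) (-((t⁻¹) ^ 2 * expNegInvGlue t)) t :=
    fun t => (expNegInvGlue_hasDerivAt t).neg
  have hWc : ∀ x, x ≠ 0 → ContDiffAt ℝ 2 (fun x => -smoothPos (w x)) x := fun x hx =>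
    (contDiff_smoothPos.contDiffAt.comp x (hwc x hx)).neg
  have hWv : ∀ x, smoothPos (w x) ≤ v x := fun x => by
    rcases le_total (w x) 0 with h2 | h2
    · rw [smoothPos_eq_zero h2]; exact h.nonneg_snd x
    · refine (smoothPos_le h2).trans ?_
      have := hφ0 x
      simp only [hw]
      have : 0 ≤ ℓ * φ x := by positivity
      linarith
  have htame : Tame fun x => -smoothPos (w x) := by
    have htv := h.symm.tame hq hb
    obtain ⟨M₁, hM₁⟩ := htv.grad
    obtain ⟨M₂, hM₂⟩ := (h.tame hp ha).grad
    obtain ⟨M₀, hM₀⟩ := htv.bdd 1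
    obtain ⟨c, hc, hcu⟩ := h.exists_lower_bound hN hp ha hne 1
    refine ⟨hWc, fun R => ?_, ⟨M₁ + M₀ * (σ * (M₂ / c) + τ), fun x i hx hx1 => ?_⟩⟩
    · obtain ⟨M, hM⟩ := htv.bdd R
      refine ⟨M, fun x hx hxR => ?_⟩
      rw [abs_neg, abs_of_nonneg (smoothPos_nonneg _)]
      exact (hWv x).trans ((le_abs_self _).trans (hM x hx hxR))
    · have hx0 : 0 < ‖x‖ := norm_pos_iff.2 hx
      have hu0 := hupos x hx
      have hv0 := h.nonneg_snd x
      have g1 := hM₁ x i hx hx1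
      have g2 := hM₂ x i hx hx1
      have g3 := hM₀ x hx hx1
      have g4 := hcu x hx hx1
      have hM₁0 : 0 ≤ M₁ := by
        have := (abs_nonneg _).trans g1
        rwa [le_div_iff₀ hx0, zero_mul] at this
      have hM₂0 : 0 ≤ M₂ := by
        have := (abs_nonneg _).trans g2
        rwa [le_div_iff₀ hx0, zero_mul] at this
      have hM₀0 : 0 ≤ M₀ := (abs_nonneg _).trans g3
      rw [pd_comp ((hwc x hx).differentiableAt (by norm_num)) (hgd _)]
      rcases le_or_gt (w x) 0 with h2 | h2
      · rw [expNegInvGlue.zero_of_nonpos h2, neg_zero, zero_mul, abs_zero]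
        positivity
      · have hφd := (hφc x hx).differentiableAt (by norm_num)
        have e : pd i w x = pd i v x - ℓ * (φ x * (σ * (pd i u x / u x) - τ * (x i / ‖x‖ ^ 2))) := by
          rw [hw, pd_sub (g := fun y => ℓ * φ y)
            ((h.contDiffAt_snd x hx).differentiableAt (by norm_num)) (hφd.const_mul _),
            pd_const_mul hφd,
            (pd_lap_rpow_mul hx (h.contDiffAt_fst x hx) hu0 σ τ).2.1]
        have h3 : ℓ * φ x ≤ M₀ := by
          simp only [hw] at h2
          have := (le_abs_self _).trans g3
          linarith
        have h4 : |pd i u x / u x| ≤ M₂ / c / ‖x‖ := by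
          rw [abs_div, abs_of_pos hu0, div_right_comm]
          gcongr
        have h5 : |x i / ‖x‖ ^ 2| ≤ 1 / ‖x‖ := by
          have h6 : |x i| ≤ ‖x‖ := PiLp.norm_apply_le x i
          rw [abs_div, abs_of_pos (by positivity : 0 < ‖x‖ ^ 2),
            div_le_div_iff₀ (by positivity) hx0]
          nlinarith
        have h7 : |pd i w x| ≤ M₁ / ‖x‖ + M₀ * (σ * (M₂ / c / ‖x‖) + τ * (1 / ‖x‖)) := by
          rw [e]
          refine (abs_sub _ _).trans (add_le_add g1 ?_)
          have := hφ0 x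
          rw [← mul_assoc, abs_mul, abs_of_nonneg (by positivity)]
          refine mul_le_mul h3 ((abs_sub _ _).trans ?_) (abs_nonneg _) hM₀0
          rw [abs_mul, abs_mul, abs_of_pos hσ0, abs_of_nonneg hτ0]
          gcongr
        rw [abs_mul, abs_neg, abs_of_nonneg (expNegInvGlue.nonneg _)]
        calc expNegInvGlue (w x) * |pd i w x| ≤ 1 * |pd i w x| := by
              gcongr; exact expNegInvGlue_le_one _
          _ ≤ M₁ / ‖x‖ + M₀ * (σ * (M₂ / c / ‖x‖) + τ * (1 / ‖x‖)) := by rw [one_mul]; exact h7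
          _ = _ := by ring
  have hlap : ∀ x, x ≠ 0 → lap (fun x => -smoothPos (w x)) x ≤ 0 := by
    intro x hx
    rw [lap_eq_sum_pd (hWc x hx)]
    have e : ∀ i, pd i (pd i fun x => -smoothPos (w x)) x =
        -((w x)⁻¹ ^ 2 * expNegInvGlue (w x)) * pd i w x ^ 2 +
          -expNegInvGlue (w x) * pd i (pd i w) x := fun i =>
      pd_pd_comp (hwc x hx) (Filter.Eventually.of_forall hgd) (hgd' _) i
    simp only [e]
    rw [Finset.sum_add_distrib, ← Finset.mul_sum, ← Finset.mul_sum, ← lap_eq_sum_pd (hwc x hx)]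
    have h3 := expNegInvGlue.nonneg (w x)
    have h4 : 0 ≤ ((w x)⁻¹ ^ 2 * expNegInvGlue (w x)) * ∑ i, pd i w x ^ 2 :=
      mul_nonneg (by positivity) (Finset.sum_nonneg fun i _ => sq_nonneg _)
    rcases le_or_gt (w x) 0 with h2 | h2
    · rw [expNegInvGlue.zero_of_nonpos h2]; simp
    · nlinarith [mul_nonneg h3 (hwlap x hx h2)]
  have h2 := h.nonpos_of_subharmonic hN hp hq hpq ha hb htame hlap
    (fun x _ => smoothPos_nonneg _) (fun x _ => hWv x) x hx
  have h3 : w x ≤ 0 := by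
    by_contra! h3
    exact absurd (smoothPos_pos h3) (not_lt.2 h2)
  have h4 : v x ≤ ℓ * φ x := by simp only [hw] at h3; linarith
  have hv0 := h.nonneg_snd x
  have h5 : v x ^ (p + 1) ≤ σ⁻¹ * ‖x‖ ^ (b - a) * u x ^ (q + 1) := by
    rw [← hψ x hx]; gcongr
  have hx0 : 0 < ‖x‖ := norm_pos_iff.2 hx
  calc ‖x‖ ^ a * v x ^ (p + 1) / (p + 1)
      ≤ ‖x‖ ^ a * (σ⁻¹ * ‖x‖ ^ (b - a) * u x ^ (q + 1)) / (p + 1) := by gcongr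
    _ = _ := by
        rw [Real.rpow_sub hx0, hσ]
        field_simp

end Comparison

section Pohozaev

variable {N : ℕ}

/-- The Euler vector field `x · ∇` applied to `w`. -/
def euler (w : Euc N → ℝ) (x : Euc N) : ℝ := ∑ j, x j * pd j w x

/-- The components of the Pohozaev vector field with potential `H`. -/
def pohozaevField (c₁ c₂ : ℝ) (H u v : Euc N → ℝ) (i : Fin N) (x : Euc N) : ℝ :=
  euler v x * pd i u x + euler u x * pd i v x - x i * (∑ j, pd j u x * pd j v x) + x i * H x +
    c₁ * (v x * pd i u x) + c₂ * (u x * pd i v x)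

lemma contDiffAt_coord {x : Euc N} (n : WithTop ℕ∞) (i : Fin N) :
    ContDiffAt ℝ n (fun y : Euc N => y i) x :=
  (EuclideanSpace.proj i : Euc N →L[ℝ] ℝ).contDiff.contDiffAt

lemma contDiffAt_euler {w : Euc N → ℝ} {x : Euc N} (hw : ContDiffAt ℝ 2 w x) :
    ContDiffAt ℝ 1 (euler w) x := by
  unfold euler
  exact ContDiffAt.sum fun j _ => (contDiffAt_coord 1 j).mul (contDiffAt_pd (m := 1) (n := 2) le_rfl hw j)

lemma contDiffAt_pohozaevField {c₁ c₂ : ℝ} {H u v : Euc N → ℝ} {x : Euc N}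
    (hu : ContDiffAt ℝ 2 u x) (hv : ContDiffAt ℝ 2 v x) (hH : ContDiffAt ℝ 1 H x) (i : Fin N) :
    ContDiffAt ℝ 1 (pohozaevField c₁ c₂ H u v i) x := by
  have du := fun j => contDiffAt_pd (m := 1) (n := 2) le_rfl hu j
  have dv := fun j => contDiffAt_pd (m := 1) (n := 2) le_rfl hv j
  have hu1 : ContDiffAt ℝ 1 u x := hu.of_le (by norm_num)
  have hv1 : ContDiffAt ℝ 1 v x := hv.of_le (by norm_num)
  unfold pohozaevField
  refine (((((contDiffAt_euler hv).mul (du i)).add ((contDiffAt_euler hu).mul (dv i))).sub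
    ((contDiffAt_coord 1 i).mul (ContDiffAt.sum fun j _ => (du j).mul (dv j)))).add
    ((contDiffAt_coord 1 i).mul hH)).add (contDiffAt_const.mul (hv1.mul (du i))) |>.add
    (contDiffAt_const.mul (hu1.mul (dv i)))

lemma pd_euler {w : Euc N → ℝ} {x : Euc N} (hw : ContDiffAt ℝ 2 w x) (i : Fin N) :
    pd i (euler w) x = pd i w x + ∑ j, x j * pd i (pd j w) x := by
  have dw := fun j => (contDiffAt_pd (m := 1) (n := 2) le_rfl hw j).differentiableAt (by norm_num)
  have dc := fun j => (contDiffAt_coord (x := x) 1 j).differentiableAt (by norm_num)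
  unfold euler
  rw [pd_sum (f := fun j y => y j * pd j w y) fun j _ => (dc j).mul (dw j)]
  simp_rw [pd_mul (dc _) (dw _), pd_coord]
  rw [Finset.sum_add_distrib]
  simp

lemma sum_pd_pohozaevField {c₁ c₂ : ℝ} {H u v : Euc N → ℝ} {x : Euc N}
    (hu : ContDiffAt ℝ 2 u x) (hv : ContDiffAt ℝ 2 v x) (hH : DifferentiableAt ℝ H x) :
    ∑ i, pd i (pohozaevField c₁ c₂ H u v i) x =
      (euler v x + c₁ * v x) * lap u x + (euler u x + c₂ * u x) * lap v x + N * H x + euler H x +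
        (2 - N + c₁ + c₂) * ∑ j, pd j u x * pd j v x := by
  have du := fun j => (contDiffAt_pd (m := 1) (n := 2) le_rfl hu j).differentiableAt (by norm_num)
  have dv := fun j => (contDiffAt_pd (m := 1) (n := 2) le_rfl hv j).differentiableAt (by norm_num)
  have dc := fun j => (contDiffAt_coord (x := x) 1 j).differentiableAt (by norm_num)
  have eu := (contDiffAt_euler hu).differentiableAt (by norm_num)
  have ev := (contDiffAt_euler hv).differentiableAt (by norm_num)
  have hu1 : DifferentiableAt ℝ u x := hu.differentiableAt (by norm_num)
  have hv1 : DifferentiableAt ℝ v x := hv.differentiableAt (by norm_num)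
  have dG : DifferentiableAt ℝ (fun y => ∑ j, pd j u y * pd j v y) x :=
    DifferentiableAt.fun_sum fun j _ => (du j).mul (dv j)
  have key : ∀ i, pd i (pohozaevField c₁ c₂ H u v i) x =
      (euler v x + c₁ * v x) * pd i (pd i u) x + (euler u x + c₂ * u x) * pd i (pd i v) x +
      H x + x i * pd i H x - (∑ j, pd j u x * pd j v x) + (2 + c₁ + c₂) * (pd i u x * pd i v x) +
      ((∑ j, x j * pd i (pd j v) x) * pd i u x + (∑ j, x j * pd i (pd j u) x) * pd i v x -
        x i * ∑ j, (pd i (pd j u) x * pd j v x + pd j u x * pd i (pd j v) x)) := by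
    intro i
    unfold pohozaevField
    have d1 := ev.mul (du i)
    have d2 := eu.mul (dv i)
    have d3 := (dc i).mul dG
    have d4 := (dc i).mul hH
    have d5 := hv1.mul (du i)
    have d6 := hu1.mul (dv i)
    rw [pd_add (f := fun y => euler v y * pd i u y + euler u y * pd i v y -
        y i * (∑ j, pd j u y * pd j v y) + y i * H y + c₁ * (v y * pd i u y))
        (g := fun y => c₂ * (u y * pd i v y)) ((((d1.add d2).sub d3).add d4).add (d5.const_mul _))
        (d6.const_mul _),
      pd_add (f := fun y => euler v y * pd i u y + euler u y * pd i v y -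
        y i * (∑ j, pd j u y * pd j v y) + y i * H y) (g := fun y => c₁ * (v y * pd i u y))
        (((d1.add d2).sub d3).add d4) (d5.const_mul _),
      pd_add (f := fun y => euler v y * pd i u y + euler u y * pd i v y -
        y i * (∑ j, pd j u y * pd j v y)) (g := fun y => y i * H y) ((d1.add d2).sub d3) d4,
      pd_sub (f := fun y => euler v y * pd i u y + euler u y * pd i v y)
        (g := fun y => y i * (∑ j, pd j u y * pd j v y)) (d1.add d2) d3,
      pd_add (f := fun y => euler v y * pd i u y) (g := fun y => euler u y * pd i v y) d1 d2,
      pd_const_mul (f := fun y => v y * pd i u y) d5,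
      pd_const_mul (f := fun y => u y * pd i v y) d6, pd_mul ev (du i), pd_mul eu (dv i), pd_mul (dc i) dG,
      pd_mul (dc i) hH, pd_mul hv1 (du i), pd_mul hu1 (dv i), pd_euler hu, pd_euler hv, pd_coord,
      pd_sum (f := fun j y => pd j u y * pd j v y) fun j _ => (du j).mul (dv j)]
    simp_rw [pd_mul (du _) (dv _)]
    simp only [if_true]
    ring
  have hsw : ∀ w z : Euc N → ℝ, ContDiffAt ℝ 2 z x →
      ∑ i, (∑ j, x j * pd i (pd j z) x) * pd i w x =
        ∑ i, x i * ∑ j, pd j w x * pd i (pd j z) x := by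
    intro w z hz
    simp_rw [Finset.sum_mul, Finset.mul_sum]
    rw [Finset.sum_comm]
    refine Finset.sum_congr rfl fun i _ => Finset.sum_congr rfl fun j _ => ?_
    rw [pd_comm hz]
    ring
  have h0 : ∑ i, ((∑ j, x j * pd i (pd j v) x) * pd i u x +
      (∑ j, x j * pd i (pd j u) x) * pd i v x -
        x i * ∑ j, (pd i (pd j u) x * pd j v x + pd j u x * pd i (pd j v) x)) = 0 := by
    rw [Finset.sum_sub_distrib, Finset.sum_add_distrib, hsw u v hv, hsw v u hu,
      ← Finset.sum_add_distrib, ← Finset.sum_sub_distrib]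
    refine Finset.sum_eq_zero fun i _ => ?_
    rw [← mul_add, ← Finset.sum_add_distrib, ← mul_sub, ← Finset.sum_sub_distrib]
    rw [Finset.sum_eq_zero, mul_zero]
    intro j _
    ring
  rw [Finset.sum_congr rfl fun i _ => key i, Finset.sum_add_distrib, h0, add_zero]
  simp only [Finset.sum_add_distrib, Finset.sum_sub_distrib, ← Finset.mul_sum, Finset.sum_const,
    Finset.card_univ, Fintype.card_fin, nsmul_eq_mul, lap_eq_sum_pd hu, lap_eq_sum_pd hv, euler]
  ring

/-- The potential of the Hénon–Lane–Emden system. -/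
def hlePotential (p q a b : ℝ) (u v : Euc N → ℝ) (x : Euc N) : ℝ :=
  ‖x‖ ^ a * (v x ^ (p + 1) / (p + 1)) + ‖x‖ ^ b * (u x ^ (q + 1) / (q + 1))

lemma contDiffAt_norm_rpow {x : Euc N} (hx : x ≠ 0) (s : ℝ) :
    ContDiffAt ℝ 1 (fun y : Euc N => ‖y‖ ^ s) x :=
  ((contDiffAt_norm ℝ hx).rpow_const_of_ne (norm_ne_zero_iff.2 hx))

lemma euler_norm_rpow {x : Euc N} (hx : x ≠ 0) (s : ℝ) :
    euler (fun y : Euc N => ‖y‖ ^ s) x = s * ‖x‖ ^ s := by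
  have hd : DifferentiableAt ℝ (fun y : Euc N => ‖y‖) x :=
    (contDiffAt_norm (n := 1) ℝ hx).differentiableAt (by norm_num)
  have hn := norm_ne_zero_iff.2 hx
  unfold euler
  rw [← fderiv_apply_eq_sum_pd]
  have h1 : HasDerivAt (fun t : ℝ => ‖(1 + t) • x‖ ^ s) (s * ‖x‖ ^ s) 0 := by
    have h2 : HasDerivAt (fun t : ℝ => (1 + t) ^ s * ‖x‖ ^ s) (s * ‖x‖ ^ s) 0 := by
      have := (((hasDerivAt_id (0 : ℝ)).const_add 1).rpow_const (p := s)
        (Or.inl (by simp))).mul_const (‖x‖ ^ s)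
      simpa using this
    refine h2.congr_of_eventuallyEq ?_
    filter_upwards [eventually_gt_nhds (show (-1 : ℝ) < 0 by norm_num)] with t ht
    rw [norm_smul, Real.norm_of_nonneg (by linarith), Real.mul_rpow (by linarith) (norm_nonneg _)]
  have hd' : DifferentiableAt ℝ (fun y : Euc N => ‖y‖ ^ s) ((1 + (0 : ℝ)) • x) := by
    rw [add_zero, one_smul]
    exact (contDiffAt_norm_rpow hx s).differentiableAt (by norm_num)
  have h3 : HasDerivAt (fun t : ℝ => (1 + t) • x) x 0 := by
    simpa using ((hasDerivAt_id (0 : ℝ)).const_add 1).smul_const x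
  have h4 := hd'.hasFDerivAt.comp_hasDerivAt (0 : ℝ) h3
  have := h4.unique h1
  simpa using this

lemma pd_rpow_const {w : Euc N → ℝ} {x : Euc N} (hw : DifferentiableAt ℝ w x) {s : ℝ} (hs : 1 ≤ s)
    (i : Fin N) : pd i (fun y => w y ^ s) x = s * w x ^ (s - 1) * pd i w x :=
  pd_comp hw (Real.hasDerivAt_rpow_const (Or.inr hs)) i

lemma differentiableAt_rpow_div {w : Euc N → ℝ} {x : Euc N} (hw : DifferentiableAt ℝ w x) {s : ℝ}
    (hs : 1 ≤ s) : DifferentiableAt ℝ (fun y => w y ^ s / s) x := by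
  simp_rw [div_eq_mul_inv]
  exact (hw.rpow_const (Or.inr hs)).mul_const _

lemma euler_norm_rpow_mul_rpow {w : Euc N → ℝ} {x : Euc N} (hx : x ≠ 0)
    (hw : DifferentiableAt ℝ w x) {s t : ℝ} (ht : 0 < t) :
    euler (fun y => ‖y‖ ^ s * (w y ^ (t + 1) / (t + 1))) x =
      s * (‖x‖ ^ s * (w x ^ (t + 1) / (t + 1))) + ‖x‖ ^ s * w x ^ t * euler w x := by
  have h1 := (contDiffAt_norm_rpow hx s).differentiableAt (by norm_num)
  have h2 : DifferentiableAt ℝ (fun y => w y ^ (t + 1)) x :=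
    hw.rpow_const (Or.inr (by linarith))
  have h3 : ∀ i, pd i (fun y => w y ^ (t + 1) / (t + 1)) x = w x ^ t * pd i w x := by
    intro i
    have := pd_const_mul h2 (t + 1)⁻¹ i
    simp_rw [div_eq_inv_mul]
    rw [this, pd_rpow_const hw (by linarith)]
    have : t + 1 ≠ 0 := by linarith
    rw [show t + 1 - 1 = t by ring]
    field_simp
  have h4 : DifferentiableAt ℝ (fun y => w y ^ (t + 1) / (t + 1)) x :=
    differentiableAt_rpow_div hw (by linarith)
  rw [← mul_assoc s, ← euler_norm_rpow hx s]
  unfold euler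
  simp_rw [pd_mul h1 h4, h3, Finset.mul_sum, Finset.sum_mul, ← Finset.sum_add_distrib]
  exact Finset.sum_congr rfl fun i _ => by ring

lemma contDiffAt_hlePotential {p q a b : ℝ} (hp : 0 < p) (hq : 0 < q) {u v : Euc N → ℝ}
    {x : Euc N} (hx : x ≠ 0) (hu : ContDiffAt ℝ 1 u x) (hv : ContDiffAt ℝ 1 v x) :
    ContDiffAt ℝ 1 (hlePotential p q a b u v) x := by
  unfold hlePotential
  refine ((contDiffAt_norm_rpow hx a).mul ((hv.rpow_const_of_le (m := 1) ?_).div_const _)).add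
    ((contDiffAt_norm_rpow hx b).mul ((hu.rpow_const_of_le (m := 1) ?_).div_const _)) <;>
  · push_cast; linarith

/-- The Pohozaev identity in divergence form. -/
lemma IsNonnegSol.sum_pd_pohozaevField {p q a b c₁ c₂ : ℝ} {u v : Euc N → ℝ}
    (h : IsNonnegSol p q a b u v) (hp : 0 < p) (hq : 0 < q) (hc : c₁ + c₂ = N - 2) {x : Euc N}
    (hx : x ≠ 0) :
    ∑ i, pd i (pohozaevField c₁ c₂ (hlePotential p q a b u v) u v i) x =
      ((N + a) / (p + 1) - c₁) * (‖x‖ ^ a * v x ^ (p + 1)) +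
        ((N + b) / (q + 1) - c₂) * (‖x‖ ^ b * u x ^ (q + 1)) := by
  have hu := h.contDiffAt_fst x hx
  have hv := h.contDiffAt_snd x hx
  have hu1 : DifferentiableAt ℝ u x := hu.differentiableAt (by norm_num)
  have hv1 : DifferentiableAt ℝ v x := hv.differentiableAt (by norm_num)
  have hH := contDiffAt_hlePotential (a := a) (b := b) hp hq hx (hu.of_le (by norm_num))
    (hv.of_le (by norm_num))
  rw [_root_.sum_pd_pohozaevField hu hv (hH.differentiableAt (by norm_num)), h.lap_fst x hx,
    h.lap_snd x hx]
  have e1 : v x ^ (p + 1) = v x ^ p * v x := Real.rpow_add_one' (h.nonneg_snd x) (by linarith)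
  have e2 : u x ^ (q + 1) = u x ^ q * u x := Real.rpow_add_one' (h.nonneg_fst x) (by linarith)
  have hE : euler (hlePotential p q a b u v) x =
      a * (‖x‖ ^ a * (v x ^ (p + 1) / (p + 1))) + ‖x‖ ^ a * v x ^ p * euler v x +
      (b * (‖x‖ ^ b * (u x ^ (q + 1) / (q + 1))) + ‖x‖ ^ b * u x ^ q * euler u x) := by
    rw [← euler_norm_rpow_mul_rpow hx hv1 hp, ← euler_norm_rpow_mul_rpow hx hu1 hq]
    unfold euler hlePotential
    rw [← Finset.sum_add_distrib]
    refine Finset.sum_congr rfl fun i _ => ?_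
    rw [← mul_add, ← pd_add (f := fun y => ‖y‖ ^ a * (v y ^ (p + 1) / (p + 1)))
      (g := fun y => ‖y‖ ^ b * (u y ^ (q + 1) / (q + 1)))]
    · exact ((contDiffAt_norm_rpow hx a).differentiableAt (by norm_num)).mul
        (differentiableAt_rpow_div hv1 (by linarith))
    · exact ((contDiffAt_norm_rpow hx b).differentiableAt (by norm_num)).mul
        (differentiableAt_rpow_div hu1 (by linarith))
  rw [hE, show (2 - N + c₁ + c₂ : ℝ) = 0 by linarith]
  unfold hlePotential
  rw [e1, e2]
  have : p + 1 ≠ 0 := by linarith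
  have : q + 1 ≠ 0 := by linarith
  field_simp
  ring

end Pohozaev

section PohozaevCube

variable {n : ℕ}

/-- The point of `ℝ^(n+1)` with `i`-th coordinate `t` and remaining coordinates `y`. -/
def slicePoint (i : Fin (n + 1)) (t : ℝ) (y : Fin n → ℝ) : Euc (n + 1) :=
  WithLp.toLp 2 (i.insertNth t y : Fin (n + 1) → ℝ)

/-- The cube of half side `r`. -/
abbrev cube (n : ℕ) (r : ℝ) : Set (Fin n → ℝ) := Icc (fun _ => -r) (fun _ => r)

lemma mem_cube {r : ℝ} {y : Fin n → ℝ} : y ∈ cube n r ↔ ∀ i, |y i| ≤ r := by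
  simp only [mem_Icc, Pi.le_def, abs_le, forall_and]

lemma continuous_slicePoint (i : Fin (n + 1)) (t : ℝ) : Continuous (slicePoint (n := n) i t) :=
  (PiLp.continuous_toLp 2 _).comp (continuous_const.finInsertNth i continuous_id)

lemma slicePoint_apply_same (i : Fin (n + 1)) (t : ℝ) (y : Fin n → ℝ) :
    slicePoint i t y i = t := by
  simp [slicePoint]

lemma abs_le_norm_slicePoint (i : Fin (n + 1)) (t : ℝ) (y : Fin n → ℝ) :
    |t| ≤ ‖slicePoint i t y‖ := by
  have := PiLp.norm_apply_le (slicePoint i t y) i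
  rwa [slicePoint_apply_same] at this

lemma norm_le_of_abs_le {r : ℝ} (hr : 0 ≤ r) {x : Euc n} (hx : ∀ i, |x i| ≤ r) : ‖x‖ ≤ n * r := by
  rw [EuclideanSpace.norm_eq]
  refine Real.sqrt_le_iff.2 ⟨by positivity, ?_⟩
  calc ∑ i, ‖x i‖ ^ 2 ≤ ∑ i : Fin n, r ^ 2 :=
        Finset.sum_le_sum fun i _ => pow_le_pow_left₀ (norm_nonneg _) (hx i) 2
    _ = n * r ^ 2 := by simp
    _ ≤ (n * r) ^ 2 := by
        rw [mul_pow]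
        refine mul_le_mul_of_nonneg_right ?_ (by positivity)
        have : (n : ℝ) ≤ (n ^ 2 : ℕ) := by exact_mod_cast Nat.le_self_pow (by norm_num) n
        simpa using this

lemma abs_slicePoint_le {r t : ℝ} {i : Fin (n + 1)} {y : Fin n → ℝ} (ht : |t| ≤ r)
    (hy : y ∈ cube n r) (j : Fin (n + 1)) : |slicePoint i t y j| ≤ r := by
  rcases eq_or_ne j i with rfl | h
  · rwa [slicePoint_apply_same]
  · obtain ⟨k, rfl⟩ := Fin.exists_succAbove_eq h
    simpa [slicePoint] using mem_cube.1 hy k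

lemma integral_sum_pd_cube {F : Fin (n + 1) → Euc (n + 1) → ℝ} (hF : ∀ i, ContDiff ℝ 1 (F i))
    {r : ℝ} (hr : 0 ≤ r) :
    ∫ x in cube (n + 1) r, ∑ i, pd i (F i) (WithLp.toLp 2 x) =
      ∑ i, ((∫ y in cube n r, F i (slicePoint i r y)) -
        ∫ y in cube n r, F i (slicePoint i (-r) y)) := by
  let L : (Fin (n + 1) → ℝ) →L[ℝ] Euc (n + 1) :=
    ((EuclideanSpace.equiv (Fin (n + 1)) ℝ).symm : (Fin (n + 1) → ℝ) →L[ℝ] Euc (n + 1))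
  have hL : ∀ x, L x = WithLp.toLp 2 x := fun x => rfl
  have cp : ∀ i, Continuous (pd i (F i)) := fun i =>
    (contDiff_pd (m := 0) le_rfl (hF i) i).continuous
  have hpd : ∀ i x, ((fderiv ℝ (F i) (L x)).comp L) (Pi.single i 1) =
      pd i (F i) (WithLp.toLp 2 x) := by
    intro i x
    rfl
  have hcont : Continuous fun x : Fin (n + 1) → ℝ => ∑ i, pd i (F i) (WithLp.toLp 2 x) :=
    continuous_finsetSum _ fun i _ => (cp i).comp (PiLp.continuous_toLp 2 _)
  have := integral_divergence_of_hasFDerivAt_off_countable' (fun _ => -r) (fun _ => r)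
    (fun _ => by linarith) (fun i x => F i (L x)) (fun i x => (fderiv ℝ (F i) (L x)).comp L) ∅
    countable_empty (fun i => ((hF i).continuous.comp L.continuous).continuousOn)
    (fun x _ i => (((hF i).differentiable (by norm_num) (L x)).hasFDerivAt.comp x L.hasFDerivAt))
    (by
      simp only [hpd]
      exact hcont.continuousOn.integrableOn_compact isCompact_Icc)
  simp only [hpd] at this
  exact this

/-- The boundary density in the Pohozaev inequality. -/
def boundaryDensity (p q : ℝ) (u v : Euc n → ℝ) (x : Euc n) : ℝ :=
  (u x + ∑ j, |pd j u x|) * (v x + ∑ j, |pd j v x|) + u x ^ (q + 1) + v x ^ (p + 1)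

lemma abs_euler_le (w : Euc n → ℝ) (x : Euc n) : |euler w x| ≤ ‖x‖ * ∑ j, |pd j w x| := by
  unfold euler
  refine (Finset.abs_sum_le_sum_abs _ _).trans ?_
  rw [Finset.mul_sum]
  refine Finset.sum_le_sum fun j _ => ?_
  rw [abs_mul]
  exact mul_le_mul_of_nonneg_right (PiLp.norm_apply_le x j) (abs_nonneg _)

lemma abs_sum_mul_le (f g : Fin n → ℝ) : |∑ j, f j * g j| ≤ (∑ j, |f j|) * ∑ j, |g j| := by
  refine (Finset.abs_sum_le_sum_abs _ _).trans ?_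
  rw [Finset.sum_mul]
  refine Finset.sum_le_sum fun j _ => ?_
  rw [abs_mul]
  exact mul_le_mul_of_nonneg_left
    (Finset.single_le_sum (f := fun j => |g j|) (fun k _ => abs_nonneg _) (Finset.mem_univ j))
    (abs_nonneg _)

lemma abs_pohozaevField_le (c₁ c₂ : ℝ) (H u v : Euc n → ℝ) (i : Fin n) (x : Euc n) :
    |pohozaevField c₁ c₂ H u v i x| ≤
      3 * ‖x‖ * ((∑ j, |pd j u x|) * ∑ j, |pd j v x|) + ‖x‖ * |H x| +
        |c₁| * (|v x| * ∑ j, |pd j u x|) + |c₂| * (|u x| * ∑ j, |pd j v x|) := by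
  have hs : ∀ w : Euc n → ℝ, |pd i w x| ≤ ∑ j, |pd j w x| := fun w =>
    Finset.single_le_sum (f := fun j => |pd j w x|) (fun k _ => abs_nonneg _) (Finset.mem_univ i)
  have h0 : ∀ w : Euc n → ℝ, 0 ≤ ∑ j, |pd j w x| := fun w =>
    Finset.sum_nonneg fun j _ => abs_nonneg _
  have hxi : |x i| ≤ ‖x‖ := PiLp.norm_apply_le x i
  have t1 : |euler v x * pd i u x| ≤ ‖x‖ * ((∑ j, |pd j u x|) * ∑ j, |pd j v x|) := by
    rw [abs_mul]
    calc _ ≤ (‖x‖ * ∑ j, |pd j v x|) * ∑ j, |pd j u x| :=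
          mul_le_mul (abs_euler_le v x) (hs u) (abs_nonneg _) (mul_nonneg (norm_nonneg _) (h0 v))
      _ = _ := by ring
  have t2 : |euler u x * pd i v x| ≤ ‖x‖ * ((∑ j, |pd j u x|) * ∑ j, |pd j v x|) := by
    rw [abs_mul]
    calc _ ≤ (‖x‖ * ∑ j, |pd j u x|) * ∑ j, |pd j v x| :=
          mul_le_mul (abs_euler_le u x) (hs v) (abs_nonneg _) (mul_nonneg (norm_nonneg _) (h0 u))
      _ = _ := by ring
  have t3 : |x i * ∑ j, pd j u x * pd j v x| ≤ ‖x‖ * ((∑ j, |pd j u x|) * ∑ j, |pd j v x|) := by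
    rw [abs_mul]
    exact mul_le_mul hxi (abs_sum_mul_le _ _) (abs_nonneg _) (norm_nonneg _)
  have t4 : |x i * H x| ≤ ‖x‖ * |H x| := by
    rw [abs_mul]
    exact mul_le_mul_of_nonneg_right hxi (abs_nonneg _)
  have t5 : |c₁ * (v x * pd i u x)| ≤ |c₁| * (|v x| * ∑ j, |pd j u x|) := by
    rw [abs_mul, abs_mul]
    gcongr
    exact hs u
  have t6 : |c₂ * (u x * pd i v x)| ≤ |c₂| * (|u x| * ∑ j, |pd j v x|) := by
    rw [abs_mul, abs_mul]
    gcongr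
    exact hs v
  unfold pohozaevField
  refine (abs_add_le _ _).trans (add_le_add ((abs_add_le _ _).trans (add_le_add
    ((abs_add_le _ _).trans (add_le_add ?_ t4)) t5)) t6)
  refine (abs_sub _ _).trans ((add_le_add (abs_add_le _ _) le_rfl).trans ?_)
  linarith

lemma exists_abs_pohozaevField_le_boundaryDensity {p q a b : ℝ} (hp : 0 < p) (hq : 0 < q)
    (c₁ c₂ : ℝ) {ρ : ℝ} (hρ : 1 ≤ ρ) :
    ∃ C > 0, ∀ u v : Euc n → ℝ, IsNonnegSol p q a b u v → ∀ x, 1 ≤ ‖x‖ → ‖x‖ ≤ ρ → ∀ i,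
      |pohozaevField c₁ c₂ (hlePotential p q a b u v) u v i x| ≤
        C * boundaryDensity p q u v x := by
  refine ⟨3 * ρ + ρ * (ρ ^ |a| + ρ ^ |b|) + |c₁| + |c₂|, by positivity, fun u v h x hx1 hxρ i => ?_⟩
  have hu := h.nonneg_fst x
  have hv := h.nonneg_snd x
  set A := ∑ j, |pd j u x| with hA
  set B := ∑ j, |pd j v x| with hB
  have hA0 : 0 ≤ A := Finset.sum_nonneg fun j _ => abs_nonneg _
  have hB0 : 0 ≤ B := Finset.sum_nonneg fun j _ => abs_nonneg _
  have hU := Real.rpow_nonneg hu (q + 1)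
  have hV := Real.rpow_nonneg hv (p + 1)
  have hpow : ∀ s : ℝ, ‖x‖ ^ s ≤ ρ ^ |s| := fun s =>
    (Real.rpow_le_rpow_of_exponent_le hx1 (le_abs_self s)).trans
      (Real.rpow_le_rpow (norm_nonneg _) hxρ (abs_nonneg s))
  have hH : |hlePotential p q a b u v x| ≤
      (ρ ^ |a| + ρ ^ |b|) * (u x ^ (q + 1) + v x ^ (p + 1)) := by
    unfold hlePotential
    rw [abs_of_nonneg (by positivity)]
    have e1 : v x ^ (p + 1) / (p + 1) ≤ v x ^ (p + 1) := div_le_self hV (by linarith)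
    have e2 : u x ^ (q + 1) / (q + 1) ≤ u x ^ (q + 1) := div_le_self hU (by linarith)
    have e3 := mul_le_mul (hpow a) e1 (by positivity) (by positivity)
    have e4 := mul_le_mul (hpow b) e2 (by positivity) (by positivity)
    have e5 : 0 ≤ ρ ^ |a| * u x ^ (q + 1) := by positivity
    have e6 : 0 ≤ ρ ^ |b| * v x ^ (p + 1) := by positivity
    linarith
  refine (abs_pohozaevField_le c₁ c₂ _ u v i x).trans ?_
  have hD : boundaryDensity p q u v x = (u x + A) * (v x + B) + u x ^ (q + 1) + v x ^ (p + 1) := rfl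
  have hAB : A * B ≤ boundaryDensity p q u v x := by
    rw [hD]; nlinarith [mul_nonneg hu hv, mul_nonneg hu hB0, mul_nonneg hA0 hv]
  have hvA : |v x| * A ≤ boundaryDensity p q u v x := by
    rw [hD, abs_of_nonneg hv]
    nlinarith [mul_nonneg hu hv, mul_nonneg hu hB0, mul_nonneg hA0 hB0]
  have huB : |u x| * B ≤ boundaryDensity p q u v x := by
    rw [hD, abs_of_nonneg hu]
    nlinarith [mul_nonneg hu hv, mul_nonneg hA0 hv, mul_nonneg hA0 hB0]
  have hUV : u x ^ (q + 1) + v x ^ (p + 1) ≤ boundaryDensity p q u v x := by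
    rw [hD]
    have : 0 ≤ (u x + A) * (v x + B) := by positivity
    linarith
  have hD0 : 0 ≤ boundaryDensity p q u v x := (add_nonneg hU hV).trans hUV
  have s1 : 3 * ‖x‖ * (A * B) ≤ 3 * ρ * boundaryDensity p q u v x :=
    mul_le_mul (by linarith) hAB (by positivity) (by positivity)
  have s2 : ‖x‖ * |hlePotential p q a b u v x| ≤
      ρ * (ρ ^ |a| + ρ ^ |b|) * boundaryDensity p q u v x := by
    calc _ ≤ ρ * ((ρ ^ |a| + ρ ^ |b|) * (u x ^ (q + 1) + v x ^ (p + 1))) :=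
          mul_le_mul hxρ hH (abs_nonneg _) (by positivity)
      _ ≤ ρ * ((ρ ^ |a| + ρ ^ |b|) * boundaryDensity p q u v x) := by gcongr
      _ = _ := by ring
  have s3 := mul_le_mul_of_nonneg_left hvA (abs_nonneg c₁)
  have s4 := mul_le_mul_of_nonneg_left huB (abs_nonneg c₂)
  calc _ ≤ _ := add_le_add (add_le_add (add_le_add s1 s2) s3) s4
    _ = _ := by ring

lemma IsNonnegSol.exists_pohozaevField_near_zero {p q a b : ℝ} {u v : Euc n → ℝ}
    (h : IsNonnegSol p q a b u v) (hp : 0 < p) (hq : 0 < q) (ha : -2 < a) (hb : -2 < b)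
    (hu : Tame u) (hv : Tame v) (c₁ c₂ : ℝ) :
    ∃ C > 0, ∀ x, x ≠ 0 → ‖x‖ ≤ 1 → ∀ i,
      |pohozaevField c₁ c₂ (hlePotential p q a b u v) u v i x| ≤ C / ‖x‖ := by
  obtain ⟨M₁, hM₁⟩ := hu.bdd 1
  obtain ⟨M₂, hM₂⟩ := hv.bdd 1
  obtain ⟨M₃, hM₃⟩ := hu.grad
  obtain ⟨M₄, hM₄⟩ := hv.grad
  obtain ⟨M, hM, h1, h2, h3, h4⟩ : ∃ M : ℝ, 0 < M ∧ M₁ ≤ M ∧ M₂ ≤ M ∧ M₃ ≤ M ∧ M₄ ≤ M :=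
    ⟨1 + |M₁| + |M₂| + |M₃| + |M₄|, by positivity, by
      constructor
      · linarith [le_abs_self M₁, abs_nonneg M₂, abs_nonneg M₃, abs_nonneg M₄]
      refine ⟨?_, ?_, ?_⟩ <;> linarith [le_abs_self M₂, le_abs_self M₃, le_abs_self M₄,
        abs_nonneg M₁, abs_nonneg M₂, abs_nonneg M₃, abs_nonneg M₄]⟩
  refine ⟨3 * (n * M) ^ 2 + (M ^ (p + 1) + M ^ (q + 1)) + |c₁| * (M * (n * M)) +
    |c₂| * (M * (n * M)), by positivity, fun x hx hx1 i => ?_⟩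
  have hx0 : 0 < ‖x‖ := norm_pos_iff.2 hx
  have hsum : ∀ w : Euc n → ℝ, ∀ M' ≤ M, (∀ x i, x ≠ 0 → ‖x‖ ≤ 1 → |pd i w x| ≤ M' / ‖x‖) →
      ∑ j, |pd j w x| ≤ n * M / ‖x‖ := by
    intro w M' hM' hw
    calc ∑ j, |pd j w x| ≤ ∑ j : Fin n, M / ‖x‖ := Finset.sum_le_sum fun j _ =>
          (hw x j hx hx1).trans (by gcongr)
      _ = _ := by simp; ring
  have hA := hsum u M₃ h3 hM₃
  have hB := hsum v M₄ h4 hM₄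
  set A := ∑ j, |pd j u x| with hA'
  set B := ∑ j, |pd j v x| with hB'
  have hA0 : 0 ≤ A := Finset.sum_nonneg fun j _ => abs_nonneg _
  have hB0 : 0 ≤ B := Finset.sum_nonneg fun j _ => abs_nonneg _
  have hu0 := h.nonneg_fst x
  have hv0 := h.nonneg_snd x
  have huM : |u x| ≤ M := (hM₁ x hx hx1).trans h1
  have hvM : |v x| ≤ M := (hM₂ x hx hx1).trans h2
  have hpow : ∀ s : ℝ, -2 < s → ‖x‖ * ‖x‖ ^ s ≤ 1 / ‖x‖ := by
    intro s hs
    rw [le_div_iff₀ hx0]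
    calc ‖x‖ * ‖x‖ ^ s * ‖x‖ = ‖x‖ ^ (s + 2) := by
          rw [Real.rpow_add hx0, Real.rpow_two]; ring
      _ ≤ 1 := Real.rpow_le_one hx0.le hx1 (by linarith)
  have hH : ‖x‖ * |hlePotential p q a b u v x| ≤ (M ^ (p + 1) + M ^ (q + 1)) / ‖x‖ := by
    unfold hlePotential
    rw [abs_of_nonneg (by positivity)]
    have e1 : v x ^ (p + 1) / (p + 1) ≤ M ^ (p + 1) :=
      (div_le_self (by positivity) (by linarith)).trans
        (Real.rpow_le_rpow hv0 ((le_abs_self _).trans hvM) (by linarith))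
    have e2 : u x ^ (q + 1) / (q + 1) ≤ M ^ (q + 1) :=
      (div_le_self (by positivity) (by linarith)).trans
        (Real.rpow_le_rpow hu0 ((le_abs_self _).trans huM) (by linarith))
    have e3 := mul_le_mul (hpow a ha) e1 (by positivity) (by positivity)
    have e4 := mul_le_mul (hpow b hb) e2 (by positivity) (by positivity)
    calc _ = ‖x‖ * ‖x‖ ^ a * (v x ^ (p + 1) / (p + 1)) +
          ‖x‖ * ‖x‖ ^ b * (u x ^ (q + 1) / (q + 1)) := by ring
      _ ≤ _ := add_le_add e3 e4
      _ = _ := by ring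
  refine (abs_pohozaevField_le c₁ c₂ _ u v i x).trans ?_
  have s1 : 3 * ‖x‖ * (A * B) ≤ 3 * (n * M) ^ 2 / ‖x‖ := by
    calc 3 * ‖x‖ * (A * B) ≤ 3 * ‖x‖ * ((n * M / ‖x‖) * (n * M / ‖x‖)) := by gcongr
      _ = _ := by field_simp
  have s3 : |c₁| * (|v x| * A) ≤ |c₁| * (M * (n * M / ‖x‖)) := by gcongr
  have s4 : |c₂| * (|u x| * B) ≤ |c₂| * (M * (n * M / ‖x‖)) := by gcongr
  calc _ ≤ _ := add_le_add (add_le_add (add_le_add s1 hH) s3) s4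
    _ = _ := by ring

end PohozaevCube

section PohozaevEnergy

variable {n : ℕ}

/-- The energy density of the Hénon–Lane–Emden system. -/
def energyDensity (p q a b : ℝ) (u v : Euc n → ℝ) (x : Euc n) : ℝ :=
  ‖x‖ ^ b * u x ^ (q + 1) + ‖x‖ ^ a * v x ^ (p + 1)

lemma contDiffAt_norm_rpow_mul_rpow {w : Euc n → ℝ} {x : Euc n} (hx : x ≠ 0)
    (hw : ContDiffAt ℝ 1 w x) {s t : ℝ} (ht : 0 < t) :
    ContDiffAt ℝ 1 (fun y => ‖y‖ ^ s * w y ^ (t + 1)) x :=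
  (contDiffAt_norm_rpow hx s).mul (hw.rpow_const_of_le (m := 1) (by push_cast; linarith))

lemma volume_cube_le {r : ℝ} (hr : 0 ≤ r) :
    volume (cube (n + 1) r) = ENNReal.ofReal ((2 * r) ^ (n + 1)) := by
  rw [Real.volume_Icc_pi]
  simp only [Finset.prod_const, Finset.card_univ, Fintype.card_fin]
  rw [ENNReal.ofReal_pow (by positivity)]
  congr 2
  ring

lemma IsNonnegSol.exists_pohozaev_cube {p q a b : ℝ} (hn : 3 ≤ n + 1) (hp : 0 < p) (hq : 0 < q)
    (ha : -2 < a) (hb : -2 < b)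
    (hsub : ((n + 1 : ℕ) : ℝ) - 2 < ((n + 1 : ℕ) + a) / (p + 1) + ((n + 1 : ℕ) + b) / (q + 1)) :
    ∃ C > 0, ∀ u v : Euc (n + 1) → ℝ, IsNonnegSol p q a b u v → ∀ r, 1 ≤ r → r ≤ 2 →
      ∫⁻ x in cube (n + 1) r, ENNReal.ofReal (energyDensity p q a b u v (WithLp.toLp 2 x)) ≤
        ENNReal.ofReal C * ∑ i,
          ((∫⁻ y in cube n r, ENNReal.ofReal (boundaryDensity p q u v (slicePoint i r y))) +
            ∫⁻ y in cube n r, ENNReal.ofReal (boundaryDensity p q u v (slicePoint i (-r) y))) := by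
  set N : ℝ := ((n + 1 : ℕ) : ℝ) with hN
  obtain ⟨c₁, c₂, hc, k1, k2⟩ : ∃ c₁ c₂ : ℝ, c₁ + c₂ = N - 2 ∧
      0 < (N + a) / (p + 1) - c₁ ∧ 0 < (N + b) / (q + 1) - c₂ := by
    set t := (N + a) / (p + 1) + (N + b) / (q + 1) - (N - 2) with ht
    refine ⟨(N + a) / (p + 1) - t / 2, (N + b) / (q + 1) - t / 2, ?_, ?_, ?_⟩ <;> linarith
  set k₁ := (N + a) / (p + 1) - c₁ with hk₁
  set k₂ := (N + b) / (q + 1) - c₂ with hk₂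
  obtain ⟨C₁, hC₁, hbd⟩ := exists_abs_pohozaevField_le_boundaryDensity (n := n + 1) (a := a) (b := b)
    hp hq c₁ c₂ (ρ := N * 2) (by
      have : (3 : ℝ) ≤ N := by rw [hN]; exact_mod_cast hn
      linarith)
  obtain ⟨C₂, hC₂, hcut⟩ := exists_pd_cutoff_bound (n + 1)
  refine ⟨C₁ / min k₁ k₂, by positivity, fun u v h r hr1 hr2 => ?_⟩
  have tu : Tame u := h.tame hp ha
  have tv : Tame v := h.symm.tame hq hb
  obtain ⟨C₃, hC₃, hnear⟩ := h.exists_pohozaevField_near_zero hp hq ha hb tu tv c₁ c₂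
  set P := pohozaevField c₁ c₂ (hlePotential p q a b u v) u v with hP
  set e : Euc (n + 1) → ℝ := fun x =>
    k₁ * (‖x‖ ^ a * v x ^ (p + 1)) + k₂ * (‖x‖ ^ b * u x ^ (q + 1)) with he
  have hu1 : ∀ x, x ≠ 0 → ContDiffAt ℝ 1 u x := fun x hx =>
    (h.contDiffAt_fst x hx).of_le (by norm_num)
  have hv1 : ∀ x, x ≠ 0 → ContDiffAt ℝ 1 v x := fun x hx =>
    (h.contDiffAt_snd x hx).of_le (by norm_num)
  have cP : ∀ i x, x ≠ 0 → ContDiffAt ℝ 1 (P i) x := fun i x hx =>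
    contDiffAt_pohozaevField (h.contDiffAt_fst x hx) (h.contDiffAt_snd x hx)
      (contDiffAt_hlePotential hp hq hx (hu1 x hx) (hv1 x hx)) i
  have ce : ∀ x, x ≠ 0 → ContDiffAt ℝ 1 e x := fun x hx =>
    (contDiffAt_const.mul (contDiffAt_norm_rpow_mul_rpow hx (hv1 x hx) hp)).add
      (contDiffAt_const.mul (contDiffAt_norm_rpow_mul_rpow hx (hu1 x hx) hq))
  have hr0 : 0 ≤ r := by linarith
  have hface : ∀ i, ∀ t : ℝ, |t| = r → ∀ ε : ℝ, 0 < ε → ε ≤ 1 / 4 →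
      ‖∫ y in cube n r, cutoff ε (slicePoint i t y) * P i (slicePoint i t y)‖ₑ ≤
        ENNReal.ofReal C₁ * ∫⁻ y in cube n r,
          ENNReal.ofReal (boundaryDensity p q u v (slicePoint i t y)) := by
    intro i t ht ε hε hε1
    refine (enorm_integral_le_lintegral_enorm _).trans ?_
    rw [← lintegral_const_mul' _ _ ENNReal.ofReal_ne_top]
    refine setLIntegral_mono' measurableSet_Icc fun y hy => ?_
    rw [← ENNReal.ofReal_mul hC₁.le, Real.enorm_eq_ofReal_abs]
    refine ENNReal.ofReal_le_ofReal ?_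
    have h1 : 1 ≤ ‖slicePoint i t y‖ := by
      have := abs_le_norm_slicePoint i t y
      linarith
    have h2 : ‖slicePoint i t y‖ ≤ N * 2 := by
      refine (norm_le_of_abs_le hr0 (abs_slicePoint_le ht.le hy)).trans ?_
      rw [← hN]
      exact mul_le_mul_of_nonneg_left hr2 (by positivity)
    rw [cutoff_eq_one hε (by linarith), one_mul]
    exact hbd u v h _ h1 h2 i
  set B : ENNReal := ENNReal.ofReal C₁ * ∑ i,
          ((∫⁻ y in cube n r, ENNReal.ofReal (boundaryDensity p q u v (slicePoint i r y))) +
            ∫⁻ y in cube n r, ENNReal.ofReal (boundaryDensity p q u v (slicePoint i (-r) y)))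
    with hB
  set K := N * (C₂ * C₃) * 4 ^ (n + 1) with hK
  have hK0 : 0 < K := by positivity
  have key : ∀ ε : ℝ, 0 < ε → ε ≤ 1 / 4 →
      ∫⁻ x in cube (n + 1) r, ENNReal.ofReal (cutoff ε (WithLp.toLp 2 x : Euc (n + 1)) *
        e (WithLp.toLp 2 x)) ≤ B + ENNReal.ofReal (K * ε) := by
    intro ε hε hε1
    have cF : ∀ i, ContDiff ℝ 1 (fun x => cutoff ε x * P i x) := fun i =>
      contDiff_cutoff_mul (n := 1) (cP i) hε
    have cE : Continuous (fun x => cutoff ε x * e x) :=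
      (contDiff_cutoff_mul (n := 1) ce hε).continuous
    have hdiv := integral_sum_pd_cube cF hr0
    set D : Euc (n + 1) → ℝ := fun x =>
      ∑ i, pd i (fun x => cutoff ε x * P i x) x - cutoff ε x * e x with hD
    have cS : Continuous fun x => ∑ i, pd i (fun x => cutoff ε x * P i x) x :=
      continuous_finsetSum _ fun i _ => (contDiff_pd (m := 0) le_rfl (cF i) i).continuous
    have cD : Continuous D := cS.sub cE
    have ctoLp : Continuous fun x : Fin (n + 1) → ℝ => (WithLp.toLp 2 x : Euc (n + 1)) :=
      PiLp.continuous_toLp 2 _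
    have hDbd : ∀ x : Euc (n + 1), ‖D x‖ₑ ≤
        indicator (closedBall 0 (2 * ε)) (fun _ => ENNReal.ofReal (N * (C₂ * C₃) / ε ^ 2)) x := by
      intro x
      by_cases hx : x = 0 ∨ ‖x‖ < ε
      · have hxε : ‖x‖ < ε := by
          rcases hx with rfl | hx
          · simpa using hε
          · exact hx
        have h0 : ∀ w : Euc (n + 1) → ℝ, (fun x => cutoff ε x * w x) =ᶠ[nhds x] fun _ => 0 := by
          intro w
          filter_upwards [continuous_norm.continuousAt.eventually_lt continuousAt_const hxε]
            with y hy
          rw [cutoff_eq_zero hε (le_of_lt hy), zero_mul]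
        have : D x = 0 := by
          simp only [hD]
          rw [(h0 e).eq_of_nhds, Finset.sum_eq_zero fun i _ => ?_, sub_zero]
          rw [pd_congr (h0 (P i)) i]
          simp [pd]
        rw [this, enorm_zero]
        exact zero_le
      · push Not at hx
        obtain ⟨hx0, hxε⟩ := hx
        have hDx : D x = ∑ i, pd i (cutoff ε) x * P i x := by
          have hdv := h.sum_pd_pohozaevField hp hq hc hx0
          simp only [hD]
          have : ∀ i, pd i (fun x => cutoff ε x * P i x) x =
              pd i (cutoff ε) x * P i x + cutoff ε x * pd i (P i) x := fun i =>
            pd_mul ((contDiff_cutoff (n := 1) ε).differentiable (by norm_num) x)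
              ((cP i x hx0).differentiableAt (by norm_num)) i
          rw [Finset.sum_congr rfl fun i _ => this i, Finset.sum_add_distrib, ← Finset.mul_sum, hdv]
          simp only [he, hk₁, hk₂]
          ring
        by_cases hx2 : 2 * ε < ‖x‖
        · have : D x = 0 := by
            rw [hDx]
            refine Finset.sum_eq_zero fun i _ => ?_
            rw [(pd_cutoff_eq_zero hε (Or.inr hx2) i).eq_of_nhds, zero_mul]
          rw [this, enorm_zero]
          exact zero_le
        · push Not at hx2
          rw [indicator_of_mem (by simpa using hx2), Real.enorm_eq_ofReal_abs, hDx]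
          refine ENNReal.ofReal_le_ofReal ((Finset.abs_sum_le_sum_abs _ _).trans ?_)
          calc ∑ i, |pd i (cutoff ε) x * P i x| ≤ ∑ i : Fin (n + 1), C₂ * C₃ / ε ^ 2 := by
                refine Finset.sum_le_sum fun i _ => ?_
                rw [abs_mul]
                calc _ ≤ (C₂ / ε) * (C₃ / ε) := by
                      refine mul_le_mul (hcut ε hε i x).1 ?_ (abs_nonneg _) (by positivity)
                      refine (hnear x hx0 (by linarith) i).trans ?_
                      gcongr
                  _ = _ := by field_simp
            _ = _ := by simp [hN]; ring
    have hDint : ‖∫ x in cube (n + 1) r, D (WithLp.toLp 2 x)‖ₑ ≤ ENNReal.ofReal (K * ε) := by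
      refine (enorm_integral_le_lintegral_enorm _).trans ?_
      calc ∫⁻ x in cube (n + 1) r, ‖D (WithLp.toLp 2 x)‖ₑ
          ≤ ∫⁻ x, ‖D (WithLp.toLp 2 x)‖ₑ := setLIntegral_le_lintegral _ _
        _ ≤ ∫⁻ x : Fin (n + 1) → ℝ, indicator (cube (n + 1) (2 * ε))
              (fun _ => ENNReal.ofReal (N * (C₂ * C₃) / ε ^ 2)) x := by
            refine lintegral_mono fun x => (hDbd _).trans ?_
            by_cases hx : (WithLp.toLp 2 x : Euc (n + 1)) ∈ closedBall 0 (2 * ε)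
            · rw [indicator_of_mem hx, indicator_of_mem]
              refine mem_cube.2 fun i => ?_
              have := PiLp.norm_apply_le (WithLp.toLp 2 x : Euc (n + 1)) i
              rw [mem_closedBall_zero_iff] at hx
              exact this.trans hx
            · rw [indicator_of_notMem hx]
              exact zero_le
        _ = ENNReal.ofReal (N * (C₂ * C₃) / ε ^ 2) * volume (cube (n + 1) (2 * ε)) := by
            rw [lintegral_indicator measurableSet_Icc, setLIntegral_const]
        _ = ENNReal.ofReal (N * (C₂ * C₃) / ε ^ 2 * (2 * (2 * ε)) ^ (n + 1)) := by
            rw [volume_cube_le (by positivity), ENNReal.ofReal_mul (by positivity)]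
        _ ≤ ENNReal.ofReal (K * ε) := by
            refine ENNReal.ofReal_le_ofReal ?_
            have e1 : (2 * (2 * ε)) ^ (n + 1) = 4 ^ (n + 1) * ε ^ (n + 1) := by
              rw [← mul_pow]; congr 1; ring
            have e2 : ε ^ (n + 1) ≤ ε ^ 3 := pow_le_pow_of_le_one hε.le (by linarith) hn
            rw [e1, hK]
            calc N * (C₂ * C₃) / ε ^ 2 * (4 ^ (n + 1) * ε ^ (n + 1))
                ≤ N * (C₂ * C₃) / ε ^ 2 * (4 ^ (n + 1) * ε ^ 3) := by gcongr
              _ = _ := by field_simp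
    have hIE : IntegrableOn (fun x : Fin (n + 1) → ℝ => cutoff ε (WithLp.toLp 2 x : Euc (n + 1)) *
        e (WithLp.toLp 2 x)) (cube (n + 1) r) :=
      (cE.comp ctoLp).continuousOn.integrableOn_compact isCompact_Icc
    have he0 : ∀ x, 0 ≤ e x := fun x => by
      have := Real.rpow_nonneg (h.nonneg_fst x) (q + 1)
      have := Real.rpow_nonneg (h.nonneg_snd x) (p + 1)
      simp only [he]; positivity
    rw [← ofReal_integral_eq_lintegral_ofReal hIE
      (Filter.Eventually.of_forall fun x => mul_nonneg (cutoff_nonneg _ _) (he0 _))]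
    have hEq : ∫ x in cube (n + 1) r, cutoff ε (WithLp.toLp 2 x : Euc (n + 1)) *
        e (WithLp.toLp 2 x) = ∑ i, ((∫ y in cube n r, cutoff ε (slicePoint i r y) *
          P i (slicePoint i r y)) - ∫ y in cube n r, cutoff ε (slicePoint i (-r) y) *
          P i (slicePoint i (-r) y)) - ∫ x in cube (n + 1) r, D (WithLp.toLp 2 x) := by
      rw [← hdiv, ← integral_sub]
      · refine integral_congr_ae (Filter.Eventually.of_forall fun x => ?_)
        simp only [hD]
        ring
      · exact (cS.comp ctoLp).continuousOn.integrableOn_compact isCompact_Icc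
      · exact (cD.comp ctoLp).continuousOn.integrableOn_compact isCompact_Icc
    rw [hEq]
    refine (ENNReal.ofReal_le_ofReal (le_abs_self _)).trans ?_
    rw [← Real.enorm_eq_ofReal_abs]
    refine (enorm_sub_le).trans (add_le_add ?_ hDint)
    refine (enorm_sum_le _ _).trans ?_
    rw [hB, Finset.mul_sum]
    refine Finset.sum_le_sum fun i _ => (enorm_sub_le).trans ?_
    rw [mul_add]
    exact add_le_add (hface i r (abs_of_nonneg hr0) ε hε hε1)
      (hface i (-r) (by rw [abs_neg, abs_of_nonneg hr0]) ε hε hε1)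
  have hlim : ∫⁻ x in cube (n + 1) r, ENNReal.ofReal (e (WithLp.toLp 2 x)) ≤ B := by
    set εs : ℕ → ℝ := fun k => 1 / ((k : ℝ) + 4) with hεs
    have hε0 : ∀ k, 0 < εs k := fun k => by simp only [hεs]; positivity
    have hε1 : ∀ k, εs k ≤ 1 / 4 := fun k => by
      simp only [hεs]
      exact one_div_le_one_div_of_le (by norm_num) (by linarith [(Nat.cast_nonneg k : (0:ℝ) ≤ k)])
    have hε2 : Filter.Tendsto εs Filter.atTop (nhds 0) := by
      have := (tendsto_one_div_add_atTop_nhds_zero_nat (𝕜 := ℝ)).comp (Filter.tendsto_add_atTop_nat 3)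
      refine this.congr fun k => ?_
      simp only [hεs, Function.comp]
      push_cast
      ring_nf
    have hconv : ∀ᵐ x ∂(volume : Measure (Fin (n + 1) → ℝ)).restrict (cube (n + 1) r),
        ENNReal.ofReal (e (WithLp.toLp 2 x)) ≤ Filter.liminf (fun k => ENNReal.ofReal
          (cutoff (εs k) (WithLp.toLp 2 x : Euc (n + 1)) * e (WithLp.toLp 2 x))) Filter.atTop := by
      have h0 : ∀ᵐ x : Fin (n + 1) → ℝ, x ≠ 0 := by
        have : ({0}ᶜ : Set (Fin (n + 1) → ℝ)) ∈ ae volume :=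
          compl_mem_ae_iff.2 (measure_singleton 0)
        exact this
      filter_upwards [ae_restrict_of_ae h0] with x hx
      have hx' : 0 < ‖(WithLp.toLp 2 x : Euc (n + 1))‖ := by
        rw [norm_pos_iff]
        intro h
        exact hx (by simpa using h)
      refine le_of_eq (Filter.Tendsto.liminf_eq ?_).symm
      refine tendsto_const_nhds.congr' ?_
      have : ∀ᶠ k in Filter.atTop, 2 * εs k < ‖(WithLp.toLp 2 x : Euc (n + 1))‖ :=
        (hε2.const_mul 2).eventually_lt_const (by simpa using hx')
      filter_upwards [this] with k hk
      rw [cutoff_eq_one (hε0 k) hk.le, one_mul]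
    refine (lintegral_mono_ae hconv).trans ((lintegral_liminf_le fun k => ?_).trans ?_)
    · refine ENNReal.measurable_ofReal.comp (Continuous.measurable ?_)
      exact (contDiff_cutoff_mul (n := 1) ce (hε0 k)).continuous.comp (PiLp.continuous_toLp 2 _)
    · have hlimB : Filter.Tendsto (fun k => B + ENNReal.ofReal (K * εs k)) Filter.atTop
          (nhds B) := by
        have := (ENNReal.tendsto_ofReal (hε2.const_mul K)).const_add B
        simpa using this
      rw [← hlimB.liminf_eq]
      exact Filter.liminf_le_liminf (Filter.Eventually.of_forall fun k => key _ (hε0 k) (hε1 k))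
  have hmin : 0 < min k₁ k₂ := lt_min k1 k2
  rw [ENNReal.ofReal_div_of_pos hmin, div_eq_mul_inv, mul_comm (ENNReal.ofReal C₁), mul_assoc, ← hB,
    ← ENNReal.div_eq_inv_mul, ENNReal.le_div_iff_mul_le
      (Or.inl (by simpa using hmin)) (Or.inl ENNReal.ofReal_ne_top), mul_comm,
    ← lintegral_const_mul' _ _ ENNReal.ofReal_ne_top]
  refine (lintegral_mono fun x => ?_).trans hlim
  rw [← ENNReal.ofReal_mul hmin.le]
  refine ENNReal.ofReal_le_ofReal ?_
  simp only [energyDensity, he]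
  set y : Euc (n + 1) := WithLp.toLp 2 x
  have e1 : 0 ≤ ‖y‖ ^ a * v y ^ (p + 1) :=
    mul_nonneg (by positivity) (Real.rpow_nonneg (h.nonneg_snd y) _)
  have e2 : 0 ≤ ‖y‖ ^ b * u y ^ (q + 1) :=
    mul_nonneg (by positivity) (Real.rpow_nonneg (h.nonneg_fst y) _)
  have e3 := mul_le_mul_of_nonneg_right (min_le_left k₁ k₂) e1
  have e4 := mul_le_mul_of_nonneg_right (min_le_right k₁ k₂) e2
  linarith

end PohozaevEnergy

section SliceKernel

variable {n : ℕ}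

lemma exists_lintegral_enorm_sub_rpow_le (L : ℝ) {e : ℝ} (he : -1 < e) :
    ∃ c : ENNReal, c ≠ ⊤ ∧ ∀ t : ℝ, ∫⁻ τ in {τ | |t - τ| ≤ L}, ‖t - τ‖ₑ ^ e ≤ c := by
  set φ : ℝ → ENNReal := indicator (Icc 0 L) fun s => ‖s‖ₑ ^ e with hφ
  have mφ : Measurable φ := (measurable_enorm.pow_const e).indicator measurableSet_Icc
  have hfin : ∫⁻ s, φ s ≠ ⊤ := by
    rw [hφ, lintegral_indicator measurableSet_Icc, ← setLIntegral_congr Ioc_ae_eq_Icc]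
    rcases le_or_gt L 0 with hL | hL
    · simp [Ioc_eq_empty (not_lt.2 hL)]
    · have h1 := (intervalIntegral.intervalIntegrable_rpow' (a := 0) (b := L) he).1
      refine ne_of_lt (lt_of_le_of_lt ?_ h1.2)
      refine setLIntegral_mono' measurableSet_Ioc fun s hs => le_of_eq ?_
      rw [Real.enorm_eq_ofReal_abs, Real.enorm_eq_ofReal_abs, abs_of_pos hs.1,
        ENNReal.ofReal_rpow_of_pos hs.1, abs_of_pos (Real.rpow_pos_of_pos hs.1 _)]
  refine ⟨(∫⁻ s, φ s) + ∫⁻ s, φ s, ENNReal.add_ne_top.2 ⟨hfin, hfin⟩, fun t => ?_⟩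
  have mS : MeasurableSet {τ : ℝ | |t - τ| ≤ L} :=
    measurableSet_le (by fun_prop) measurable_const
  have h1 : ∫⁻ τ, φ (t - τ) = ∫⁻ s, φ s := lintegral_sub_left_eq_self φ t
  have h2 : ∫⁻ τ, φ (τ - t) = ∫⁻ s, φ s := lintegral_sub_right_eq_self φ t
  rw [← lintegral_indicator mS]
  calc _ ≤ ∫⁻ τ, (φ (t - τ) + φ (τ - t)) := by
        refine lintegral_mono fun τ => ?_
        by_cases hτ : τ ∈ {τ : ℝ | |t - τ| ≤ L}
        · rw [indicator_of_mem hτ]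
          obtain ⟨k1, k2⟩ := abs_le.1 (show |t - τ| ≤ L from hτ)
          rcases le_total τ t with h | h
          · rw [hφ, indicator_of_mem (show t - τ ∈ Icc 0 L from ⟨by linarith, k2⟩)]
            exact le_self_add
          · rw [hφ, indicator_of_mem (show τ - t ∈ Icc 0 L from ⟨by linarith, by linarith⟩),
              enorm_sub_rev]
            exact le_add_self
        · rw [indicator_of_notMem hτ]
          exact zero_le
    _ = _ := by
        have m1 : Measurable fun τ => φ (t - τ) := mφ.comp (measurable_const.sub measurable_id)
        rw [lintegral_add_left m1, h1, h2]

lemma exists_lintegral_slice_kernel_le {m : ℝ} (hm : (n : ℝ) < m) :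
    ∃ c : ENNReal, c ≠ ⊤ ∧ ∀ (s : ℝ) (z : Fin n → ℝ), s ≠ 0 →
      ∫⁻ ζ, (‖s‖ₑ + ‖z - ζ‖ₑ) ^ (-m) ≤ c * ‖s‖ₑ ^ ((n : ℝ) - m) := by
  refine ⟨∫⁻ ζ : Fin n → ℝ, (1 + ‖ζ‖ₑ) ^ (-m), ?_, fun s z hs => ?_⟩
  · have h := finite_integral_one_add_norm (E := Fin n → ℝ) (μ := volume) (r := m) (by simpa using hm)
    refine ne_of_lt (lt_of_le_of_lt (lintegral_mono fun ζ => le_of_eq ?_) h)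
    rw [← ENNReal.ofReal_rpow_of_pos (by positivity), ENNReal.ofReal_add zero_le_one (norm_nonneg _),
      ENNReal.ofReal_one, ofReal_norm]
  · have hs0 : ‖s‖ₑ ≠ 0 := by simpa using hs
    have hs1 : ‖s‖ₑ ≠ ⊤ := enorm_ne_top
    have hg : Measurable fun ζ : Fin n → ℝ => (‖s‖ₑ + ‖ζ‖ₑ) ^ (-m) :=
      (measurable_const.add measurable_enorm).pow_const _
    rw [lintegral_sub_left_eq_self (fun ζ => (‖s‖ₑ + ‖ζ‖ₑ) ^ (-m)) z]
    have h1 : ∫⁻ ζ, (‖s‖ₑ + ‖s • ζ‖ₑ) ^ (-m) ∂(volume : Measure (Fin n → ℝ)) =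
        ENNReal.ofReal |(s ^ n)⁻¹| * ∫⁻ ζ, (‖s‖ₑ + ‖ζ‖ₑ) ^ (-m) ∂(volume : Measure (Fin n → ℝ)) := by
      rw [← lintegral_map (f := fun ζ => (‖s‖ₑ + ‖ζ‖ₑ) ^ (-m)) hg (measurable_const_smul s),
        Measure.map_addHaar_smul _ hs, lintegral_smul_measure]
      simp
    have h2 : ∫⁻ ζ, (‖s‖ₑ + ‖s • ζ‖ₑ) ^ (-m) ∂(volume : Measure (Fin n → ℝ)) =
        ‖s‖ₑ ^ (-m) * ∫⁻ ζ : Fin n → ℝ, (1 + ‖ζ‖ₑ) ^ (-m) := by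
      have hg1 : Measurable fun ζ : Fin n → ℝ => (1 + ‖ζ‖ₑ) ^ (-m) :=
        (measurable_const.add measurable_enorm).pow_const _
      rw [← lintegral_const_mul _ hg1]
      refine lintegral_congr fun ζ => ?_
      rw [enorm_smul, ← ENNReal.mul_rpow_of_ne_zero hs0 (by simp), mul_add, mul_one]
    have h3 : ENNReal.ofReal |(s ^ n)⁻¹| = ‖s‖ₑ ^ (-(n : ℝ)) := by
      rw [← Real.enorm_eq_ofReal_abs, enorm_inv (pow_ne_zero _ hs), enorm_pow, ENNReal.rpow_neg,
        ENNReal.rpow_natCast]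
    rw [h2, h3] at h1
    have h4 : ‖s‖ₑ ^ (n : ℝ) * ‖s‖ₑ ^ (-(n : ℝ)) = 1 := by
      rw [← ENNReal.rpow_add _ _ hs0 hs1, add_neg_cancel, ENNReal.rpow_zero]
    calc ∫⁻ ζ, (‖s‖ₑ + ‖ζ‖ₑ) ^ (-m) ∂(volume : Measure (Fin n → ℝ))
        = ‖s‖ₑ ^ (n : ℝ) * (‖s‖ₑ ^ (-(n : ℝ)) *
            ∫⁻ ζ, (‖s‖ₑ + ‖ζ‖ₑ) ^ (-m) ∂(volume : Measure (Fin n → ℝ))) := by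
          rw [← mul_assoc, h4, one_mul]
      _ ≤ _ := by
          rw [← h1, sub_eq_add_neg, ENNReal.rpow_add _ _ hs0 hs1]
          exact le_of_eq (by ring)

/-- A one-sided trace inequality for the Riesz-type kernel `(|s| + |ξ|)^(-γ)` on the slice
`{t} × ℝⁿ`. -/
lemma exists_lintegral_slice_rpow_le {γ κ s δ : ℝ} (L : ℝ) (hn : 0 < n) (hκ : 1 ≤ κ) (hs : κ ≤ s)
    (hδ : 0 < δ) (hδ1 : δ < 1) (hl : γ - 1 + δ = n * (1 / s + 1 - 1 / κ)) :
    ∃ C : ENNReal, C ≠ ⊤ ∧ ∀ (t : ℝ) (F : ℝ × (Fin n → ℝ) → ENNReal), Measurable F →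
      (∀ y, L < |t - y.1| → F y = 0) →
      ∫⁻ z, (∫⁻ y, (‖t - y.1‖ₑ + ‖z - y.2‖ₑ) ^ (-γ) * F y) ^ s ≤
        C * (∫⁻ y, F y ^ κ * ‖t - y.1‖ₑ ^ (-1 + δ)) ^ (s / κ) := by
  have hκ0 : 0 < κ := by linarith
  have hs0 : 0 < s := by linarith
  have hn' : (0 : ℝ) < n := by exact_mod_cast hn
  have hθ : 0 ≤ 1 - 1 / κ := by
    rw [sub_nonneg, div_le_one hκ0]; exact hκ
  have hβ : 0 ≤ 1 / κ - 1 / s := by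
    rw [sub_nonneg]; exact one_div_le_one_div_of_le hκ0 hs
  have hl0 : 0 < 1 / s + 1 - 1 / κ := by
    have : 0 < 1 / s := by positivity
    linarith
  obtain ⟨l, hlpos, hldef⟩ : ∃ l : ℝ, 0 < l ∧ l * (1 / s + 1 - 1 / κ) = 1 :=
    ⟨(1 / s + 1 - 1 / κ)⁻¹, by positivity, inv_mul_cancel₀ hl0.ne'⟩
  have hγl : γ * l - n = l * (1 - δ) := by
    have : l * (γ - 1 + δ) = n * (l * (1 / s + 1 - 1 / κ)) := by rw [hl]; ring
    rw [hldef] at this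
    linarith
  set e := (1 - δ) * (l - 1) with he
  obtain ⟨c₁, hc₁, hker⟩ := exists_lintegral_slice_kernel_le (n := n) (m := γ * l)
    (by nlinarith)
  obtain ⟨c₂, hc₂, hline⟩ := exists_lintegral_enorm_sub_rpow_le L (e := -1 + δ) (by linarith)
  refine ⟨c₁ * (c₁ * c₂) ^ (s * (1 - 1 / κ)), ENNReal.mul_ne_top hc₁
    (ENNReal.rpow_ne_top_of_nonneg (by positivity) (ENNReal.mul_ne_top hc₁ hc₂)),
    fun t F mF hF => ?_⟩
  set I : Set ℝ := {τ | |t - τ| ≤ L} with hI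
  have mI : MeasurableSet I := measurableSet_le (by fun_prop) measurable_const
  set μ : Measure (ℝ × (Fin n → ℝ)) := (volume.restrict I).prod volume with hμ
  have hμ' : μ = volume.restrict (I ×ˢ univ) := by
    rw [hμ, Measure.volume_eq_prod, ← Measure.prod_restrict, Measure.restrict_univ]
  have hle : μ ≤ volume := by rw [hμ']; exact Measure.restrict_le_self
  have hne : ∀ᵐ τ : ℝ ∂(volume.restrict I), t - τ ≠ 0 := by
    have : ({t}ᶜ : Set ℝ) ∈ ae (volume : Measure ℝ) := compl_mem_ae_iff.2 (measure_singleton t)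
    refine ae_restrict_of_ae ?_
    filter_upwards [this] with τ hτ h0
    exact hτ (by simpa using (sub_eq_zero.1 h0).symm)
  have hneμ : ∀ᵐ y ∂μ, t - y.1 ≠ 0 := Measure.quasiMeasurePreserving_fst.ae hne
  have mW : Measurable fun y : ℝ × (Fin n → ℝ) => ‖t - y.1‖ₑ := by fun_prop
  have mK : Measurable fun y : (Fin n → ℝ) × ℝ × (Fin n → ℝ) => ‖t - y.2.1‖ₑ + ‖y.1 - y.2.2‖ₑ := by
    fun_prop
  have mKz : ∀ z : Fin n → ℝ,
      Measurable fun y : ℝ × (Fin n → ℝ) => ‖t - y.1‖ₑ + ‖z - y.2‖ₑ := fun z => by fun_prop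
  have mKy : ∀ y : ℝ × (Fin n → ℝ),
      Measurable fun z : Fin n → ℝ => ‖t - y.1‖ₑ + ‖z - y.2‖ₑ := fun z => by fun_prop
  set B := ∫⁻ y, F y ^ κ * ‖t - y.1‖ₑ ^ (-1 + δ) ∂μ with hB
  set A : (Fin n → ℝ) → ENNReal := fun z => ∫⁻ y, (‖t - y.1‖ₑ + ‖z - y.2‖ₑ) ^ (-(γ * l)) *
    F y ^ κ * ‖t - y.1‖ₑ ^ e ∂μ with hA
  have hwe : ∀ w : ENNReal, w ≠ 0 → w ≠ ⊤ → w ^ ((n : ℝ) - γ * l) * w ^ e = w ^ (-1 + δ) := by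
    intro w h0 h1
    rw [← ENNReal.rpow_add _ _ h0 h1]
    congr 1
    rw [he]; linarith
  have hC : ∀ z : Fin n → ℝ, ∫⁻ y, (‖t - y.1‖ₑ + ‖z - y.2‖ₑ) ^ (-(γ * l)) *
      ‖t - y.1‖ₑ ^ e ∂μ ≤ c₁ * c₂ := by
    intro z
    have hm : Measurable fun y : ℝ × (Fin n → ℝ) =>
        (‖t - y.1‖ₑ + ‖z - y.2‖ₑ) ^ (-(γ * l)) * ‖t - y.1‖ₑ ^ e :=
      ((mKz z).pow_const _).mul (mW.pow_const _)
    rw [hμ, lintegral_prod _ hm.aemeasurable]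
    calc _ ≤ ∫⁻ τ in I, c₁ * ‖t - τ‖ₑ ^ (-1 + δ) := by
          refine lintegral_mono_ae ?_
          filter_upwards [hne] with τ hτ
          rw [lintegral_mul_const' _ _ (ENNReal.rpow_ne_top_of_ne_zero (by simpa using hτ)
            enorm_ne_top)]
          rw [← hwe ‖t - τ‖ₑ (by simpa using hτ) enorm_ne_top, ← mul_assoc]
          exact mul_le_mul_left (hker (t - τ) z hτ) _
      _ ≤ c₁ * c₂ := by
          rw [lintegral_const_mul' _ _ hc₁]
          exact mul_le_mul_right (hline t) _
  have hAint : ∫⁻ z, A z ≤ c₁ * B := by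
    rw [hA, lintegral_lintegral_swap]
    · rw [hB, ← lintegral_const_mul' _ _ hc₁]
      refine lintegral_mono_ae ?_
      filter_upwards [hneμ] with y hy
      have h0 : ‖t - y.1‖ₑ ≠ 0 := by simpa using hy
      have h1 : ‖t - y.1‖ₑ ≠ ⊤ := enorm_ne_top
      have m1 : Measurable fun z : Fin n → ℝ => (‖t - y.1‖ₑ + ‖z - y.2‖ₑ) ^ (-(γ * l)) :=
        (mKy y).pow_const _
      rw [lintegral_mul_const _ (m1.mul_const _), lintegral_mul_const _ m1]
      have : ∫⁻ z : Fin n → ℝ, (‖t - y.1‖ₑ + ‖z - y.2‖ₑ) ^ (-(γ * l)) ≤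
          c₁ * ‖t - y.1‖ₑ ^ ((n : ℝ) - γ * l) := by
        simp_rw [enorm_sub_rev _ y.2]
        exact hker _ _ hy
      calc _ ≤ c₁ * ‖t - y.1‖ₑ ^ ((n : ℝ) - γ * l) * F y ^ κ * ‖t - y.1‖ₑ ^ e := by gcongr
        _ = c₁ * (F y ^ κ * (‖t - y.1‖ₑ ^ ((n : ℝ) - γ * l) * ‖t - y.1‖ₑ ^ e)) := by ring
        _ = _ := by rw [hwe _ h0 h1]
    · exact (((mK.pow_const _).mul ((mF.comp measurable_snd).pow_const _)).mul
        ((mW.comp measurable_snd).pow_const _)).aemeasurable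
  have hpt : ∀ z, (∫⁻ y, (‖t - y.1‖ₑ + ‖z - y.2‖ₑ) ^ (-γ) * F y) ^ s ≤
      A z * (B ^ (s / κ - 1) * (c₁ * c₂) ^ (s * (1 - 1 / κ))) := by
    intro z
    have e1 : ∫⁻ y, (‖t - y.1‖ₑ + ‖z - y.2‖ₑ) ^ (-γ) * F y =
        ∫⁻ y, (‖t - y.1‖ₑ + ‖z - y.2‖ₑ) ^ (-γ) * F y ∂μ := by
      rw [hμ', ← lintegral_indicator (mI.prod MeasurableSet.univ)]
      refine lintegral_congr fun y => ?_
      by_cases hy : y.1 ∈ I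
      · rw [indicator_of_mem (show y ∈ I ×ˢ univ from ⟨hy, mem_univ _⟩)]
      · rw [indicator_of_notMem fun h => hy h.1, hF y (not_le.1 hy), mul_zero]
    have e2 : ∫⁻ y, (‖t - y.1‖ₑ + ‖z - y.2‖ₑ) ^ (-γ) * F y ∂μ ≤
        A z ^ (1 / s) * B ^ (1 / κ - 1 / s) * (c₁ * c₂) ^ (1 - 1 / κ) := by
      have hH := ENNReal.lintegral_prod_norm_pow_le (μ := μ) (Finset.univ : Finset (Fin 3))
        (f := ![fun y => (‖t - y.1‖ₑ + ‖z - y.2‖ₑ) ^ (-(γ * l)) * F y ^ κ * ‖t - y.1‖ₑ ^ e,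
          fun y => F y ^ κ * ‖t - y.1‖ₑ ^ (-1 + δ),
          fun y => (‖t - y.1‖ₑ + ‖z - y.2‖ₑ) ^ (-(γ * l)) * ‖t - y.1‖ₑ ^ e])
        (p := ![1 / s, 1 / κ - 1 / s, 1 - 1 / κ]) (by
          intro i _
          fin_cases i
          · exact ((((mKz z).pow_const _).mul (mF.pow_const _)).mul (mW.pow_const _)).aemeasurable
          · exact ((mF.pow_const _).mul (mW.pow_const _)).aemeasurable
          · exact (((mKz z).pow_const _).mul (mW.pow_const _)).aemeasurable)
        (by simp [Fin.sum_univ_three]) (by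
          intro i _
          fin_cases i
          · exact (by positivity : 0 ≤ 1 / s)
          · exact hβ
          · exact hθ)
      simp only [Fin.prod_univ_three, Matrix.cons_val_zero, Matrix.cons_val_one,
        Matrix.cons_val_two, Matrix.head_cons, Matrix.tail_cons] at hH
      refine (lintegral_mono_ae ?_).trans (hH.trans ?_)
      · filter_upwards [hneμ] with y hy
        have h0 : ‖t - y.1‖ₑ ≠ 0 := by simpa using hy
        have h1 : ‖t - y.1‖ₑ ≠ ⊤ := enorm_ne_top
        set W := ‖t - y.1‖ₑ
        set K := W + ‖z - y.2‖ₑ with hK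
        have hK0 : K ≠ 0 := by simp [hK, h0]
        have hK1 : K ≠ ⊤ := ENNReal.add_ne_top.2 ⟨h1, enorm_ne_top⟩
        have hs' : 0 ≤ 1 / s := by positivity
        simp only [ENNReal.mul_rpow_of_nonneg _ _ hs', ENNReal.mul_rpow_of_nonneg _ _ hβ,
          ENNReal.mul_rpow_of_nonneg _ _ hθ, ← ENNReal.rpow_mul]
        have k1 : K ^ (-γ) = K ^ (-(γ * l) * (1 / s)) * K ^ (-(γ * l) * (1 - 1 / κ)) := by
          rw [← ENNReal.rpow_add _ _ hK0 hK1]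
          congr 1
          linear_combination γ * hldef
        have k2 : F y = F y ^ (κ * (1 / s)) * F y ^ (κ * (1 / κ - 1 / s)) := by
          rw [← ENNReal.rpow_add_of_nonneg _ _ (by positivity) (by positivity)]
          have : κ * (1 / s) + κ * (1 / κ - 1 / s) = 1 := by field_simp; ring
          rw [this, ENNReal.rpow_one]
        have k3 : (1 : ENNReal) = W ^ (e * (1 / s)) * W ^ ((-1 + δ) * (1 / κ - 1 / s)) *
            W ^ (e * (1 - 1 / κ)) := by
          rw [← ENNReal.rpow_add _ _ h0 h1, ← ENNReal.rpow_add _ _ h0 h1]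
          have : e * (1 / s) + (-1 + δ) * (1 / κ - 1 / s) + e * (1 - 1 / κ) = 0 := by
            rw [he]
            linear_combination (1 - δ) * hldef
          rw [this, ENNReal.rpow_zero]
        calc K ^ (-γ) * F y = K ^ (-(γ * l) * (1 / s)) * K ^ (-(γ * l) * (1 - 1 / κ)) *
              (F y ^ (κ * (1 / s)) * F y ^ (κ * (1 / κ - 1 / s))) * 1 := by
              rw [← k1, ← k2, mul_one]
          _ ≤ _ := by
              rw [k3]
              exact le_of_eq (by ring)
      · gcongr
        exact hC z
    rw [e1]
    calc _ ≤ (A z ^ (1 / s) * B ^ (1 / κ - 1 / s) * (c₁ * c₂) ^ (1 - 1 / κ)) ^ s := by gcongr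
      _ = _ := by
        rw [ENNReal.mul_rpow_of_nonneg _ _ hs0.le, ENNReal.mul_rpow_of_nonneg _ _ hs0.le,
          ← ENNReal.rpow_mul, ← ENNReal.rpow_mul, ← ENNReal.rpow_mul]
        have i1 : 1 / s * s = 1 := by field_simp
        have i2 : (1 / κ - 1 / s) * s = s / κ - 1 := by field_simp
        rw [i1, i2, ENNReal.rpow_one, mul_comm (1 - 1 / κ) s, mul_assoc]
  have mA : Measurable A := by
    refine Measurable.lintegral_prod_right' (f := fun y : (Fin n → ℝ) × ℝ × (Fin n → ℝ) =>
      (‖t - y.2.1‖ₑ + ‖y.1 - y.2.2‖ₑ) ^ (-(γ * l)) * F y.2 ^ κ * ‖t - y.2.1‖ₑ ^ e) ?_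
    exact ((mK.pow_const _).mul ((mF.comp measurable_snd).pow_const _)).mul
        ((mW.comp measurable_snd).pow_const _)
  have hsκ : 1 ≤ s / κ := (one_le_div hκ0).2 hs
  calc _ ≤ ∫⁻ z, A z * (B ^ (s / κ - 1) * (c₁ * c₂) ^ (s * (1 - 1 / κ))) := lintegral_mono hpt
    _ = (∫⁻ z, A z) * (B ^ (s / κ - 1) * (c₁ * c₂) ^ (s * (1 - 1 / κ))) := lintegral_mul_const _ mA
    _ ≤ c₁ * B * (B ^ (s / κ - 1) * (c₁ * c₂) ^ (s * (1 - 1 / κ))) := by gcongr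
    _ = c₁ * (c₁ * c₂) ^ (s * (1 - 1 / κ)) * (B ^ (1 : ℝ) * B ^ (s / κ - 1)) := by
        rw [ENNReal.rpow_one]; ring
    _ = c₁ * (c₁ * c₂) ^ (s * (1 - 1 / κ)) * B ^ (s / κ) := by
        rw [← ENNReal.rpow_add_of_nonneg _ _ zero_le_one (by linarith), add_sub_cancel]
    _ ≤ _ := by
        gcongr
        exact lintegral_mono' hle le_rfl

end SliceKernel

section Slices

variable {n : ℕ}

lemma slicePoint_succAbove (i : Fin (n + 1)) (t : ℝ) (y : Fin n → ℝ) (j : Fin n) :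
    slicePoint i t y (i.succAbove j) = y j := by
  simp [slicePoint]

lemma measurable_slicePoint_prod (i : Fin (n + 1)) :
    Measurable fun w : ℝ × (Fin n → ℝ) => slicePoint i w.1 w.2 :=
  ((MeasurableEquiv.toLp 2 (Fin (n + 1) → ℝ)).measurable).comp
    (MeasurableEquiv.piFinSuccAbove (fun _ : Fin (n + 1) => ℝ) i).symm.measurable

lemma lintegral_eq_lintegral_slicePoint (i : Fin (n + 1)) {h : Euc (n + 1) → ENNReal}
    (mh : Measurable h) :
    ∫⁻ y, h y = ∫⁻ w : ℝ × (Fin n → ℝ), h (slicePoint i w.1 w.2) := by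
  have h1 := (EuclideanSpace.volume_preserving_symm_measurableEquiv_toLp (Fin (n + 1))).symm
  have h2 := (volume_preserving_piFinSuccAbove (fun _ : Fin (n + 1) => ℝ) i).symm
  have h3 := h1.comp h2
  exact (h3.lintegral_comp mh).symm

lemma norm_sub_slicePoint_ge (i : Fin (n + 1)) (t τ : ℝ) (z ζ : Fin n → ℝ) :
    |t - τ| + ‖z - ζ‖ ≤ 2 * ‖slicePoint i τ ζ - slicePoint i t z‖ := by
  have hc : ∀ j, |slicePoint i τ ζ j - slicePoint i t z j| ≤
      ‖slicePoint i τ ζ - slicePoint i t z‖ := fun j => by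
    simpa using PiLp.norm_apply_le (slicePoint i τ ζ - slicePoint i t z) j
  have h1 : |t - τ| ≤ ‖slicePoint i τ ζ - slicePoint i t z‖ := by
    have := hc i
    rwa [slicePoint_apply_same, slicePoint_apply_same, abs_sub_comm] at this
  have h2 : ‖z - ζ‖ ≤ ‖slicePoint i τ ζ - slicePoint i t z‖ := by
    rw [pi_norm_le_iff_of_nonneg (norm_nonneg _)]
    intro j
    have := hc (i.succAbove j)
    rw [slicePoint_succAbove, slicePoint_succAbove, abs_sub_comm] at this
    simpa using this
  linarith

/-- The Riesz-type potential of order `γ` of a nonnegative density. -/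
def rieszPot (γ : ℝ) (h : Euc n → ENNReal) (x : Euc n) : ENNReal :=
  ∫⁻ y, h y * ENNReal.ofReal (‖y - x‖ ^ (-γ))

lemma rieszPot_slicePoint_le {γ : ℝ} (hγ : 0 < γ) (i : Fin (n + 1)) {h : Euc (n + 1) → ENNReal}
    (mh : Measurable h) (t : ℝ) (z : Fin n → ℝ) :
    rieszPot γ h (slicePoint i t z) ≤ ENNReal.ofReal (2 ^ γ) *
      ∫⁻ w : ℝ × (Fin n → ℝ), (‖t - w.1‖ₑ + ‖z - w.2‖ₑ) ^ (-γ) * h (slicePoint i w.1 w.2) := by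
  have m1 : Measurable fun y : Euc (n + 1) =>
      h y * ENNReal.ofReal (‖y - slicePoint i t z‖ ^ (-γ)) :=
    mh.mul (((measurable_id.sub_const _).norm.pow_const _).ennreal_ofReal)
  rw [rieszPot, lintegral_eq_lintegral_slicePoint i m1,
    ← lintegral_const_mul' _ _ ENNReal.ofReal_ne_top]
  refine lintegral_mono fun w => ?_
  have hge := norm_sub_slicePoint_ge i t w.1 z w.2
  set X := ‖slicePoint i w.1 w.2 - slicePoint i t z‖ with hX
  have hX0 : 0 ≤ X := norm_nonneg _
  have hsum : ‖t - w.1‖ₑ + ‖z - w.2‖ₑ = ENNReal.ofReal (|t - w.1| + ‖z - w.2‖) := by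
    rw [ENNReal.ofReal_add (abs_nonneg _) (norm_nonneg _), Real.enorm_eq_ofReal_abs, ofReal_norm]
  have key : ENNReal.ofReal (X ^ (-γ)) ≤
      ENNReal.ofReal (2 ^ γ) * (‖t - w.1‖ₑ + ‖z - w.2‖ₑ) ^ (-γ) := by
    rcases hX0.eq_or_lt with h0 | h0
    · rw [← h0, Real.zero_rpow (by linarith)]
      simp
    · rcases (add_nonneg (abs_nonneg (t - w.1)) (norm_nonneg (z - w.2))).eq_or_lt with h1 | h1
      · rw [hsum, ← h1, ENNReal.ofReal_zero, ENNReal.zero_rpow_of_neg (by linarith),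
          ENNReal.mul_top (by simp; positivity)]
        exact le_top
      · rw [hsum, ENNReal.ofReal_rpow_of_pos h1, ← ENNReal.ofReal_mul (by positivity)]
        apply ENNReal.ofReal_le_ofReal
        rw [Real.rpow_neg hX0, Real.rpow_neg h1.le, ← div_eq_mul_inv, inv_eq_one_div,
          div_le_div_iff₀ (by positivity) (by positivity), one_mul,
          ← Real.mul_rpow (by norm_num) hX0]
        exact Real.rpow_le_rpow h1.le hge hγ.le
  calc h (slicePoint i w.1 w.2) * ENNReal.ofReal (X ^ (-γ))
      ≤ h (slicePoint i w.1 w.2) *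
        (ENNReal.ofReal (2 ^ γ) * (‖t - w.1‖ₑ + ‖z - w.2‖ₑ) ^ (-γ)) := by gcongr
    _ = _ := by ring

lemma exists_lintegral_rieszPot_slice_le {γ κ s δ : ℝ} (L : ℝ) (hn : 0 < n) (hγ : 0 < γ)
    (hκ : 1 ≤ κ) (hs : κ ≤ s) (hδ : 0 < δ) (hδ1 : δ < 1)
    (hl : γ - 1 + δ = n * (1 / s + 1 - 1 / κ)) :
    ∃ C : ENNReal, C ≠ ⊤ ∧ ∀ (i : Fin (n + 1)) (t : ℝ) (h : Euc (n + 1) → ENNReal), Measurable h →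
      (∀ y, L < |t - y i| → h y = 0) →
      ∫⁻ z, rieszPot γ h (slicePoint i t z) ^ s ≤
        C * (∫⁻ y, h y ^ κ * ‖t - y i‖ₑ ^ (-1 + δ)) ^ (s / κ) := by
  obtain ⟨C, hC, H⟩ := exists_lintegral_slice_rpow_le L hn hκ hs hδ hδ1 hl
  have hs0 : 0 ≤ s := by linarith
  refine ⟨ENNReal.ofReal (2 ^ γ) ^ s * C,
    ENNReal.mul_ne_top (ENNReal.rpow_ne_top_of_nonneg hs0 ENNReal.ofReal_ne_top) hC,
    fun i t h mh hh => ?_⟩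
  have H' := H t (fun w => h (slicePoint i w.1 w.2)) (mh.comp (measurable_slicePoint_prod i))
    (fun w hw => hh _ (by rwa [slicePoint_apply_same]))
  have mi : Measurable fun y : Euc (n + 1) => h y ^ κ * ‖t - y i‖ₑ ^ (-1 + δ) :=
    (mh.pow_const _).mul ((measurable_const.sub (by fun_prop)).enorm.pow_const _)
  have e1 := lintegral_eq_lintegral_slicePoint i mi
  simp only [slicePoint_apply_same] at e1
  rw [e1, mul_assoc]
  refine le_trans ?_ (mul_le_mul_right H' _)
  rw [← lintegral_const_mul' _ _ (ENNReal.rpow_ne_top_of_nonneg hs0 ENNReal.ofReal_ne_top)]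
  refine lintegral_mono fun z => ?_
  rw [← ENNReal.mul_rpow_of_nonneg _ _ hs0]
  exact ENNReal.rpow_le_rpow (rieszPot_slicePoint_le hγ i mh t z) hs0

lemma exists_lintegral_Icc_enorm_sub_le {δ : ℝ} (hδ : 0 < δ) (hδ1 : δ < 1) :
    ∃ c : ENNReal, c ≠ ⊤ ∧ ∀ t : ℝ, ∫⁻ r in Icc (1 : ℝ) 2, ‖t - r‖ₑ ^ (-1 + δ) ≤ c := by
  obtain ⟨c, hc, h⟩ := exists_lintegral_enorm_sub_rpow_le 1 (e := -1 + δ) (by linarith)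
  refine ⟨c + 1, by simpa using hc, fun t => ?_⟩
  have mS : MeasurableSet {τ : ℝ | |t - τ| ≤ 1} :=
    measurableSet_le (by fun_prop) measurable_const
  calc ∫⁻ r in Icc (1 : ℝ) 2, ‖t - r‖ₑ ^ (-1 + δ)
      ≤ ∫⁻ r in Icc (1 : ℝ) 2, (indicator {τ : ℝ | |t - τ| ≤ 1}
          (fun r => ‖t - r‖ₑ ^ (-1 + δ)) r + 1) := by
        refine lintegral_mono fun r => ?_
        by_cases hr : r ∈ {τ : ℝ | |t - τ| ≤ 1}
        · rw [indicator_of_mem hr]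
          exact le_self_add
        · rw [indicator_of_notMem hr, zero_add]
          have hr' : 1 ≤ |t - r| := (not_le.1 hr).le
          refine ENNReal.rpow_le_one_of_one_le_of_neg ?_ (by linarith)
          rw [Real.enorm_eq_ofReal_abs]
          exact ENNReal.one_le_ofReal.2 hr'
    _ = (∫⁻ r in Icc (1 : ℝ) 2, indicator {τ : ℝ | |t - τ| ≤ 1}
          (fun r => ‖t - r‖ₑ ^ (-1 + δ)) r) + 1 := by
        rw [lintegral_add_right _ measurable_const]
        norm_num
    _ ≤ c + 1 := by
        gcongr
        refine (lintegral_mono' Measure.restrict_le_self le_rfl).trans ?_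
        rw [lintegral_indicator mS]
        exact h t

/-- A good coordinate cube: one can pick its side so that finitely many densities have controlled
fractional traces on every face. -/
lemma exists_good_cube {K : Type*} [Fintype K] {δ : ℝ} (hδ : 0 < δ) (hδ1 : δ < 1) :
    ∃ C : ENNReal, C ≠ ⊤ ∧ ∀ (H : K → Euc n → ENNReal) (A : K → ENNReal),
      (∀ k, Measurable (H k)) → (∀ k, A k ≠ 0) → (∀ k, A k ≠ ⊤) → (∀ k, ∫⁻ y, H k y ≤ A k) →
      ∃ r : ℝ, 1 ≤ r ∧ r ≤ 2 ∧ ∀ k i,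
        ∫⁻ y, H k y * ‖r - y i‖ₑ ^ (-1 + δ) ≤ C * A k ∧
        ∫⁻ y, H k y * ‖-r - y i‖ₑ ^ (-1 + δ) ≤ C * A k := by
  obtain ⟨c, hc, hline⟩ := exists_lintegral_Icc_enorm_sub_le hδ hδ1
  refine ⟨∑ _k : K, ∑ _i : Fin n, (c + c), ?_, fun H A mH hA0 hA1 hHA => ?_⟩
  · simp [ENNReal.mul_ne_top, hc]
  have hf : ∀ t s : ℝ, ‖-t - s‖ₑ = ‖-s - t‖ₑ := fun t s => by
    rw [show -t - s = -s - t by ring]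
  have mk : ∀ (k : K) (i : Fin n), Measurable fun w : ℝ × Euc n =>
      H k w.2 * ‖w.1 - w.2 i‖ₑ ^ (-1 + δ) := fun k i =>
    ((mH k).comp measurable_snd).mul
      ((measurable_fst.sub (by fun_prop)).enorm.pow_const _)
  have mk' : ∀ (k : K) (i : Fin n), Measurable fun w : ℝ × Euc n =>
      H k w.2 * ‖-w.1 - w.2 i‖ₑ ^ (-1 + δ) := fun k i =>
    ((mH k).comp measurable_snd).mul
      ((measurable_fst.neg.sub (by fun_prop)).enorm.pow_const _)
  set P : K → Fin n → ℝ → ENNReal := fun k i r => ∫⁻ y, H k y * ‖r - y i‖ₑ ^ (-1 + δ) with hP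
  set M : K → Fin n → ℝ → ENNReal := fun k i r => ∫⁻ y, H k y * ‖-r - y i‖ₑ ^ (-1 + δ) with hM
  have mP : ∀ k i, Measurable (P k i) := fun k i => (mk k i).lintegral_prod_right'
  have mM : ∀ k i, Measurable (M k i) := fun k i => (mk' k i).lintegral_prod_right'
  have iP : ∀ k i, ∫⁻ r in Icc (1 : ℝ) 2, P k i r ≤ c * A k := fun k i => by
    rw [hP, lintegral_lintegral_swap (mk k i).aemeasurable]
    calc _ ≤ ∫⁻ y, c * H k y := by
          refine lintegral_mono fun y => ?_
          have m1 : Measurable fun r : ℝ => ‖r - y i‖ₑ ^ (-1 + δ) := by fun_prop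
          rw [lintegral_const_mul _ m1, mul_comm]
          refine mul_le_mul_left ?_ _
          simp_rw [enorm_sub_rev _ (y i)]
          exact hline (y i)
      _ ≤ _ := by
          rw [lintegral_const_mul' _ _ hc]
          exact mul_le_mul_right (hHA k) _
  have iM : ∀ k i, ∫⁻ r in Icc (1 : ℝ) 2, M k i r ≤ c * A k := fun k i => by
    rw [hM, lintegral_lintegral_swap (mk' k i).aemeasurable]
    calc _ ≤ ∫⁻ y, c * H k y := by
          refine lintegral_mono fun y => ?_
          have m1 : Measurable fun r : ℝ => ‖-r - y i‖ₑ ^ (-1 + δ) := by fun_prop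
          rw [lintegral_const_mul _ m1, mul_comm]
          refine mul_le_mul_left ?_ _
          simp_rw [hf _ (y i)]
          exact hline (-y i)
      _ ≤ _ := by
          rw [lintegral_const_mul' _ _ hc]
          exact mul_le_mul_right (hHA k) _
  set G : ℝ → ENNReal := fun r => ∑ k, ∑ i, (P k i r + M k i r) / A k with hG
  have mS : ∀ k i, Measurable fun r => (P k i r + M k i r) / A k := fun k i =>
    ((mP k i).add (mM k i)).div_const _
  have mG : Measurable G :=
    Finset.measurable_fun_sum _ fun k _ => Finset.measurable_fun_sum _ fun i _ => mS k i
  have iG : ∫⁻ r in Icc (1 : ℝ) 2, G r ≤ ∑ _k : K, ∑ _i : Fin n, (c + c) := by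
    simp only [hG]
    rw [lintegral_finsetSum _ fun k _ => Finset.measurable_fun_sum _ fun i _ => mS k i]
    refine Finset.sum_le_sum fun k _ => ?_
    rw [lintegral_finsetSum _ fun i _ => mS k i]
    refine Finset.sum_le_sum fun i _ => ?_
    simp_rw [div_eq_mul_inv]
    rw [lintegral_mul_const' _ _ (ENNReal.inv_ne_top.2 (hA0 k)), lintegral_add_left (mP k i)]
    calc _ ≤ (c * A k + c * A k) * (A k)⁻¹ := by
          gcongr
          · exact iP k i
          · exact iM k i
      _ = (c + c) * (A k * (A k)⁻¹) := by ring
      _ = c + c := by rw [ENNReal.mul_inv_cancel (hA0 k) (hA1 k), mul_one]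
  obtain ⟨r, hr, hle⟩ := exists_le_setLAverage (μ := volume) (s := Icc (1 : ℝ) 2) (f := G)
    (by norm_num) (by norm_num) mG.aemeasurable
  rw [setLAverage_eq] at hle
  have hG1 : G r ≤ ∑ _k : K, ∑ _i : Fin n, (c + c) := by
    refine hle.trans (le_trans (le_of_eq ?_) iG)
    norm_num
  refine ⟨r, hr.1, hr.2, fun k i => ?_⟩
  have h1 : (P k i r + M k i r) / A k ≤ ∑ _k : K, ∑ _i : Fin n, (c + c) := by
    refine le_trans ?_ hG1
    refine le_trans ?_ (Finset.single_le_sum (f := fun k => ∑ i, (P k i r + M k i r) / A k)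
      (fun _ _ => zero_le) (Finset.mem_univ k))
    exact Finset.single_le_sum (f := fun i => (P k i r + M k i r) / A k)
      (fun _ _ => zero_le) (Finset.mem_univ i)
  rw [ENNReal.div_le_iff (hA0 k) (hA1 k)] at h1
  exact ⟨le_self_add.trans h1, le_add_self.trans h1⟩

end Slices

section Exponents

lemma exists_exponents {d p q : ℝ} (hd : 2 ≤ d) (hp : 0 < p) (hq : 0 < q) (hpq : 1 < p * q)
    (hα : d - 2 < 2 * (p + 1) / (p * q - 1)) :
    ∃ δ cu cv : ℝ, 0 < δ ∧ δ < 1 ∧ δ ≤ 2 / (p + 1) ∧ 0 ≤ cu ∧ cu ≤ 1 / (p + 1) ∧ 0 ≤ cv ∧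
      cv ≤ 1 / (q + 1) ∧ cu + cv = 1 - 2 / d + 2 * δ / d ∧ 0 < cv - δ / d ∧
      p * cu + q * cv < 1 ∧ p * cu < cv - δ / d := by
  have hd0 : 0 < d := by linarith
  set Q := 1 / (q + 1) with hQ
  set w := 1 - 2 / d with hw
  have hQ0 : 0 < Q := by positivity
  have hQ1 : Q + q * Q = 1 := by rw [hQ]; field_simp; ring
  have hw0 : 0 ≤ w := by
    rw [hw, sub_nonneg, div_le_one hd0]; exact hd
  have hG : 0 < (p + 1) * Q - p * w := by
    rw [lt_div_iff₀ (by linarith)] at hα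
    have : (p + 1) * Q - p * w = ((p + 1) * d - p * (d - 2) * (q + 1)) / ((q + 1) * d) := by
      rw [hQ, hw]; field_simp
    rw [this]
    apply div_pos _ (by positivity)
    nlinarith
  set ε := min (Q / 2) (min (((p + 1) * Q - p * w) / (2 * (2 * p + 1)))
    (min (1 / (2 * d)) (2 / (p + 1) / d))) with hε
  have hε0 : 0 < ε := by
    refine lt_min (by positivity) (lt_min (by positivity) (lt_min (by positivity) (by positivity)))
  have h1 : ε ≤ Q / 2 := min_le_left _ _
  have h2 : ε ≤ ((p + 1) * Q - p * w) / (2 * (2 * p + 1)) :=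
    (min_le_right _ _).trans (min_le_left _ _)
  have h3 : ε ≤ 1 / (2 * d) := (min_le_right _ _).trans ((min_le_right _ _).trans (min_le_left _ _))
  have h4 : ε ≤ 2 / (p + 1) / d :=
    (min_le_right _ _).trans ((min_le_right _ _).trans (min_le_right _ _))
  rw [le_div_iff₀ (by positivity)] at h2 h3 h4
  have e1 : 2 * (ε * d) / d = 2 * ε := by field_simp
  have e2 : ε * d / d = ε := by field_simp
  rcases le_or_gt (w + 2 * ε) Q with hm | hm
  · refine ⟨ε * d, 0, w + 2 * ε, by positivity, by linarith, h4, le_rfl, by positivity,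
      by positivity, hm, by rw [e1]; ring, by rw [e2]; linarith, ?_, by rw [e2]; linarith⟩
    have := mul_le_mul_of_nonneg_left hm hq.le
    linarith
  · have hk : p * (w + 2 * ε - Q) < Q - ε := by nlinarith
    refine ⟨ε * d, w + 2 * ε - Q, Q, by positivity, by linarith, h4, by linarith, ?_, hQ0.le, le_rfl,
      by rw [e1]; ring, by rw [e2]; linarith, by linarith, by rw [e2]; exact hk⟩
    have hk' : p * (w + 2 * ε - Q) ≤ Q := by linarith
    have : Q ≤ p * (1 / (p + 1)) := by
      rw [hQ, mul_one_div, div_le_div_iff₀ (by positivity) (by positivity)]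
      nlinarith
    exact le_of_mul_le_mul_left (hk'.trans this) hp

end Exponents

section Interpolation

variable {α : Type*} [MeasurableSpace α] {μ : Measure α}

lemma rpow_le_rpow_mul_add_rpow_mul {x S : ENNReal} (hx : x ≠ ⊤) {κ k : ℝ}
    (h1 : 1 ≤ κ) (hk : κ ≤ k) : x ^ κ ≤ S ^ (κ - 1) * x + S ^ (κ - k) * x ^ k := by
  rcases le_or_gt x S with h | h
  · refine le_trans ?_ le_self_add
    calc x ^ κ = x ^ (κ - 1) * x ^ (1 : ℝ) := by
          rw [← ENNReal.rpow_add_of_nonneg _ _ (by linarith) zero_le_one, sub_add_cancel]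
      _ ≤ S ^ (κ - 1) * x := by
          rw [ENNReal.rpow_one]
          gcongr
  · refine le_trans ?_ le_add_self
    have hx0 : x ≠ 0 := (lt_of_le_of_lt zero_le h).ne'
    calc x ^ κ = x ^ (κ - k) * x ^ k := by
          rw [← ENNReal.rpow_add _ _ hx0 hx, sub_add_cancel]
      _ ≤ S ^ (κ - k) * x ^ k := by
          refine mul_le_mul_left ?_ _
          rw [← neg_sub k κ, ENNReal.rpow_neg, ENNReal.rpow_neg, ENNReal.inv_le_inv]
          exact ENNReal.rpow_le_rpow h.le (by linarith)

/-- Interpolation between an `L¹` bound and a weighted `L^k` bound. -/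
lemma lintegral_rpow_le_of_interpolation {F e : α → ENNReal} (mF : Measurable F) {κ k p : ℝ}
    (h1 : 1 ≤ κ) (hk : κ ≤ k) (hpk : p * (k - 1) = 1) {T c c' : ENNReal} (hT : 1 ≤ T) (hT1 : T ≠ ⊤)
    (hF : ∀ x, F x ≠ ⊤) (hc : ∫⁻ x, F x ∂μ ≤ c) (hc' : c' ≠ ⊤) (he : ∀ x, F x ^ k ≤ c' * e x)
    (hT2 : ∫⁻ x, e x ∂μ ≤ T) :
    ∫⁻ x, F x ^ κ ∂μ ≤ (c + c') * T ^ (p * (κ - 1)) := by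
  have hT0 : T ≠ 0 := (zero_lt_one.trans_le hT).ne'
  have hS0 : T ^ p ≠ 0 := by simp [ENNReal.rpow_eq_zero_iff, hT0, hT1]
  have hS1 : T ^ p ≠ ⊤ := ENNReal.rpow_ne_top_of_ne_zero hT0 hT1
  have m1 : Measurable fun x => (T ^ p) ^ (κ - 1) * F x := mF.const_mul _
  calc ∫⁻ x, F x ^ κ ∂μ
      ≤ ∫⁻ x, ((T ^ p) ^ (κ - 1) * F x + (T ^ p) ^ (κ - k) * F x ^ k) ∂μ :=
        lintegral_mono fun x => rpow_le_rpow_mul_add_rpow_mul (hF x) h1 hk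
    _ = (T ^ p) ^ (κ - 1) * (∫⁻ x, F x ∂μ) + (T ^ p) ^ (κ - k) * ∫⁻ x, F x ^ k ∂μ := by
        rw [lintegral_add_left m1, lintegral_const_mul _ mF,
          lintegral_const_mul _ (mF.pow_const _)]
    _ ≤ (T ^ p) ^ (κ - 1) * c + (T ^ p) ^ (κ - k) * (c' * T) := by
        gcongr
        refine (lintegral_mono he).trans ?_
        rw [lintegral_const_mul' _ _ hc']
        gcongr
    _ = _ := by
        have : (T ^ p) ^ (κ - k) * T = T ^ (p * (κ - 1)) := by
          nth_rewrite 2 [← ENNReal.rpow_one T]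
          rw [← ENNReal.rpow_mul, ← ENNReal.rpow_add _ _ hT0 hT1]
          congr 1
          linear_combination -hpk
        rw [mul_left_comm, this, ← ENNReal.rpow_mul]
        ring

end Interpolation

section Faces

variable {n : ℕ}

lemma exists_lintegral_face_le {γ κ s δ θ ρ : ℝ} {C' : ENNReal} (hC' : C' ≠ ⊤) (hn : 0 < n)
    (hγ : 0 < γ) (hκ : 1 ≤ κ) (hs : κ ≤ s) (hδ : 0 < δ) (hδ1 : δ < 1)
    (hl : γ - 1 + δ = n * (1 / s + 1 - 1 / κ)) (hθ : 0 ≤ θ) :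
    ∃ C : ENNReal, C ≠ ⊤ ∧ ∀ (T : ENNReal) (i : Fin (n + 1)) (t r : ℝ) (h : Euc (n + 1) → ENNReal),
      1 ≤ T → |t| ≤ 2 → 0 ≤ r → r ≤ 2 → Measurable h → (∀ y, ρ < ‖y‖ → h y = 0) →
      ∫⁻ y, h y ^ κ * ‖t - y i‖ₑ ^ (-1 + δ) ≤ C' * T ^ (θ * κ) →
      ∫⁻ z in cube n r, (1 + rieszPot γ h (slicePoint i t z)) ^ s ≤ C * T ^ (θ * s) := by
  obtain ⟨C, hC, H⟩ := exists_lintegral_rieszPot_slice_le (ρ + 2) hn hγ hκ hs hδ hδ1 hl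
  have hs1 : 1 ≤ s := hκ.trans hs
  have hs0 : 0 < s := by linarith
  have hκ0 : 0 < κ := by linarith
  have h2 : (2 : ENNReal) ^ (s - 1) ≠ ⊤ := ENNReal.rpow_ne_top_of_nonneg (by linarith) (by simp)
  obtain ⟨m, rfl⟩ : ∃ m, n = m + 1 := ⟨n - 1, by omega⟩
  refine ⟨2 ^ (s - 1) * (ENNReal.ofReal (4 ^ (m + 1)) + C * C' ^ (s / κ)), ENNReal.mul_ne_top h2
    (ENNReal.add_ne_top.2 ⟨ENNReal.ofReal_ne_top, ENNReal.mul_ne_top hC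
      (ENNReal.rpow_ne_top_of_nonneg (by positivity) hC')⟩),
    fun T i t r h hT ht hr0 hr mh hsupp hh => ?_⟩
  have h1 := H i t h mh fun y hy => hsupp y (by
    have e1 : |y i| ≤ ‖y‖ := by simpa using PiLp.norm_apply_le y i
    have e2 := abs_sub t (y i)
    linarith)
  calc ∫⁻ z in cube (m + 1) r, (1 + rieszPot γ h (slicePoint i t z)) ^ s
      ≤ ∫⁻ z in cube (m + 1) r, 2 ^ (s - 1) *
        (1 + rieszPot γ h (slicePoint i t z) ^ s) := by
        refine lintegral_mono fun z => ?_
        simpa using ENNReal.rpow_add_le_mul_rpow_add_rpow 1 (rieszPot γ h (slicePoint i t z)) hs1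
    _ ≤ 2 ^ (s - 1) * (ENNReal.ofReal (4 ^ (m + 1)) +
          C * (C' * T ^ (θ * κ)) ^ (s / κ)) := by
        rw [lintegral_const_mul' _ _ h2, lintegral_add_left measurable_const]
        gcongr
        · rw [lintegral_const, one_mul, Measure.restrict_apply_univ, volume_cube_le hr0]
          apply ENNReal.ofReal_le_ofReal
          gcongr
          linarith
        · exact (setLIntegral_le_lintegral _ _).trans (h1.trans (by gcongr))
    _ = 2 ^ (s - 1) * (ENNReal.ofReal (4 ^ (m + 1)) * 1 +
          C * C' ^ (s / κ) * T ^ (θ * s)) := by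
        have : θ * κ * (s / κ) = θ * s := by field_simp
        rw [ENNReal.mul_rpow_of_nonneg _ _ (by positivity), ← ENNReal.rpow_mul, this, mul_one,
          mul_assoc]
    _ ≤ 2 ^ (s - 1) * (ENNReal.ofReal (4 ^ (m + 1)) * T ^ (θ * s) +
          C * C' ^ (s / κ) * T ^ (θ * s)) := by
        gcongr
        simpa using ENNReal.rpow_le_rpow_of_exponent_le hT (show 0 ≤ θ * s by positivity)
    _ = _ := by ring

end Faces

section AnnularDensity

variable {n : ℕ}

/-- The density `|x|^a v^p` cut off to the annulus `1/2 ≤ |x| ≤ ρ`. -/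
def annularDensity (ρ a p : ℝ) (v : Euc n → ℝ) : Euc n → ENNReal :=
  indicator {y | 1 / 2 ≤ ‖y‖ ∧ ‖y‖ ≤ ρ} fun y => ENNReal.ofReal (‖y‖ ^ a * v y ^ p)

lemma measurableSet_annulus (ρ : ℝ) : MeasurableSet {y : Euc n | 1 / 2 ≤ ‖y‖ ∧ ‖y‖ ≤ ρ} :=
  (measurableSet_le measurable_const measurable_norm).inter
    (measurableSet_le measurable_norm measurable_const)

lemma measurable_annularDensity {ρ a p : ℝ} {v : Euc n → ℝ} (hv : Continuous v) :
    Measurable (annularDensity ρ a p v) :=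
  (((measurable_norm.pow_const _).mul (hv.measurable.pow_const _)).ennreal_ofReal).indicator
    (measurableSet_annulus ρ)

lemma annularDensity_eq_zero {ρ a p : ℝ} {v : Euc n → ℝ} {y : Euc n} (hy : ρ < ‖y‖) :
    annularDensity ρ a p v y = 0 :=
  indicator_of_notMem (fun h => absurd h.2 (not_le.2 hy)) _

lemma annularDensity_ne_top {ρ a p : ℝ} {v : Euc n → ℝ} (y : Euc n) :
    annularDensity ρ a p v y ≠ ⊤ := by
  unfold annularDensity
  by_cases hy : y ∈ {y : Euc n | 1 / 2 ≤ ‖y‖ ∧ ‖y‖ ≤ ρ}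
  · rw [indicator_of_mem hy]; exact ENNReal.ofReal_ne_top
  · rw [indicator_of_notMem hy]; exact ENNReal.zero_ne_top

lemma rieszPot_annularDensity {γ ρ a p : ℝ} {v : Euc n → ℝ} (x : Euc n) :
    rieszPot γ (annularDensity ρ a p v) x = ∫⁻ y in {y : Euc n | 1 / 2 ≤ ‖y‖ ∧ ‖y‖ ≤ ρ},
      ENNReal.ofReal (‖y‖ ^ a * v y ^ p) * ENNReal.ofReal (‖y - x‖ ^ (-γ)) := by
  rw [rieszPot, ← lintegral_indicator (measurableSet_annulus ρ)]
  refine lintegral_congr fun y => ?_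
  unfold annularDensity
  by_cases hy : y ∈ {y : Euc n | 1 / 2 ≤ ‖y‖ ∧ ‖y‖ ≤ ρ}
  · rw [indicator_of_mem hy, indicator_of_mem hy]
  · rw [indicator_of_notMem hy, indicator_of_notMem hy, zero_mul]

lemma rieszPot_annularDensity_le {γ ρ a p : ℝ} (hγ : 0 < γ) {v : Euc n → ℝ} {x : Euc n}
    (hx : ‖x‖ ≤ ρ) : rieszPot γ (annularDensity ρ a p v) x ≤
      ENNReal.ofReal (2 * ρ) * rieszPot (γ + 1) (annularDensity ρ a p v) x := by
  rw [rieszPot, rieszPot, ← lintegral_const_mul' _ _ ENNReal.ofReal_ne_top]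
  refine lintegral_mono fun y => ?_
  rcases lt_or_ge ρ ‖y‖ with hy | hy
  · simp [annularDensity_eq_zero hy]
  rw [mul_left_comm, ← ENNReal.ofReal_mul (by linarith [norm_nonneg x])]
  refine mul_le_mul_right (ENNReal.ofReal_le_ofReal ?_) _
  rcases (norm_nonneg (y - x)).eq_or_lt with h0 | h0
  · rw [← h0, Real.zero_rpow (by linarith), Real.zero_rpow (by linarith), mul_zero]
  · have e : ‖y - x‖ ^ (-γ) = ‖y - x‖ * ‖y - x‖ ^ (-(γ + 1)) := by
      nth_rewrite 2 [← Real.rpow_one ‖y - x‖]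
      rw [← Real.rpow_add h0]
      congr 1
      ring
    rw [e]
    refine mul_le_mul_of_nonneg_right ?_ (by positivity)
    linarith [norm_sub_le y x]

lemma IsNonnegSol.exists_potential_bound (hn : 2 ≤ n) {p q a b : ℝ} (hp : 0 < p) (hq : 0 < q)
    (hpq : 1 < p * q) (ha : -2 < a) (hb : -2 < b) {ρ : ℝ} (hρ : 1 ≤ ρ) :
    ∃ C : ENNReal, C ≠ ⊤ ∧ ∀ u v : Euc (n + 1) → ℝ, IsNonnegSol p q a b u v →
      ∀ x, 1 ≤ ‖x‖ → ‖x‖ + 1 / 2 ≤ ρ →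
      ENNReal.ofReal (u x) ≤ C * (1 + rieszPot ((n : ℝ) - 1) (annularDensity ρ a p v) x) ∧
      ENNReal.ofReal (u x + ∑ j, |pd j u x|) ≤ C * (1 + rieszPot n (annularDensity ρ a p v) x) := by
  obtain ⟨C, hC, H⟩ := IsNonnegSol.exists_pointwise_bound (N := n + 1) (by omega) hp hq hpq ha hb
    (ρ := ρ) (by linarith)
  have hn' : (2 : ℝ) ≤ n := by exact_mod_cast hn
  set c := ENNReal.ofReal C with hc
  have hc1 : c ≠ ⊤ := ENNReal.ofReal_ne_top
  set d := ENNReal.ofReal (2 * ρ) with hd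
  have hd1 : 1 ≤ d := ENNReal.one_le_ofReal.2 (by linarith)
  refine ⟨c * d + ((n + 1 : ℕ) : ENNReal) * c, ENNReal.add_ne_top.2
    ⟨ENNReal.mul_ne_top hc1 ENNReal.ofReal_ne_top, ENNReal.mul_ne_top (by simp) hc1⟩,
    fun u v h x hx1 hx2 => ?_⟩
  obtain ⟨h1, h2⟩ := H u v h x hx1 hx2
  have e1 : (2 - ((n + 1 : ℕ) : ℝ)) = -((n : ℝ) - 1) := by push_cast; ring
  have e2 : (1 - ((n + 1 : ℕ) : ℝ)) = -(n : ℝ) := by push_cast; ring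
  rw [e1, ← rieszPot_annularDensity] at h1
  rw [e2] at h2
  simp only [← rieszPot_annularDensity] at h2
  have h3 := rieszPot_annularDensity_le (γ := (n : ℝ) - 1) (p := p) (a := a) (v := v) (by linarith)
    (show ‖x‖ ≤ ρ by linarith)
  rw [sub_add_cancel] at h3
  set U := rieszPot n (annularDensity ρ a p v) x
  have hcd : c ≤ c * d := by
    calc c = c * 1 := (mul_one c).symm
      _ ≤ c * d := by gcongr
  refine ⟨h1.trans (mul_le_mul_left (hcd.trans le_self_add) _), ?_⟩
  calc ENNReal.ofReal (u x + ∑ j, |pd j u x|)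
      = ENNReal.ofReal (u x) + ∑ j, ‖pd j u x‖ₑ := by
        rw [ENNReal.ofReal_add (h.nonneg_fst x) (Finset.sum_nonneg fun _ _ => abs_nonneg _),
          ENNReal.ofReal_sum_of_nonneg fun _ _ => abs_nonneg _]
        simp_rw [Real.enorm_eq_ofReal_abs]
    _ ≤ c * (1 + d * U) + ∑ _j : Fin (n + 1), c * (1 + U) := by
        gcongr with j
        · exact h1.trans (by gcongr)
        · exact h2 j
    _ ≤ c * (d * (1 + U)) + ∑ _j : Fin (n + 1), c * (1 + U) := by
        gcongr
        rw [mul_add, mul_one]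
        gcongr
    _ = _ := by
        rw [Finset.sum_const, Finset.card_univ, Fintype.card_fin, nsmul_eq_mul]
        ring

lemma lintegral_annularDensity (ρ a p : ℝ) (v : Euc n → ℝ) :
    ∫⁻ y, annularDensity ρ a p v y =
      ∫⁻ y in {y | 1 / 2 ≤ ‖y‖ ∧ ‖y‖ ≤ ρ}, ENNReal.ofReal (‖y‖ ^ a * v y ^ p) :=
  lintegral_indicator (measurableSet_annulus ρ) _

lemma IsNonnegSol.exists_lintegral_annularDensity_le (hn : 2 ≤ n) {p q a b : ℝ} (hp : 0 < p)
    (hq : 0 < q) (hpq : 1 < p * q) (ha : -2 < a) (hb : -2 < b) {ρ : ℝ} (hρ : 0 < ρ) :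
    ∃ C : ENNReal, C ≠ ⊤ ∧ ∀ u v : Euc (n + 1) → ℝ, IsNonnegSol p q a b u v →
      ∫⁻ y, annularDensity ρ a p v y ≤ C := by
  obtain ⟨C, hC, H⟩ := exists_basic_estimate (N := n + 1) (by omega) hp hq hpq ha hb hρ
  refine ⟨ENNReal.ofReal C, ENNReal.ofReal_ne_top, fun u v h => ?_⟩
  refine le_trans ?_ (H u v h).2.2.1
  rw [lintegral_annularDensity]
  calc _ = ∫⁻ y in {y : Euc (n + 1) | 1 / 2 ≤ ‖y‖ ∧ ‖y‖ ≤ ρ}, ENNReal.ofReal (-lap u y) := by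
        refine setLIntegral_congr_fun (measurableSet_annulus ρ) fun y hy => ?_
        have hy0 : y ≠ 0 := norm_pos_iff.1 (lt_of_lt_of_le (by norm_num) hy.1)
        simp only [h.lap_fst y hy0, neg_neg]
    _ ≤ _ := lintegral_mono_set fun y hy => by simpa using hy.2

lemma annularDensity_rpow_le {ρ a b p q : ℝ} (hp : 0 < p) (hρ : 2 ≤ ρ) {u v : Euc n → ℝ}
    (hu : ∀ x, 0 ≤ u x) (hv : ∀ x, 0 ≤ v x) (y : Euc n) :
    annularDensity ρ a p v y ^ ((p + 1) / p) ≤ ENNReal.ofReal (ρ ^ (|a| / p)) *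
      indicator (closedBall 0 ρ) (fun y => ENNReal.ofReal (energyDensity p q a b u v y)) y := by
  unfold annularDensity
  have hk : 0 < (p + 1) / p := by positivity
  by_cases hy : y ∈ {y : Euc n | 1 / 2 ≤ ‖y‖ ∧ ‖y‖ ≤ ρ}
  · have hy' : y ∈ closedBall (0 : Euc n) ρ := by simpa using hy.2
    have hpos : 0 < ‖y‖ := lt_of_lt_of_le (by norm_num) hy.1
    rw [indicator_of_mem hy, indicator_of_mem hy',
      ENNReal.ofReal_rpow_of_nonneg (mul_nonneg (by positivity) (Real.rpow_nonneg (hv y) _)) hk.le,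
      ← ENNReal.ofReal_mul (by positivity)]
    apply ENNReal.ofReal_le_ofReal
    have hvp := hv y
    rw [Real.mul_rpow (by positivity) (by positivity), ← Real.rpow_mul hpos.le,
      ← Real.rpow_mul hvp]
    have e1 : a * ((p + 1) / p) = a / p + a := by field_simp; ring
    have e2 : p * ((p + 1) / p) = p + 1 := by field_simp
    rw [e1, e2, Real.rpow_add hpos, mul_assoc]
    have h1 : ‖y‖ ^ (a / p) ≤ ρ ^ (|a| / p) := by
      rcases le_total 0 a with h0 | h0
      · rw [abs_of_nonneg h0]
        exact Real.rpow_le_rpow hpos.le hy.2 (by positivity)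
      · rw [abs_of_nonpos h0]
        have : a / p = -(-a / p) := by ring
        rw [this, Real.rpow_neg hpos.le, ← Real.inv_rpow hpos.le]
        refine Real.rpow_le_rpow (by positivity) ?_ (div_nonneg (by linarith) hp.le)
        rw [inv_le_comm₀ hpos (by linarith)]
        refine le_trans ?_ hy.1
        rw [inv_eq_one_div]
        exact one_div_le_one_div_of_le (by norm_num) hρ
    have hup := hu y
    have h2 : ‖y‖ ^ a * v y ^ (p + 1) ≤ energyDensity p q a b u v y := by
      unfold energyDensity
      have : 0 ≤ ‖y‖ ^ b * u y ^ (q + 1) := by positivity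
      linarith
    exact mul_le_mul h1 h2 (by positivity) (by positivity)
  · rw [indicator_of_notMem hy, ENNReal.zero_rpow_of_pos hk]
    exact zero_le

lemma IsNonnegSol.exists_lintegral_annularDensity_rpow_le (hn : 2 ≤ n) {p q a b : ℝ} (hp : 0 < p)
    (hq : 0 < q) (hpq : 1 < p * q) (ha : -2 < a) (hb : -2 < b) {ρ c : ℝ} (hρ : 2 ≤ ρ) (hc0 : 0 ≤ c)
    (hc1 : c ≤ 1 / (p + 1)) :
    ∃ C : ENNReal, C ≠ ⊤ ∧ ∀ u v : Euc (n + 1) → ℝ, IsNonnegSol p q a b u v →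
      ∀ T : ENNReal, 1 ≤ T → T ≠ ⊤ →
      ∫⁻ y in closedBall (0 : Euc (n + 1)) ρ, ENNReal.ofReal (energyDensity p q a b u v y) ≤ T →
      ∫⁻ y, annularDensity ρ a p v y ^ (1 - c)⁻¹ ≤ C * T ^ (p * c * (1 - c)⁻¹) := by
  obtain ⟨C, hC, H⟩ := IsNonnegSol.exists_lintegral_annularDensity_le hn hp hq hpq ha hb
    (ρ := ρ) (by linarith)
  have hp1 : 1 / (p + 1) < 1 := by rw [div_lt_one (by linarith)]; linarith
  have hc : 0 < 1 - c := by linarith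
  have hκ : 1 ≤ (1 - c)⁻¹ := by rw [one_le_inv₀ hc]; linarith
  have hk : (1 - c)⁻¹ ≤ (p + 1) / p := by
    rw [inv_le_comm₀ hc (by positivity), inv_div]
    have : p / (p + 1) = 1 - 1 / (p + 1) := by field_simp; ring
    linarith
  have hpk : p * ((p + 1) / p - 1) = 1 := by field_simp; ring
  refine ⟨C + ENNReal.ofReal (ρ ^ (|a| / p)), ENNReal.add_ne_top.2 ⟨hC, ENNReal.ofReal_ne_top⟩,
    fun u v h T hT hT1 hE => ?_⟩
  have e1 : p * c * (1 - c)⁻¹ = p * ((1 - c)⁻¹ - 1) := by field_simp; ring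
  rw [e1]
  refine lintegral_rpow_le_of_interpolation (measurable_annularDensity h.continuous_snd) hκ hk hpk
    hT hT1 annularDensity_ne_top (H u v h) ENNReal.ofReal_ne_top
    (annularDensity_rpow_le (q := q) (b := b) hp hρ h.nonneg_fst h.nonneg_snd) ?_
  rwa [lintegral_indicator isClosed_closedBall.measurableSet]

end AnnularDensity

section EnergyGain

variable {n : ℕ}

lemma measurable_rieszPot {γ : ℝ} {h : Euc n → ENNReal} (mh : Measurable h) :
    Measurable (rieszPot γ h) := by
  refine Measurable.lintegral_prod_right' (f := fun w : Euc n × Euc n =>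
    h w.2 * ENNReal.ofReal (‖w.2 - w.1‖ ^ (-γ))) ?_
  exact (mh.comp measurable_snd).mul
    ((((measurable_snd.sub measurable_fst).norm).pow_const _).ennreal_ofReal)

lemma IsNonnegSol.exists_rpow_snd_le (hn : 3 ≤ n + 1) {p q a b : ℝ} (hq : 0 < q) (hqp : q ≤ p)
    (hpq : 1 < p * q) (ha : -2 < a) (hb : -2 < b) (h0 : 0 ≤ a - b)
    (h1 : a - b ≤ (((n + 1 : ℕ) : ℝ) - 2) * (p - q)) :
    ∃ C > 0, ∀ u v : Euc (n + 1) → ℝ, IsNonnegSol p q a b u v → (∃ x, u x ≠ 0) →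
      ∀ x, 1 ≤ ‖x‖ → v x ^ (p + 1) ≤ C * u x ^ (q + 1) := by
  have hp : 0 < p := hq.trans_le hqp
  refine ⟨(p + 1) / (q + 1), by positivity, fun u v h hne x hx1 => ?_⟩
  have hx0 : 0 < ‖x‖ := by linarith
  have := h.comparison hn hq hqp hpq ha hb h0 h1 hne x (norm_pos_iff.1 hx0)
  have hu := h.nonneg_fst x
  have hv := h.nonneg_snd x
  have hab : ‖x‖ ^ b ≤ ‖x‖ ^ a := Real.rpow_le_rpow_of_exponent_le hx1 (by linarith)
  have h2 : ‖x‖ ^ a * (v x ^ (p + 1) / (p + 1)) ≤ ‖x‖ ^ a * (u x ^ (q + 1) / (q + 1)) := by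
    calc _ = ‖x‖ ^ a * v x ^ (p + 1) / (p + 1) := by ring
      _ ≤ ‖x‖ ^ b * u x ^ (q + 1) / (q + 1) := this
      _ = ‖x‖ ^ b * (u x ^ (q + 1) / (q + 1)) := by ring
      _ ≤ _ := mul_le_mul_of_nonneg_right hab (by positivity)
  have h3 := le_of_mul_le_mul_left h2 (by positivity)
  rw [div_le_iff₀ (by positivity)] at h3
  calc _ ≤ _ := h3
    _ = _ := by ring

lemma ofReal_rpow_le_of_le {w s t : ℝ} {C X : ENNReal} (hw : 0 ≤ w) (hs : 0 ≤ s) (hst : s ≤ t)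
    (h : ENNReal.ofReal w ≤ C * (1 + X)) : ENNReal.ofReal (w ^ s) ≤ C ^ s * (1 + X) ^ t := by
  rw [← ENNReal.ofReal_rpow_of_nonneg hw hs]
  refine (ENNReal.rpow_le_rpow h hs).trans ?_
  rw [ENNReal.mul_rpow_of_nonneg _ _ hs]
  exact mul_le_mul_right (ENNReal.rpow_le_rpow_of_exponent_le le_self_add hst) _

lemma IsNonnegSol.exists_boundaryDensity_le (hn : 2 ≤ n) {p q a b : ℝ} (hq : 0 < q) (hqp : q ≤ p)
    (hpq : 1 < p * q) (ha : -2 < a) (hb : -2 < b)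
    (hab : 4 ≤ n + 1 → 0 ≤ a - b ∧ a - b ≤ (((n + 1 : ℕ) : ℝ) - 2) * (p - q)) {ρ s₁ s₂ : ℝ}
    (hρ : 1 ≤ ρ) (hs₁ : q + 1 ≤ s₁) (hs₂ : n = 2 → p + 1 ≤ s₂) :
    ∃ C : ENNReal, C ≠ ⊤ ∧ ∀ u v : Euc (n + 1) → ℝ, IsNonnegSol p q a b u v → (∃ x, u x ≠ 0) →
      ∀ x, 1 ≤ ‖x‖ → ‖x‖ + 1 / 2 ≤ ρ →
      ENNReal.ofReal (boundaryDensity p q u v x) ≤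
        C * ((1 + rieszPot n (annularDensity ρ a p v) x) *
            (1 + rieszPot n (annularDensity ρ b q u) x) +
          (1 + rieszPot ((n : ℝ) - 1) (annularDensity ρ a p v) x) ^ s₁ +
          (1 + rieszPot ((n : ℝ) - 1) (annularDensity ρ b q u) x) ^ s₂) := by
  have hp : 0 < p := hq.trans_le hqp
  obtain ⟨C₁, hC₁, H₁⟩ := IsNonnegSol.exists_potential_bound hn hp hq hpq ha hb hρ
  obtain ⟨C₂, hC₂, H₂⟩ := IsNonnegSol.exists_potential_bound hn hq hp (by linarith) hb ha hρ
  have hC₁' : C₁ ^ (q + 1) ≠ ⊤ := ENNReal.rpow_ne_top_of_nonneg (by linarith) hC₁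
  have hC₂' : C₂ ^ (p + 1) ≠ ⊤ := ENNReal.rpow_ne_top_of_nonneg (by linarith) hC₂
  obtain ⟨C₃, hC₃, H₃⟩ : ∃ C₃ : ENNReal, C₃ ≠ ⊤ ∧ ∀ u v : Euc (n + 1) → ℝ,
      IsNonnegSol p q a b u v → (∃ x, u x ≠ 0) → ∀ x, 1 ≤ ‖x‖ → ‖x‖ + 1 / 2 ≤ ρ →
      ENNReal.ofReal (v x ^ (p + 1)) ≤ C₃ *
        ((1 + rieszPot ((n : ℝ) - 1) (annularDensity ρ a p v) x) ^ s₁ +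
          (1 + rieszPot ((n : ℝ) - 1) (annularDensity ρ b q u) x) ^ s₂) := by
    by_cases h2 : n = 2
    · refine ⟨C₂ ^ (p + 1), hC₂', fun u v h hne x hx1 hx2 => ?_⟩
      refine (ofReal_rpow_le_of_le (h.nonneg_snd x) (by linarith) (hs₂ h2)
        (H₂ v u h.symm x hx1 hx2).1).trans ?_
      gcongr
      exact le_add_self
    · obtain ⟨h0, h1⟩ := hab (by omega)
      obtain ⟨C, hC, H⟩ := IsNonnegSol.exists_rpow_snd_le (n := n) (by omega) hq hqp hpq ha hb h0 h1
      refine ⟨ENNReal.ofReal C * C₁ ^ (q + 1), ENNReal.mul_ne_top ENNReal.ofReal_ne_top hC₁',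
        fun u v h hne x hx1 hx2 => ?_⟩
      refine (ENNReal.ofReal_le_ofReal (H u v h hne x hx1)).trans ?_
      rw [ENNReal.ofReal_mul hC.le, mul_assoc]
      refine mul_le_mul_right ?_ _
      refine (ofReal_rpow_le_of_le (h.nonneg_fst x) (by linarith) hs₁
        (H₁ u v h x hx1 hx2).1).trans ?_
      gcongr
      exact le_self_add
  refine ⟨C₁ * C₂ + C₁ ^ (q + 1) + C₃, ENNReal.add_ne_top.2 ⟨ENNReal.add_ne_top.2
    ⟨ENNReal.mul_ne_top hC₁ hC₂, hC₁'⟩, hC₃⟩, fun u v h hne x hx1 hx2 => ?_⟩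
  have k1 := H₁ u v h x hx1 hx2
  have k2 := H₂ v u h.symm x hx1 hx2
  have k3 := H₃ u v h hne x hx1 hx2
  have hu := h.nonneg_fst x
  have hv := h.nonneg_snd x
  have k4 := ofReal_rpow_le_of_le hu (by linarith : 0 ≤ q + 1) hs₁ k1.1
  have hA : 0 ≤ u x + ∑ j, |pd j u x| := add_nonneg hu (Finset.sum_nonneg fun _ _ => abs_nonneg _)
  have hB : 0 ≤ v x + ∑ j, |pd j v x| := add_nonneg hv (Finset.sum_nonneg fun _ _ => abs_nonneg _)
  unfold boundaryDensity
  rw [ENNReal.ofReal_add (by positivity) (by positivity), ENNReal.ofReal_add (by positivity)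
    (by positivity), ENNReal.ofReal_mul hA]
  set U := 1 + rieszPot n (annularDensity ρ a p v) x
  set V := 1 + rieszPot n (annularDensity ρ b q u) x
  set X := (1 + rieszPot ((n : ℝ) - 1) (annularDensity ρ a p v) x) ^ s₁
  set Y := (1 + rieszPot ((n : ℝ) - 1) (annularDensity ρ b q u) x) ^ s₂
  calc _ ≤ C₁ * U * (C₂ * V) + C₁ ^ (q + 1) * X + C₃ * (X + Y) := by
        gcongr
        · exact k1.2
        · exact k2.2
    _ = C₁ * C₂ * (U * V) + C₁ ^ (q + 1) * X + C₃ * (X + Y) := by ring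
    _ ≤ C₁ * C₂ * (U * V + X + Y) + C₁ ^ (q + 1) * (U * V + X + Y) + C₃ * (U * V + X + Y) := by
        gcongr
        · rw [add_assoc]; exact le_self_add
        · rw [add_right_comm]; exact le_add_self
        · exact le_add_self
    _ = _ := by ring

lemma measurable_energyDensity {p q a b : ℝ} {u v : Euc n → ℝ} (hu : Continuous u)
    (hv : Continuous v) : Measurable (energyDensity p q a b u v) :=
  ((measurable_norm.pow_const _).mul (hu.measurable.pow_const _)).add
    ((measurable_norm.pow_const _).mul (hv.measurable.pow_const _))

lemma lintegral_closedBall_le_cube {f : Euc n → ENNReal} (hf : Measurable f) {s r : ℝ}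
    (hsr : s ≤ r) :
    ∫⁻ y in closedBall (0 : Euc n) s, f y ≤ ∫⁻ x in cube n r, f (WithLp.toLp 2 x) := by
  rw [← (PiLp.volume_preserving_toLp (Fin n)).setLIntegral_comp_preimage
    isClosed_closedBall.measurableSet hf]
  refine lintegral_mono_set fun x hx => mem_cube.2 fun i => ?_
  have h1 : ‖(WithLp.toLp 2 x : Euc n)‖ ≤ s := by simpa using hx
  have h2 : |x i| ≤ ‖(WithLp.toLp 2 x : Euc n)‖ := by
    simpa using PiLp.norm_apply_le (WithLp.toLp 2 x : Euc n) i
  linarith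

set_option maxHeartbeats 1000000 in
/-- The energy in a unit ball is controlled by a power less than one of the energy in a larger
ball. -/
lemma IsNonnegSol.exists_energy_gain (hn : 2 ≤ n) {p q a b : ℝ} (hq : 0 < q) (hqp : q ≤ p)
    (hpq : 1 < p * q) (ha : -2 < a) (hb : -2 < b)
    (hsub : ((n + 1 : ℕ) : ℝ) - 2 < ((n + 1 : ℕ) + a) / (p + 1) + ((n + 1 : ℕ) + b) / (q + 1))
    (hab : 4 ≤ n + 1 → 0 ≤ a - b ∧ a - b ≤ (((n + 1 : ℕ) : ℝ) - 2) * (p - q))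
    (hα : (n : ℝ) - 2 < 2 * (p + 1) / (p * q - 1)) :
    ∃ C : ENNReal, C ≠ ⊤ ∧ ∃ θ : ℝ, 0 ≤ θ ∧ θ < 1 ∧ ∀ u v : Euc (n + 1) → ℝ,
      IsNonnegSol p q a b u v → (∃ x, u x ≠ 0) → ∀ T : ENNReal, 1 ≤ T → T ≠ ⊤ →
      ∫⁻ y in closedBall (0 : Euc (n + 1)) (2 * (n + 1) + 1),
        ENNReal.ofReal (energyDensity p q a b u v y) ≤ T →
      ∫⁻ y in closedBall (0 : Euc (n + 1)) 1,
        ENNReal.ofReal (energyDensity p q a b u v y) ≤ C * T ^ θ := by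
  have hp : 0 < p := hq.trans_le hqp
  have hn' : (2 : ℝ) ≤ n := by exact_mod_cast hn
  have hn0 : (0 : ℝ) < n := by linarith
  set ρ : ℝ := 2 * (n + 1) + 1 with hρ
  have hρ2 : 2 ≤ ρ := by linarith
  obtain ⟨δ, cu, cv, hδ, hδ1, hδp, hcu, hcup, hcv, hcvq, hsum, hs₁pos, hθ₁, hθ₂⟩ :=
    exists_exponents hn' hp hq hpq hα
  have hP1 : 1 / (p + 1) < 1 := by rw [div_lt_one (by linarith)]; linarith
  have hQ1 : 1 / (q + 1) < 1 := by rw [div_lt_one (by linarith)]; linarith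
  have hcu1 : 0 < 1 - cu := by linarith
  have hcv1 : 0 < 1 - cv := by linarith
  have hδn : 0 < δ / n := by positivity
  have h1n : δ / n < 1 / n := by gcongr
  have e2 : 2 / (n : ℝ) = 2 * (1 / n) := by ring
  have e3 : 2 * δ / (n : ℝ) = 2 * (δ / n) := by ring
  have hnn : 1 / (n : ℝ) ≤ 1 / 2 := by gcongr
  rw [e2, e3] at hsum
  set X := 1 - cu - 1 / n + δ / n with hX
  set Y := 1 - cv - 1 / n + δ / n with hY
  have hXY : X + Y = 1 := by linarith
  have hX0 : 0 < X := by linarith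
  have hY0 : 0 < Y := by linarith
  set S := cv - δ / n with hS
  set W := ((n : ℝ) - 2 + δ) / n with hW
  have hW0 : 0 < W := by rw [hW]; apply div_pos _ hn0; linarith
  have hW1 : W ≤ 1 := by rw [hW, div_le_one hn0]; linarith
  have hκu : 1 ≤ (1 - cu)⁻¹ := by rw [one_le_inv₀ hcu1]; linarith
  have hκv : 1 ≤ (1 - cv)⁻¹ := by rw [one_le_inv₀ hcv1]; linarith
  have hκ0 : 1 ≤ (1 - (0 : ℝ))⁻¹ := by norm_num
  have hs₁ : q + 1 ≤ S⁻¹ := by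
    rw [le_inv_comm₀ (by linarith) hs₁pos, inv_eq_one_div]
    linarith
  have hs₂ : n = 2 → p + 1 ≤ W⁻¹ := by
    intro h2
    have : (n : ℝ) = 2 := by exact_mod_cast h2
    rw [le_inv_comm₀ (by linarith) hW0, hW, this]
    rw [le_div_iff₀ (by linarith)] at hδp
    rw [inv_eq_one_div, le_div_iff₀ (by linarith), sub_self, zero_add, div_mul_eq_mul_div,
      div_le_iff₀ two_pos]
    linarith
  obtain ⟨C₀, hC₀, hpoh⟩ := IsNonnegSol.exists_pohozaev_cube (n := n) (by omega) hp hq ha hb hsub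
  obtain ⟨C₁, hC₁, hbd⟩ := IsNonnegSol.exists_boundaryDensity_le hn hq hqp hpq ha hb hab
    (show 1 ≤ ρ by linarith) hs₁ hs₂
  obtain ⟨Du, hDu, hdu⟩ := IsNonnegSol.exists_lintegral_annularDensity_rpow_le hn hp hq hpq ha hb
    hρ2 hcu hcup
  obtain ⟨Dv, hDv, hdv⟩ := IsNonnegSol.exists_lintegral_annularDensity_rpow_le hn hq hp
    (by linarith) hb ha hρ2 hcv hcvq
  obtain ⟨Dw, hDw, hdw⟩ := IsNonnegSol.exists_lintegral_annularDensity_rpow_le hn hq hp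
    (by linarith) hb ha hρ2 le_rfl (show 0 ≤ 1 / (q + 1) by positivity)
  obtain ⟨Cg, hCg, hgood⟩ := exists_good_cube (n := n + 1) (K := Fin 3) hδ hδ1
  have hconst : ∀ {D : ENNReal}, D ≠ ⊤ → Cg * (D + 1) ≠ ⊤ := fun hD =>
    ENNReal.mul_ne_top hCg (by simpa using hD)
  obtain ⟨E₁, hE₁, hf₁⟩ := exists_lintegral_face_le (n := n) (γ := n) (κ := (1 - cu)⁻¹)
    (s := X⁻¹) (θ := p * cu) (ρ := ρ) (hconst hDu) (by omega) hn0 hκu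
    (inv_anti₀ hX0 (by linarith)) hδ hδ1 (by
      rw [one_div, inv_inv, one_div, inv_inv, hX]; field_simp; ring) (by positivity)
  obtain ⟨E₂, hE₂, hf₂⟩ := exists_lintegral_face_le (n := n) (γ := n) (κ := (1 - cv)⁻¹)
    (s := Y⁻¹) (θ := q * cv) (ρ := ρ) (hconst hDv) (by omega) hn0 hκv
    (inv_anti₀ hY0 (by linarith)) hδ hδ1 (by
      rw [one_div, inv_inv, one_div, inv_inv, hY]; field_simp; ring) (by positivity)
  obtain ⟨E₃, hE₃, hf₃⟩ := exists_lintegral_face_le (n := n) (γ := (n : ℝ) - 1)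
    (κ := (1 - cu)⁻¹)
    (s := S⁻¹) (θ := p * cu) (ρ := ρ) (hconst hDu) (by omega) (by linarith) hκu
    (inv_anti₀ hs₁pos (by linarith)) hδ hδ1 (by
      have : S = 1 - cu - 2 * (1 / n) + δ / n := by rw [hS]; linarith
      rw [one_div, inv_inv, one_div, inv_inv, this]; field_simp; ring) (by positivity)
  obtain ⟨E₄, hE₄, hf₄⟩ := exists_lintegral_face_le (n := n) (γ := (n : ℝ) - 1)
    (κ := (1 - (0 : ℝ))⁻¹)
    (s := W⁻¹) (θ := q * 0) (ρ := ρ) (hconst hDw) (by omega) (by linarith) hκ0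
    (inv_anti₀ hW0 (by linarith)) hδ hδ1 (by
      rw [one_div, inv_inv, one_div, inv_inv, hW]; field_simp; ring) (by simp)
  set θ := max (p * cu + q * cv) (p * cu * S⁻¹) with hθ
  set Cf := C₁ * (E₁ ^ X * E₂ ^ Y + E₃ + E₄) with hCf
  have hCf' : Cf ≠ ⊤ := ENNReal.mul_ne_top hC₁ (ENNReal.add_ne_top.2 ⟨ENNReal.add_ne_top.2
    ⟨ENNReal.mul_ne_top (ENNReal.rpow_ne_top_of_nonneg hX0.le hE₁)
      (ENNReal.rpow_ne_top_of_nonneg hY0.le hE₂), hE₃⟩, hE₄⟩)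
  have hθ0 : 0 ≤ θ := le_max_of_le_left (by positivity)
  refine ⟨ENNReal.ofReal C₀ * ∑ _i : Fin (n + 1), (Cf + Cf), ?_, θ, hθ0, ?_,
    fun u v h hne T hT hT1 hE => ?_⟩
  · refine ENNReal.mul_ne_top ENNReal.ofReal_ne_top ?_
    simp [ENNReal.mul_ne_top, hCf']
  · refine max_lt hθ₁ ?_
    rwa [← div_eq_mul_inv, div_lt_one hs₁pos]
  have hT0 : T ≠ 0 := (zero_lt_one.trans_le hT).ne'
  have hTp : ∀ e : ℝ, T ^ e ≠ 0 := fun e => by simp [ENNReal.rpow_eq_zero_iff, hT0, hT1]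
  have hTt : ∀ e : ℝ, T ^ e ≠ ⊤ := fun e => ENNReal.rpow_ne_top_of_ne_zero hT0 hT1
  have hE' : ∫⁻ y in closedBall (0 : Euc (n + 1)) ρ,
      ENNReal.ofReal (energyDensity q p b a v u y) ≤ T := by
    simpa only [energyDensity, add_comm] using hE
  set F := annularDensity ρ a p v with hF
  set G := annularDensity ρ b q u with hG
  have mF : Measurable F := measurable_annularDensity h.continuous_snd
  have mG : Measurable G := measurable_annularDensity h.continuous_fst
  obtain ⟨r, hr1, hr2, hr⟩ := hgood
    ![fun y => F y ^ (1 - cu)⁻¹, fun y => G y ^ (1 - cv)⁻¹, fun y => G y ^ (1 - (0 : ℝ))⁻¹]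
    ![(Du + 1) * T ^ (p * cu * (1 - cu)⁻¹), (Dv + 1) * T ^ (q * cv * (1 - cv)⁻¹),
      (Dw + 1) * T ^ (q * 0 * (1 - (0 : ℝ))⁻¹)]
    (by
      intro k
      fin_cases k
      · exact mF.pow_const _
      · exact mG.pow_const _
      · exact mG.pow_const _)
    (by
      intro k
      fin_cases k
      · exact mul_ne_zero (by simp) (hTp _)
      · exact mul_ne_zero (by simp) (hTp _)
      · exact mul_ne_zero (by simp) (hTp _))
    (by
      intro k
      fin_cases k
      · exact ENNReal.mul_ne_top (by simpa using hDu) (hTt _)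
      · exact ENNReal.mul_ne_top (by simpa using hDv) (hTt _)
      · exact ENNReal.mul_ne_top (by simpa using hDw) (hTt _))
    (by
      intro k
      fin_cases k
      · exact (hdu u v h T hT hT1 hE).trans (mul_le_mul_left le_self_add _)
      · exact (hdv v u h.symm T hT hT1 hE').trans (mul_le_mul_left le_self_add _)
      · exact (hdw v u h.symm T hT hT1 hE').trans (mul_le_mul_left le_self_add _))
  have hface : ∀ (i : Fin (n + 1)) (t : ℝ), |t| = r →
      (∀ k, ∫⁻ y, ![fun y => F y ^ (1 - cu)⁻¹, fun y => G y ^ (1 - cv)⁻¹,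
        fun y => G y ^ (1 - (0 : ℝ))⁻¹] k y * ‖t - y i‖ₑ ^ (-1 + δ) ≤ Cg *
        ![(Du + 1) * T ^ (p * cu * (1 - cu)⁻¹), (Dv + 1) * T ^ (q * cv * (1 - cv)⁻¹),
          (Dw + 1) * T ^ (q * 0 * (1 - (0 : ℝ))⁻¹)] k) →
      ∫⁻ y in cube n r, ENNReal.ofReal (boundaryDensity p q u v (slicePoint i t y)) ≤
        Cf * T ^ θ := by
    intro i t ht hk
    have ht2 : |t| ≤ 2 := by linarith
    have hr0 : 0 ≤ r := by linarith
    have k0 := hk 0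
    have k1 := hk 1
    have k2 := hk 2
    simp only [Matrix.cons_val_zero, Matrix.cons_val_one, Matrix.cons_val_two, Matrix.head_cons,
      Matrix.tail_cons, ← mul_assoc Cg] at k0 k1 k2
    have b1 := hf₁ T i t r F hT ht2 hr0 hr2 mF (fun y hy => annularDensity_eq_zero hy) k0
    have b2 := hf₂ T i t r G hT ht2 hr0 hr2 mG (fun y hy => annularDensity_eq_zero hy) k1
    have b3 := hf₃ T i t r F hT ht2 hr0 hr2 mF (fun y hy => annularDensity_eq_zero hy) k0
    have b4 := hf₄ T i t r G hT ht2 hr0 hr2 mG (fun y hy => annularDensity_eq_zero hy) k2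
    have mR : ∀ (γ : ℝ) (H : Euc (n + 1) → ENNReal), Measurable H →
        Measurable fun z : Fin n → ℝ => 1 + rieszPot γ H (slicePoint i t z) := fun γ H mH =>
      measurable_const.add ((measurable_rieszPot mH).comp (continuous_slicePoint i t).measurable)
    have m1 := mR n F mF
    have m2 := mR n G mG
    have m3 := (mR ((n : ℝ) - 1) F mF).pow_const S⁻¹
    have m12 : Measurable fun z : Fin n → ℝ => (1 + rieszPot n F (slicePoint i t z)) *
        (1 + rieszPot n G (slicePoint i t z)) := m1.mul m2
    have m123 : Measurable fun z : Fin n → ℝ => (1 + rieszPot n F (slicePoint i t z)) *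
        (1 + rieszPot n G (slicePoint i t z)) +
        (1 + rieszPot ((n : ℝ) - 1) F (slicePoint i t z)) ^ S⁻¹ := m12.add m3
    have hol : (X⁻¹).HolderConjugate Y⁻¹ := by
      rw [Real.holderConjugate_iff]
      refine ⟨(one_lt_inv₀ hX0).2 (by linarith), by rwa [inv_inv, inv_inv]⟩
    have hUV : ∫⁻ z in cube n r, (1 + rieszPot n F (slicePoint i t z)) *
        (1 + rieszPot n G (slicePoint i t z)) ≤ E₁ ^ X * E₂ ^ Y * T ^ (p * cu + q * cv) := by
      refine (ENNReal.lintegral_mul_le_Lp_mul_Lq _ hol m1.aemeasurable m2.aemeasurable).trans ?_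
      rw [one_div, inv_inv, one_div, inv_inv]
      calc _ ≤ (E₁ * T ^ (p * cu * X⁻¹)) ^ X * (E₂ * T ^ (q * cv * Y⁻¹)) ^ Y := by gcongr
        _ = E₁ ^ X * E₂ ^ Y * (T ^ (p * cu) * T ^ (q * cv)) := by
            rw [ENNReal.mul_rpow_of_nonneg _ _ hX0.le, ENNReal.mul_rpow_of_nonneg _ _ hY0.le,
              ← ENNReal.rpow_mul, ← ENNReal.rpow_mul, inv_mul_cancel_right₀ hX0.ne',
              inv_mul_cancel_right₀ hY0.ne']
            ring
        _ = _ := by rw [ENNReal.rpow_add _ _ hT0 hT1]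
    calc _ ≤ ∫⁻ z in cube n r, C₁ * ((1 + rieszPot n F (slicePoint i t z)) *
          (1 + rieszPot n G (slicePoint i t z)) +
          (1 + rieszPot ((n : ℝ) - 1) F (slicePoint i t z)) ^ S⁻¹ +
          (1 + rieszPot ((n : ℝ) - 1) G (slicePoint i t z)) ^ W⁻¹) := by
          refine setLIntegral_mono' measurableSet_Icc fun z hz => ?_
          refine hbd u v h hne _ ?_ ?_
          · have := abs_le_norm_slicePoint i t z
            linarith
          · have := norm_le_of_abs_le hr0 fun j => abs_slicePoint_le (i := i) ht.le hz j
            push_cast at this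
            nlinarith
      _ ≤ C₁ * (E₁ ^ X * E₂ ^ Y * T ^ (p * cu + q * cv) + E₃ * T ^ (p * cu * S⁻¹) +
          E₄ * T ^ (q * 0 * W⁻¹)) := by
          rw [lintegral_const_mul' _ _ hC₁, lintegral_add_left m123, lintegral_add_left m12]
          gcongr
      _ ≤ C₁ * (E₁ ^ X * E₂ ^ Y * T ^ θ + E₃ * T ^ θ + E₄ * T ^ θ) := by
          gcongr
          · exact le_max_left _ _
          · exact le_max_right _ _
          · simpa using hθ0
      _ = _ := by rw [hCf]; ring
  have hcube := hpoh u v h r hr1 hr2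
  calc ∫⁻ y in closedBall (0 : Euc (n + 1)) 1, ENNReal.ofReal (energyDensity p q a b u v y)
      ≤ ∫⁻ x in cube (n + 1) r,
          ENNReal.ofReal (energyDensity p q a b u v (WithLp.toLp 2 x)) :=
        lintegral_closedBall_le_cube
          (measurable_energyDensity h.continuous_fst h.continuous_snd).ennreal_ofReal hr1
    _ ≤ _ := hcube
    _ ≤ ENNReal.ofReal C₀ * ∑ _i : Fin (n + 1), (Cf * T ^ θ + Cf * T ^ θ) := by
        gcongr with i
        · exact hface i r (abs_of_nonneg (by linarith)) fun k => (hr k i).1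
        · exact hface i (-r) (by rw [abs_neg, abs_of_nonneg (by linarith)]) fun k => (hr k i).2
    _ = _ := by
        clear_value Cf
        simp_rw [← add_mul]
        rw [← Finset.sum_mul, mul_assoc]

end EnergyGain

section Liouville

variable {N : ℕ} {p q a b : ℝ} {u v : Euc N → ℝ}

open Filter Topology

/-- A sequence of at most exponential growth which is controlled by a power less than one of its
shift does not tend to infinity. -/
lemma not_tendsto_atTop_of_le_rpow_succ {g : ℕ → ℝ} {C K B θ : ℝ} (hC : 0 ≤ C) (hB : 0 < B)
    (hθ : 0 ≤ θ) (hθ1 : θ < 1) (hg : ∀ k, g k ≤ C * max 1 (g (k + 1)) ^ θ)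
    (hK : ∀ᶠ k in atTop, g k ≤ K * B ^ k) : ¬ Tendsto g atTop atTop := by
  intro ht
  by_cases hfreq : ∃ᶠ k in atTop, g (k + 1) ≤ 2 * B * g k
  · have h1 : ∀ᶠ k in atTop, C * (2 * B) ^ θ < g k ^ (1 - θ) :=
      ((tendsto_rpow_atTop (by linarith)).comp ht).eventually_gt_atTop _
    obtain ⟨k, hk, h1k, h2k, h3k⟩ := (hfreq.and_eventually (h1.and
      ((ht.eventually_ge_atTop 1).and
        ((ht.comp (tendsto_add_atTop_nat 1)).eventually_ge_atTop 1)))).exists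
    have h0 : 0 < g k := by linarith
    have h3 : (1 : ℝ) ≤ g (k + 1) := h3k
    have h4 : g k ≤ C * (2 * B) ^ θ * g k ^ θ := by
      refine (hg k).trans ?_
      rw [max_eq_right h3, mul_assoc, ← Real.mul_rpow (by positivity) h0.le]
      gcongr
    have h5 : g k = g k ^ (1 - θ) * g k ^ θ := by
      rw [← Real.rpow_add h0]; simp
    have h6 : 0 < g k ^ θ := by positivity
    have : g k ^ (1 - θ) ≤ C * (2 * B) ^ θ := by
      refine le_of_mul_le_mul_right ?_ h6
      rw [← h5]; exact h4
    linarith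
  · have hev : ∀ᶠ k in atTop, 2 * B * g k ≤ g (k + 1) := by
      filter_upwards [not_frequently.1 hfreq] with k hk using le_of_lt (not_le.1 hk)
    obtain ⟨k₀, hk₀⟩ := eventually_atTop.1 (hev.and (hK.and (ht.eventually_ge_atTop 1)))
    have hlow : ∀ j, (2 * B) ^ j ≤ g (k₀ + j) := by
      intro j
      induction j with
      | zero => simpa using (hk₀ k₀ le_rfl).2.2
      | succ j ih =>
        calc (2 * B) ^ (j + 1) = 2 * B * (2 * B) ^ j := by ring
          _ ≤ 2 * B * g (k₀ + j) := by gcongr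
          _ ≤ _ := (hk₀ (k₀ + j) (by omega)).1
    have hbd : ∀ j : ℕ, (2 : ℝ) ^ j ≤ K * B ^ k₀ := by
      intro j
      have h1 := (hlow j).trans (hk₀ (k₀ + j) (by omega)).2.1
      rw [mul_pow, pow_add, ← mul_assoc] at h1
      exact le_of_mul_le_mul_right h1 (by positivity)
    obtain ⟨j, hj⟩ := pow_unbounded_of_one_lt (K * B ^ k₀) (one_lt_two (α := ℝ))
    linarith [hbd j]

lemma energyDensity_comp_smul (hu : ∀ x, 0 ≤ u x) (hv : ∀ x, 0 ≤ v x) {R : ℝ} (hR : 0 < R)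
    {s t : ℝ} (h1 : s + 2 + a = p * t) (h2 : t + 2 + b = q * s) (x : Euc N) :
    energyDensity p q a b (fun x => R ^ s * u (R • x)) (fun x => R ^ t * v (R • x)) x =
      R ^ (s + t + 2) * energyDensity p q a b u v (R • x) := by
  have hu' := hu (R • x)
  have hv' := hv (R • x)
  simp only [energyDensity, norm_smul, Real.norm_of_nonneg hR.le]
  rw [Real.mul_rpow (by positivity) hu', Real.mul_rpow (by positivity) hv',
    Real.mul_rpow hR.le (norm_nonneg x), Real.mul_rpow hR.le (norm_nonneg x), ← Real.rpow_mul hR.le,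
    ← Real.rpow_mul hR.le]
  have e1 : R ^ (s * (q + 1)) = R ^ (s + t + 2) * R ^ b := by
    rw [← Real.rpow_add hR]; congr 1; linarith
  have e2 : R ^ (t * (p + 1)) = R ^ (s + t + 2) * R ^ a := by
    rw [← Real.rpow_add hR]; congr 1; linarith
  rw [e1, e2]
  ring

/-- The energy of the rescaled solution. -/
lemma lintegral_energyDensity_comp_smul (hu : ∀ x, 0 ≤ u x) (hv : ∀ x, 0 ≤ v x)
    (hE : Measurable (energyDensity p q a b u v)) {R : ℝ} (hR : 0 < R)
    {s t : ℝ} (h1 : s + 2 + a = p * t) (h2 : t + 2 + b = q * s) (r : ℝ) :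
    ∫⁻ x in closedBall (0 : Euc N) r, ENNReal.ofReal (energyDensity p q a b
        (fun x => R ^ s * u (R • x)) (fun x => R ^ t * v (R • x)) x) =
      ENNReal.ofReal (R ^ (s + t + 2 - N)) *
        ∫⁻ x in closedBall (0 : Euc N) (R * r), ENNReal.ofReal (energyDensity p q a b u v x) := by
  have hm : Measurable fun x : Euc N => ENNReal.ofReal (energyDensity p q a b u v x) :=
    hE.ennreal_ofReal
  have h := lintegral_comp_affine ((closedBall (0 : Euc N) (R * r)).indicator
    fun x => ENNReal.ofReal (energyDensity p q a b u v x)) 0 hR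
  rw [lintegral_indicator isClosed_closedBall.measurableSet] at h
  have hm' : Measurable fun x : Euc N => (closedBall (0 : Euc N) (R * r)).indicator
      (fun x => ENNReal.ofReal (energyDensity p q a b u v x)) (0 + R • x) :=
    (hm.indicator isClosed_closedBall.measurableSet).comp (by fun_prop)
  rw [Real.rpow_sub hR, Real.rpow_natCast, div_eq_mul_inv, ENNReal.ofReal_mul (by positivity),
    mul_assoc, ← h, ← lintegral_const_mul _ hm',
    ← lintegral_indicator isClosed_closedBall.measurableSet]
  refine lintegral_congr fun x => ?_
  have hmem : x ∈ closedBall (0 : Euc N) r ↔ 0 + R • x ∈ closedBall (0 : Euc N) (R * r) := by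
    simp [norm_smul, abs_of_pos hR, hR]
  by_cases hx : x ∈ closedBall (0 : Euc N) r
  · rw [indicator_of_mem hx, indicator_of_mem (hmem.1 hx), energyDensity_comp_smul hu hv hR h1 h2,
      ENNReal.ofReal_mul (by positivity), zero_add]
  · rw [indicator_of_notMem hx, indicator_of_notMem (fun hc => hx (hmem.2 hc)), mul_zero]

lemma IsNonnegSol.lintegral_energyDensity_lt_top (hN : 3 ≤ N) (h : IsNonnegSol p q a b u v)
    (hp : 0 < p) (hq : 0 < q) (hpq : 1 < p * q) (ha : -2 < a) (hb : -2 < b) (r : ℝ) :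
    ∫⁻ x in closedBall (0 : Euc N) r, ENNReal.ofReal (energyDensity p q a b u v x) < ⊤ := by
  have hNz : NeZero N := ⟨by omega⟩
  obtain ⟨ρ, hρ, hrρ⟩ : ∃ ρ : ℝ, 0 < ρ ∧ r ≤ ρ := ⟨max 1 r, by positivity, le_max_right _ _⟩
  obtain ⟨C, -, hC⟩ := exists_basic_estimate hN hp hq hpq ha hb hρ
  obtain ⟨-, -, hlu, hlv⟩ := hC u v h
  obtain ⟨A, hA⟩ := (isCompact_closedBall (0 : Euc N) ρ).exists_bound_of_continuousOn
    h.continuous_fst.continuousOn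
  obtain ⟨B, hB⟩ := (isCompact_closedBall (0 : Euc N) ρ).exists_bound_of_continuousOn
    h.continuous_snd.continuousOn
  have hmeas : ∀ {w : Euc N → ℝ}, (∀ x, x ≠ 0 → ContDiffAt ℝ 2 w x) → Measurable (lap w) :=
    fun hw => measurable_of_continuousOn_compl_singleton 0 fun y hy =>
      (contDiffAt_lap (hw y hy)).continuousAt.continuousWithinAt
  have mu : Measurable fun x => ENNReal.ofReal (-lap u x) :=
    (hmeas h.contDiffAt_fst).neg.ennreal_ofReal
  have mv : Measurable fun x => ENNReal.ofReal (-lap v x) :=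
    (hmeas h.contDiffAt_snd).neg.ennreal_ofReal
  calc ∫⁻ x in closedBall (0 : Euc N) r, ENNReal.ofReal (energyDensity p q a b u v x)
      ≤ ∫⁻ x in closedBall (0 : Euc N) ρ, ENNReal.ofReal (energyDensity p q a b u v x) :=
        lintegral_mono_set (closedBall_subset_closedBall hrρ)
    _ ≤ ∫⁻ x in closedBall (0 : Euc N) ρ, (ENNReal.ofReal A * ENNReal.ofReal (-lap v x) +
          ENNReal.ofReal B * ENNReal.ofReal (-lap u x)) := by
        refine lintegral_mono_ae ?_
        filter_upwards [ae_restrict_mem isClosed_closedBall.measurableSet,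
          ae_restrict_of_ae (ae_ne_point (0 : Euc N))] with x hx hx0
        have hux := h.nonneg_fst x
        have hvx := h.nonneg_snd x
        have hu1 : u x ≤ A := (le_abs_self _).trans (hA x hx)
        have hv1 : v x ≤ B := (le_abs_self _).trans (hB x hx)
        have hA0 : 0 ≤ A := hux.trans hu1
        have hB0 : 0 ≤ B := hvx.trans hv1
        rw [h.lap_fst x hx0, h.lap_snd x hx0, neg_neg, neg_neg, ← ENNReal.ofReal_mul hA0,
          ← ENNReal.ofReal_mul hB0, ← ENNReal.ofReal_add (by positivity) (by positivity)]
        refine ENNReal.ofReal_le_ofReal ?_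
        unfold energyDensity
        rw [Real.rpow_add_one' hux (by linarith), Real.rpow_add_one' hvx (by linarith)]
        have e1 : ‖x‖ ^ b * (u x ^ q * u x) ≤ ‖x‖ ^ b * (u x ^ q * A) := by gcongr
        have e2 : ‖x‖ ^ a * (v x ^ p * v x) ≤ ‖x‖ ^ a * (v x ^ p * B) := by gcongr
        linarith
    _ = ENNReal.ofReal A * (∫⁻ x in closedBall (0 : Euc N) ρ, ENNReal.ofReal (-lap v x)) +
          ENNReal.ofReal B * ∫⁻ x in closedBall (0 : Euc N) ρ, ENNReal.ofReal (-lap u x) := by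
        rw [lintegral_add_left (mv.const_mul _), lintegral_const_mul _ mv,
          lintegral_const_mul _ mu]
    _ < ⊤ := by
        refine ENNReal.add_lt_top.2 ⟨ENNReal.mul_lt_top ENNReal.ofReal_lt_top ?_,
          ENNReal.mul_lt_top ENNReal.ofReal_lt_top ?_⟩
        · exact hlv.trans_lt ENNReal.ofReal_lt_top
        · exact hlu.trans_lt ENNReal.ofReal_lt_top

lemma IsNonnegSol.lintegral_energyDensity_pos (hN : 3 ≤ N) (h : IsNonnegSol p q a b u v)
    (hp : 0 < p) (ha : -2 < a) (hne : ∃ x, u x ≠ 0) :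
    0 < ∫⁻ x in closedBall (0 : Euc N) 1, ENNReal.ofReal (energyDensity p q a b u v x) := by
  have hNz : NeZero N := ⟨by omega⟩
  obtain ⟨c, hc, hlow⟩ := h.exists_lower_bound hN hp ha hne 1
  refine pos_iff_ne_zero.2 fun h0 => ?_
  have hm : Measurable fun x : Euc N => ENNReal.ofReal (energyDensity p q a b u v x) :=
    (measurable_energyDensity h.continuous_fst h.continuous_snd).ennreal_ofReal
  rw [lintegral_eq_zero_iff hm] at h0
  have hF : ∀ᵐ x ∂(volume.restrict (closedBall (0 : Euc N) 1)), False := by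
    filter_upwards [h0, ae_restrict_mem isClosed_closedBall.measurableSet,
      ae_restrict_of_ae (ae_ne_point (0 : Euc N))] with x h1 h2 hx
    have hux : 0 < u x := hc.trans_le (hlow x hx (by simpa using h2))
    have hvx := h.nonneg_snd x
    have hx' : 0 < ‖x‖ := norm_pos_iff.2 hx
    have h3 : energyDensity p q a b u v x ≤ 0 := ENNReal.ofReal_eq_zero.1 h1
    have h4 : 0 < energyDensity p q a b u v x := by
      unfold energyDensity; positivity
    linarith
  rw [ae_iff] at hF
  simp only [not_false_eq_true] at hF
  have h5 : volume (closedBall (0 : Euc N) 1) = 0 := by simpa using hF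
  exact (measure_closedBall_pos volume (0 : Euc N) one_pos).ne h5.symm

/-- Polynomial growth of the energy of polynomially bounded solutions. -/
lemma exists_lintegral_energyDensity_le_of_polyBounded (hp : 0 < p) (hq : 0 < q)
    (hu : PolyBounded u) (hv : PolyBounded v)
    (hu0 : ∀ x, 0 ≤ u x) (hv0 : ∀ x, 0 ≤ v x)
    (hfin : ∀ r, ∫⁻ x in closedBall (0 : Euc N) r,
      ENNReal.ofReal (energyDensity p q a b u v x) < ⊤) :
    ∃ K L : ℝ, ∀ᶠ R in atTop, ∫⁻ x in closedBall (0 : Euc N) R,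
      ENNReal.ofReal (energyDensity p q a b u v x) ≤ ENNReal.ofReal (K * R ^ L) := by
  obtain ⟨K₁, L₁, R₁, hK₁, hL₁, h₁⟩ := hu
  obtain ⟨K₂, L₂, R₂, hK₂, hL₂, h₂⟩ := hv
  set R₀ := max 1 (max R₁ R₂) with hR₀
  set F₀ := ∫⁻ x in closedBall (0 : Euc N) R₀,
    ENNReal.ofReal (energyDensity p q a b u v x) with hF₀
  set V := volume (closedBall (0 : Euc N) 1) with hV
  have hVt : V ≠ ⊤ := (isCompact_closedBall (0 : Euc N) 1).measure_lt_top.ne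
  set D := K₁ ^ (q + 1) + K₂ ^ (p + 1) with hD
  set m := |b| + |a| + L₁ * (q + 1) + L₂ * (p + 1) with hm
  have hm0 : 0 ≤ m := by positivity
  refine ⟨F₀.toReal + D * V.toReal, m + N, ?_⟩
  filter_upwards [eventually_ge_atTop R₀] with R hR
  have hR1 : 1 ≤ R := (le_max_left _ _).trans hR
  have hR0 : 0 < R := by linarith
  have hpt : ∀ x : Euc N, x ∈ closedBall (0 : Euc N) R \ closedBall 0 R₀ →
      energyDensity p q a b u v x ≤ D * R ^ m := by
    rintro x ⟨hx1, hx2⟩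
    have hxR : ‖x‖ ≤ R := by simpa using hx1
    have hx0 : R₀ < ‖x‖ := by simpa using hx2
    have hx1 : 1 ≤ ‖x‖ := (le_max_left _ _).trans hx0.le
    have key : ∀ {w c K L k : ℝ}, 0 ≤ w → 0 < k → 0 < K → 0 < L → w ≤ K * ‖x‖ ^ L →
        |c| + L * (k + 1) ≤ m → ‖x‖ ^ c * w ^ (k + 1) ≤ K ^ (k + 1) * R ^ m := by
      intro w c K L k hw hk hK hL hwK hcm
      calc ‖x‖ ^ c * w ^ (k + 1) ≤ R ^ |c| * (K * R ^ L) ^ (k + 1) := by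
            gcongr
            · exact (Real.rpow_le_rpow_of_exponent_le hx1 (le_abs_self c)).trans
                (Real.rpow_le_rpow (by positivity) hxR (abs_nonneg c))
            · exact hwK.trans (by gcongr)
        _ = K ^ (k + 1) * R ^ (|c| + L * (k + 1)) := by
            rw [Real.mul_rpow hK.le (by positivity), ← Real.rpow_mul hR0.le, Real.rpow_add hR0]
            ring
        _ ≤ _ := by
            gcongr
    have h3 := key (c := b) (k := q) (hu0 x) hq hK₁ hL₁
      ((le_abs_self _).trans (h₁ x
        (((le_max_left _ _).trans (le_max_right _ _)).trans hx0.le)))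
      (by rw [hm]; nlinarith [abs_nonneg a, mul_pos hL₂ (by linarith : 0 < p + 1)])
    have h4 := key (c := a) (k := p) (hv0 x) hp hK₂ hL₂
      ((le_abs_self _).trans (h₂ x
        (((le_max_right _ _).trans (le_max_right _ _)).trans hx0.le)))
      (by rw [hm]; nlinarith [abs_nonneg b, mul_pos hL₁ (by linarith : 0 < q + 1)])
    rw [energyDensity, hD, add_mul]
    exact add_le_add h3 h4
  have hD0 : 0 ≤ D := by positivity
  have hsplit : closedBall (0 : Euc N) R ⊆
      closedBall 0 R₀ ∪ (closedBall (0 : Euc N) R \ closedBall 0 R₀) := by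
    intro x hx
    by_cases h : x ∈ closedBall (0 : Euc N) R₀
    · exact Or.inl h
    · exact Or.inr ⟨hx, h⟩
  calc ∫⁻ x in closedBall (0 : Euc N) R, ENNReal.ofReal (energyDensity p q a b u v x)
      ≤ F₀ + ∫⁻ x in closedBall (0 : Euc N) R \ closedBall 0 R₀,
          ENNReal.ofReal (energyDensity p q a b u v x) :=
        (lintegral_mono_set hsplit).trans (lintegral_union_le _ _ _)
    _ ≤ F₀ + ∫⁻ _ in closedBall (0 : Euc N) R \ closedBall 0 R₀, ENNReal.ofReal (D * R ^ m) := by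
        gcongr 1
        refine setLIntegral_mono' (isClosed_closedBall.measurableSet.diff
          isClosed_closedBall.measurableSet) fun x hx => ENNReal.ofReal_le_ofReal (hpt x hx)
    _ ≤ F₀ + ENNReal.ofReal (D * R ^ m) * volume (closedBall (0 : Euc N) R) := by
        rw [setLIntegral_const]
        gcongr
        exact sdiff_subset
    _ = ENNReal.ofReal (F₀.toReal + D * R ^ m * (R ^ N * V.toReal)) := by
        rw [Measure.addHaar_closedBall' volume (0 : Euc N) hR0.le,
          ENNReal.ofReal_add ENNReal.toReal_nonneg (by positivity),
          ENNReal.ofReal_toReal (hfin R₀).ne, ENNReal.ofReal_mul (p := D * R ^ m) (by positivity),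
          ENNReal.ofReal_mul (p := R ^ N) (by positivity), ENNReal.ofReal_toReal hVt]
        simp [hV, hF₀]
    _ ≤ _ := by
        refine ENNReal.ofReal_le_ofReal ?_
        have e1 : 1 ≤ R ^ (m + N) := Real.one_le_rpow hR1 (by positivity)
        have e2 : R ^ (m + N) = R ^ m * R ^ N := by
          rw [Real.rpow_add hR0, Real.rpow_natCast]
        have e3 : 0 ≤ F₀.toReal := ENNReal.toReal_nonneg
        calc F₀.toReal + D * R ^ m * (R ^ N * V.toReal)
            ≤ F₀.toReal * R ^ (m + N) + D * R ^ m * (R ^ N * V.toReal) := by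
              gcongr
              exact le_mul_of_one_le_right e3 e1
          _ = _ := by rw [e2]; ring

/-- If the first component vanishes identically, so does the second. -/
lemma IsNonnegSol.snd_eq_zero_of_fst_eq_zero [NeZero N] (h : IsNonnegSol p q a b u v)
    (hp : 0 < p) (hu : ∀ x, u x = 0) (x : Euc N) : v x = 0 := by
  have hoff : ∀ y : Euc N, y ≠ 0 → v y = 0 := by
    intro y hy
    have h1 := h.lap_fst y hy
    have h2 : lap u y = 0 := by
      have : u = fun _ => 0 := funext hu
      subst this
      simp [lap]
    rw [h2] at h1
    have h3 : ‖y‖ ^ a * v y ^ p = 0 := by linarith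
    have h4 : ‖y‖ ^ a ≠ 0 := (Real.rpow_pos_of_pos (norm_pos_iff.2 hy) a).ne'
    exact (Real.rpow_eq_zero (h.nonneg_snd y) hp.ne').1 ((mul_eq_zero.1 h3).resolve_left h4)
  have hae : v =ᵐ[volume] fun _ => 0 := by
    filter_upwards [ae_ne_point (0 : Euc N)] with y hy using hoff y hy
  exact congrFun (Continuous.ae_eq_iff_eq volume h.continuous_snd continuous_const |>.1 hae) x

/-- Liouville theorem for solutions whose energy grows at most polynomially. -/
lemma IsNonnegSol.fst_eq_zero {n : ℕ} {u v : Euc (n + 1) → ℝ} (h : IsNonnegSol p q a b u v)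
    (hn : 2 ≤ n) (hq : 0 < q) (hqp : q ≤ p)
    (hpq : 1 < p * q) (ha : -2 < a) (hb : -2 < b)
    (hsub : ((n + 1 : ℕ) : ℝ) - 2 < ((n + 1 : ℕ) + a) / (p + 1) + ((n + 1 : ℕ) + b) / (q + 1))
    (hab : 4 ≤ n + 1 → 0 ≤ a - b ∧ a - b ≤ (((n + 1 : ℕ) : ℝ) - 2) * (p - q))
    (hα : (n : ℝ) - 2 < 2 * (p + 1) / (p * q - 1)) {K L : ℝ}
    (hgrowth : ∀ᶠ R in atTop, ∫⁻ x in closedBall (0 : Euc (n + 1)) R,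
      ENNReal.ofReal (energyDensity p q a b u v x) ≤ ENNReal.ofReal (K * R ^ L))
    (x : Euc (n + 1)) : u x = 0 := by
  by_contra hx
  have hp : 0 < p := hq.trans_le hqp
  have hN : 3 ≤ n + 1 := by omega
  have hpq0 : 0 < p * q - 1 := by linarith
  obtain ⟨C, hC, θ, hθ, hθ1, hgain⟩ :=
    IsNonnegSol.exists_energy_gain hn hq hqp hpq ha hb hsub hab hα
  have hfin := h.lintegral_energyDensity_lt_top hN hp hq hpq ha hb
  have hpos := h.lintegral_energyDensity_pos hN hp ha ⟨x, hx⟩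
  have hE := measurable_energyDensity (p := p) (q := q) (a := a) (b := b)
    h.continuous_fst h.continuous_snd
  set F : ℝ → ENNReal := fun r => ∫⁻ x in closedBall (0 : Euc (n + 1)) r,
    ENNReal.ofReal (energyDensity p q a b u v x) with hF
  have hFmono : Monotone F := fun r r' hr =>
    lintegral_mono_set (closedBall_subset_closedBall hr)
  set s := ((b + 2) * p + a + 2) / (p * q - 1) with hs
  set t := ((a + 2) * q + b + 2) / (p * q - 1) with ht
  have es : s * (p * q - 1) = (b + 2) * p + a + 2 := div_mul_cancel₀ _ hpq0.ne'
  have et : t * (p * q - 1) = (a + 2) * q + b + 2 := div_mul_cancel₀ _ hpq0.ne'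
  have h1 : s + 2 + a = p * t :=
    mul_right_cancel₀ hpq0.ne' (by linear_combination es - p * et)
  have h2 : t + 2 + b = q * s :=
    mul_right_cancel₀ hpq0.ne' (by linear_combination et - q * es)
  set σ := s + t + 2 - ((n + 1 : ℕ) : ℝ) with hσ
  have hσ0 : 0 < σ := by
    have e : ((n + 1 : ℕ) + a) / (p + 1) + ((n + 1 : ℕ) + b) / (q + 1) - (((n + 1 : ℕ) : ℝ) - 2)
        = (p * q - 1) / ((p + 1) * (q + 1)) * σ := by
      rw [hσ, hs, ht]
      generalize ((n + 1 : ℕ) : ℝ) = M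
      field_simp
      ring
    have e1 : 0 < (p * q - 1) / ((p + 1) * (q + 1)) := by positivity
    exact pos_of_mul_pos_right (by rw [← e]; linarith) e1.le
  set ρ : ℝ := 2 * (n + 1) + 1 with hρ
  have hρ1 : 1 < ρ := by rw [hρ]; linarith [n.cast_nonneg (α := ℝ)]
  have hρ0 : 0 < ρ := by linarith
  set G : ℕ → ENNReal := fun k => ENNReal.ofReal ((ρ ^ k) ^ σ) * F (ρ ^ k) with hG
  have hGt : ∀ k, G k ≠ ⊤ := fun k => ENNReal.mul_ne_top ENNReal.ofReal_ne_top (hfin _).ne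
  have hstep : ∀ k, G k ≤ C * max 1 (G (k + 1)) ^ θ := by
    intro k
    have hRk : 0 < ρ ^ k := by positivity
    have hsol := h.comp_smul hRk h1 h2
    have h3 := lintegral_energyDensity_comp_smul h.nonneg_fst h.nonneg_snd hE hRk h1 h2
    have h4 := hgain _ _ hsol
      ⟨(ρ ^ k)⁻¹ • x, by
        simp only [smul_smul, mul_inv_cancel₀ hRk.ne', one_smul]
        exact mul_ne_zero (Real.rpow_pos_of_pos hRk s).ne' hx⟩
      (max 1 (G (k + 1))) (le_max_left _ _) (max_ne_top ENNReal.one_ne_top (hGt _)) ?_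
    · rw [h3, mul_one] at h4
      exact h4
    · rw [h3]
      refine le_trans ?_ (le_max_right _ _)
      have h5 : ρ ^ k * ρ = ρ ^ (k + 1) := (pow_succ ρ k).symm
      have h6 : ρ ^ k ≤ ρ ^ (k + 1) := pow_le_pow_right₀ hρ1.le (by omega)
      rw [h5]
      simp only [hG, hF]
      gcongr
  refine not_tendsto_atTop_of_le_rpow_succ (g := fun k => (G k).toReal) (C := C.toReal)
    (K := K) (B := ρ ^ (σ + L)) (θ := θ) ENNReal.toReal_nonneg (by positivity) hθ hθ1
    (fun k => ?_) ?_ ?_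
  · have h3 := ENNReal.toReal_mono (ENNReal.mul_ne_top hC (ENNReal.rpow_ne_top_of_nonneg hθ
      (max_ne_top ENNReal.one_ne_top (hGt (k + 1))))) (hstep k)
    rwa [ENNReal.toReal_mul (a := C), ← ENNReal.toReal_rpow,
      ENNReal.toReal_max ENNReal.one_ne_top (hGt _), ENNReal.toReal_one] at h3
  · filter_upwards [(tendsto_pow_atTop_atTop_of_one_lt hρ1).eventually hgrowth] with k hk
    have hRk : 0 < ρ ^ k := by positivity
    have hKL : 0 < K * (ρ ^ k) ^ L := by
      refine ENNReal.ofReal_pos.1 (lt_of_lt_of_le hpos (le_trans ?_ hk))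
      exact hFmono (one_le_pow₀ hρ1.le)
    have h3 : G k ≤ ENNReal.ofReal (K * (ρ ^ (σ + L)) ^ k) := by
      have e : K * (ρ ^ (σ + L)) ^ k = (ρ ^ k) ^ σ * (K * (ρ ^ k) ^ L) := by
        rw [← Real.rpow_natCast (ρ ^ (σ + L)), ← Real.rpow_mul hρ0.le, mul_comm (σ + L),
          Real.rpow_mul hρ0.le, Real.rpow_natCast, Real.rpow_add hRk]
        ring
      rw [e, ENNReal.ofReal_mul (by positivity)]
      exact mul_le_mul_right hk _
    have h4 : 0 ≤ K * (ρ ^ (σ + L)) ^ k := by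
      have hK : 0 < K := pos_of_mul_pos_left hKL (by positivity)
      positivity
    exact ENNReal.toReal_le_of_le_ofReal h4 h3
  · have hF1 : 0 < (F 1).toReal := ENNReal.toReal_pos hpos.ne' (hfin 1).ne
    refine tendsto_atTop_mono (f := fun k : ℕ => (ρ ^ k) ^ σ * (F 1).toReal) (fun k => ?_) ?_
    · have hRk : 0 < ρ ^ k := by positivity
      simp only [hG]
      rw [ENNReal.toReal_mul, ENNReal.toReal_ofReal (by positivity)]
      have h5 : (F 1).toReal ≤ (F (ρ ^ k)).toReal :=
        ENNReal.toReal_mono (hfin _).ne (hFmono (one_le_pow₀ hρ1.le))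
      gcongr
    · exact (((tendsto_rpow_atTop hσ0).comp
        (tendsto_pow_atTop_atTop_of_one_lt hρ1)).atTop_mul_const hF1)

end Liouville

/-- Theorem 3.27: Liouville theorem for nonnegative solutions of the subcritical
Hénon–Lane–Emden system when `α > N - 3`. -/
theorem stmt_18 (N : ℕ) (hN : 3 ≤ N) (p q a b : ℝ)
    (hq : 0 < q) (hqp : q ≤ p) (hpq : 1 < p * q)
    (ha : -2 < a) (hb : -2 < b)
    (hsub : ((N : ℝ) + a) / (p + 1) + ((N : ℝ) + b) / (q + 1) > (N : ℝ) - 2)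
    (hab : 4 ≤ N → 0 ≤ a - b ∧ a - b ≤ ((N : ℝ) - 2) * (p - q))
    (u v : Euc N → ℝ)
    (hsol : IsHLESol p q a b u v) (hu : ∀ x, 0 ≤ u x) (hv : ∀ x, 0 ≤ v x)
    (hbd : (PolyBounded u ∧ PolyBounded v) ∨
      (∫⁻ x : Euc N, ENNReal.ofReal (‖x‖ ^ b * u x ^ (q + 1) + ‖x‖ ^ a * v x ^ (p + 1))) < ⊤)
    (hα : (N : ℝ) - 3 < 2 * (p + 1) / (p * q - 1)) :
    ∀ x, u x = 0 ∧ v x = 0 := by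
  have hp : 0 < p := hq.trans_le hqp
  obtain ⟨n, rfl⟩ : ∃ n, N = n + 1 := ⟨N - 1, by omega⟩
  have h := hsol.isNonnegSol hp hq hu hv
  have hgrowth : ∃ K L : ℝ, ∀ᶠ R in Filter.atTop, ∫⁻ x in closedBall (0 : Euc (n + 1)) R,
      ENNReal.ofReal (energyDensity p q a b u v x) ≤ ENNReal.ofReal (K * R ^ L) := by
    rcases hbd with ⟨hbu, hbv⟩ | hfin
    · exact exists_lintegral_energyDensity_le_of_polyBounded hp hq hbu hbv hu hv
        (h.lintegral_energyDensity_lt_top hN hp hq hpq ha hb)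
    · refine ⟨(∫⁻ x, ENNReal.ofReal (energyDensity p q a b u v x)).toReal, 0,
        Filter.Eventually.of_forall fun R => ?_⟩
      rw [Real.rpow_zero, mul_one, ENNReal.ofReal_toReal (by exact hfin.ne)]
      exact setLIntegral_le_lintegral _ _
  obtain ⟨K, L, hKL⟩ := hgrowth
  have hu0 : ∀ x, u x = 0 := h.fst_eq_zero (by omega) hq hqp hpq ha hb hsub hab
    (by push_cast at hα; linarith) hKL
  exact fun x => ⟨hu0 x, h.snd_eq_zero_of_fst_eq_zero hp hu0 x⟩
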